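/- arXiv:1409.5685 — 2 statements merged into one kernel-verified Lean document; each statement's English description precedes it below -/
import Mathlib

section
/- For every integer m ≥ 3, S(m) > e^{m−1}/(m − 1). -/
/-- The k-th prime, 1-indexed: `nthPrime 1 = 2`. -/
noncomputable def nthPrime (k : ℕ) : ℕ := Nat.nth Nat.Prime (k - 1)

/-- `IsS m S` says that `S` is the maximum of `{k*m - p_k : k ≥ 1}`. -/
def IsS (m : ℕ) (S : ℤ) : Prop :=
  IsGreatest {a : ℤ | ∃ k : ℕ, 0 < k ∧ a = (k : ℤ) * m - nthPrime k} S

section ZZ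
open Complex MeasureTheory Filter Topology Set



/-- periodic Bernoulli-type cubic -/
noncomputable def zzB (x : ℝ) : ℝ :=
  Int.fract x ^ 3 - 3 / 2 * Int.fract x ^ 2 + 1 / 2 * Int.fract x

lemma zzB_bound (x : ℝ) : |zzB x| ≤ 1 / 20 := by
  have h0 := Int.fract_nonneg x
  have h1 := (Int.fract_lt_one x).le
  unfold zzB
  set y := Int.fract x
  rw [abs_le]
  constructor
  · nlinarith [mul_nonneg (sub_nonneg.2 h1) (sq_nonneg (y - 789/1000)), mul_nonneg h0 (sq_nonneg (y - 789/1000)), sq_nonneg (y-789/1000)]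
  · nlinarith [mul_nonneg h0 (sq_nonneg (y - 211/1000)), mul_nonneg (sub_nonneg.2 h1) (sq_nonneg (y - 211/1000)), sq_nonneg (y-211/1000)]

lemma zzB_meas : Measurable zzB := by
  unfold zzB
  have := measurable_fract (R := ℝ)
  fun_prop

lemma zz_cpow_deriv (r : ℂ) {x : ℝ} (hx : 0 < x) :
    HasDerivAt (fun y : ℝ => (y : ℂ) ^ r) (r * (x : ℂ) ^ (r - 1)) x := by
  by_cases hr : r = 0
  · subst hr
    simpa using hasDerivAt_const x (1 : ℂ)
  · simpa using hasDerivAt_ofReal_cpow_const hx.ne' hr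

lemma zz_poly_deriv (n : ℝ) (x : ℝ) :
    HasDerivAt (fun y : ℝ => ((((y - n) ^ 3 - 3 / 2 * (y - n) ^ 2 + 1 / 2 * (y - n)) : ℝ) : ℂ))
      (((3 * ((x - n) ^ 2 - (x - n) + 1 / 6) : ℝ)) : ℂ) x := by
  apply HasDerivAt.ofReal_comp
  have h : HasDerivAt (fun y : ℝ => y - n) 1 x := (hasDerivAt_id x).sub_const n
  have k := ((h.pow 3).sub ((h.pow 2).const_mul (3 / 2))).add (h.const_mul (1/2))
  exact k.congr_deriv (by push_cast; ring)

lemma zz_poly_deriv2 (n : ℝ) (x : ℝ) :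
    HasDerivAt (fun y : ℝ => ((((y - n) ^ 2 - (y - n) + 1 / 6) : ℝ) : ℂ))
      (((2 * ((x - n) - 1 / 2) : ℝ)) : ℂ) x := by
  apply HasDerivAt.ofReal_comp
  have h : HasDerivAt (fun y : ℝ => y - n) 1 x := (hasDerivAt_id x).sub_const n
  have k := ((h.pow 2).sub h).add_const (1 / 6)
  exact k.congr_deriv (by push_cast; ring)

lemma zz_poly_deriv1 (n : ℝ) (x : ℝ) :
    HasDerivAt (fun y : ℝ => ((((y - n) - 1 / 2) : ℝ) : ℂ)) ((1 : ℝ) : ℂ) x := by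
  apply HasDerivAt.ofReal_comp
  exact ((hasDerivAt_id x).sub_const n).sub_const _

lemma zz_intgb (s : ℂ) {a b : ℝ} (ha : 0 < a) (hb : 0 < b) :
    IntervalIntegrable (fun x : ℝ => (zzB x : ℂ) * (x : ℂ) ^ (-s - 3)) volume a b := by
  have h1 : IntervalIntegrable (fun x : ℝ => (x : ℂ) ^ (-s - 3)) volume a b := by
    apply ContinuousOn.intervalIntegrable
    intro x hx
    have : 0 < x := lt_of_lt_of_le (lt_min ha hb) hx.1
    exact (zz_cpow_deriv _ this).continuousAt.continuousWithinAt
  have h2 : ∀ S : Set ℝ, IntegrableOn (fun x : ℝ => (x : ℂ) ^ (-s - 3)) S →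
      IntegrableOn (fun x : ℝ => (zzB x : ℂ) * (x : ℂ) ^ (-s - 3)) S := fun S hS =>
    Integrable.bdd_mul (c := 1 / 20) hS
      (measurable_ofReal.comp zzB_meas).aestronglyMeasurable
      (Eventually.of_forall fun x => by
        rw [Complex.norm_real, Real.norm_eq_abs]; exact zzB_bound x)
  exact ⟨h2 _ h1.1, h2 _ h1.2⟩

/-- one step of Euler-Maclaurin -/
lemma zz_step (s : ℂ) (hs : s ≠ 1) (n : ℕ) (hn : 1 ≤ n) :
    (((n + 1 : ℕ) : ℂ) ^ (1 - s) - (n : ℂ) ^ (1 - s)) / (1 - s)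
      - s * (s + 1) * (s + 2) / 6 * ∫ x in (n : ℝ)..(n + 1 : ℕ), (zzB x : ℂ) * (x : ℂ) ^ (-s - 3)
    = s / 12 * (((n + 1 : ℕ) : ℂ) ^ (-s - 1) - (n : ℂ) ^ (-s - 1))
      + (((n + 1 : ℕ) : ℂ) ^ (-s) + (n : ℂ) ^ (-s)) / 2 := by
  have hn0 : (0 : ℝ) < n := by exact_mod_cast hn
  have hs' : (1 - s) ≠ 0 := fun h => hs (sub_eq_zero.1 h).symm
  set P : ℝ → ℂ := fun x => ((((x - n) ^ 3 - 3 / 2 * (x - n) ^ 2 + 1 / 2 * (x - n)) : ℝ) : ℂ) with hP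
  have hcong : ∫ x in (n : ℝ)..(n + 1 : ℕ), (zzB x : ℂ) * (x : ℂ) ^ (-s - 3)
      = ∫ x in (n : ℝ)..(n + 1 : ℕ), P x * (x : ℂ) ^ (-s - 3) := by
    apply intervalIntegral.integral_congr_ae
    have : ∀ᵐ x : ℝ, x ≠ (n + 1 : ℕ) := by
      simp [ae_iff, measure_singleton]
    filter_upwards [this] with x hx hx2
    rw [uIoc_of_le (by push_cast; linarith)] at hx2
    have hfl : Int.fract x = x - n := by
      rw [Int.fract_eq_iff]
      refine ⟨by linarith [hx2.1], ?_, n, by simp⟩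
      have := lt_of_le_of_ne hx2.2 hx
      push_cast at this; linarith
    simp only [zzB, hfl, hP]
  rw [hcong]
  set Φ : ℝ → ℂ := fun x => P x / 6 * (s * (s + 1) * (x : ℂ) ^ (-s - 2))
      + ((((x - n) ^ 2 - (x - n) + 1 / 6) : ℝ) : ℂ) / 2 * (s * (x : ℂ) ^ (-s - 1))
      + ((((x - n) - 1 / 2) : ℝ) : ℂ) * (x : ℂ) ^ (-s) - (x : ℂ) ^ (1 - s) / (1 - s) with hΦ
  have hd : ∀ x ∈ uIcc (n : ℝ) (n + 1 : ℕ), HasDerivAt Φ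
      (- (s * (s + 1) * (s + 2) / 6) * (P x * (x : ℂ) ^ (-s - 3))) x := by
    intro x hx
    rw [uIcc_of_le (by push_cast; linarith)] at hx
    have hx0 : 0 < x := lt_of_lt_of_le hn0 hx.1
    have h3 := zz_poly_deriv n x
    have h2 := zz_poly_deriv2 n x
    have h1 := zz_poly_deriv1 n x
    have e2 := zz_cpow_deriv (-s - 2) hx0
    have e1 := zz_cpow_deriv (-s - 1) hx0
    have e0 := zz_cpow_deriv (-s) hx0
    have em := zz_cpow_deriv (1 - s) hx0
    have r2 : -s - 2 - 1 = -s - 3 := by ring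
    have r1 : -s - 1 - 1 = -s - 2 := by ring
    have r0 : 1 - s - 1 = -s := by ring
    rw [r2] at e2; rw [r1] at e1; rw [r0] at em
    have k := ((((h3.div_const 6).mul (e2.const_mul (s * (s + 1)))).add
      ((h2.div_const 2).mul (e1.const_mul s))).add (h1.mul e0)).sub (em.div_const (1 - s))
    refine k.congr_deriv ?_
    simp only [hP]
    push_cast
    field_simp
    ring
  have hintg := intervalIntegral.integral_eq_sub_of_hasDerivAt hd (by
    apply IntervalIntegrable.const_mul
    apply ContinuousOn.intervalIntegrable
    intro x hx
    rw [uIcc_of_le (by push_cast; linarith)] at hx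
    have hx0 : 0 < x := lt_of_lt_of_le hn0 hx.1
    exact ((zz_poly_deriv n x).continuousAt.mul
      (zz_cpow_deriv _ hx0).continuousAt).continuousWithinAt)
  rw [intervalIntegral.integral_const_mul] at hintg
  have : ∀ A : ℂ, A - s * (s + 1) * (s + 2) / 6 * ∫ x in (n : ℝ)..(n + 1 : ℕ), P x * (x : ℂ) ^ (-s - 3) = A + (Φ (n + 1 : ℕ) - Φ n) := by
    intro A; rw [← hintg]; ring
  rw [this]
  simp only [hΦ, hP]
  push_cast
  ring

/-- finite Euler-Maclaurin from 1 to K -/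
lemma zz_fin (s : ℂ) (hs : s ≠ 1) (K : ℕ) (hK : 1 ≤ K) :
    ∑ n ∈ Finset.Ico 1 K, (n : ℂ) ^ (-s) =
      (1 / (s - 1) + 1 / 2 + s / 12) + ((K : ℂ) ^ (1 - s) / (1 - s) - (K : ℂ) ^ (-s) / 2
        - s / 12 * (K : ℂ) ^ (-s - 1))
      - s * (s + 1) * (s + 2) / 6 * ∫ x in (1 : ℝ)..K, (zzB x : ℂ) * (x : ℂ) ^ (-s - 3) := by
  have hs' : (1 - s) ≠ 0 := fun h => hs (sub_eq_zero.1 h).symm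
  have hs'' : (s - 1) ≠ 0 := sub_ne_zero.2 hs
  induction K, hK using Nat.le_induction with
  | base =>
    simp
    field_simp
    ring
  | succ K hK ih =>
    have hK0 : (0 : ℝ) < K := by exact_mod_cast hK
    rw [Finset.sum_Ico_succ_top hK, ih]
    have h := zz_step s hs K hK
    have hadd := intervalIntegral.integral_add_adjacent_intervals
      (zz_intgb s one_pos hK0) (zz_intgb s hK0 (show (0 : ℝ) < (K + 1 : ℕ) by positivity))
    rw [← hadd]
    linear_combination -h

noncomputable def zzJ (s : ℂ) : ℂ := ∫ x in Ioi (1 : ℝ), (zzB x : ℂ) * (x : ℂ) ^ (-s - 3)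

lemma zzJ_norm_int (s : ℂ) (hs : -2 < s.re) {N : ℝ} (hN : 0 < N) :
    IntegrableOn (fun x : ℝ => (zzB x : ℂ) * (x : ℂ) ^ (-s - 3)) (Ioi N) := by
  refine Integrable.bdd_mul (c := 1 / 20) (integrableOn_Ioi_cpow_of_lt (by simp; linarith) hN)
      (measurable_ofReal.comp zzB_meas).aestronglyMeasurable
      (Eventually.of_forall fun x => by
        rw [Complex.norm_real, Real.norm_eq_abs]; exact zzB_bound x)

lemma zzJ_tail_bound (s : ℂ) (hs : -2 < s.re) {N : ℝ} (hN : 0 < N) :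
    ‖∫ x in Ioi N, (zzB x : ℂ) * (x : ℂ) ^ (-s - 3)‖ ≤
      1 / 20 * (N ^ (-s.re - 2) / (s.re + 2)) := by
  have h1 : ∫ x in Ioi N, (1 / 20 : ℝ) * x ^ (-s.re - 3) = 1 / 20 * (N ^ (-s.re - 2) / (s.re + 2)) := by
    rw [integral_const_mul, integral_Ioi_rpow_of_lt (by linarith) hN]
    rw [show -s.re - 3 + 1 = -(s.re + 2) by ring, show -s.re - 2 = -(s.re + 2) by ring, neg_div_neg_eq]
  rw [← h1]
  apply norm_integral_le_of_norm_le
  · exact (integrableOn_Ioi_rpow_of_lt (by linarith) hN).const_mul _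
  · rw [ae_restrict_iff' measurableSet_Ioi]
    refine Eventually.of_forall fun x hx => ?_
    have hx0 : 0 < x := hN.trans hx
    rw [norm_mul, Complex.norm_real, Real.norm_eq_abs, norm_cpow_eq_rpow_re_of_pos hx0]
    have : (-s - 3).re = -s.re - 3 := by simp
    rw [this]
    exact mul_le_mul_of_nonneg_right (zzB_bound x) (Real.rpow_nonneg hx0.le _)

lemma zzJ_bound (s : ℂ) (hs : -2 < s.re) : ‖zzJ s‖ ≤ 1 / 20 / (s.re + 2) := by
  have := zzJ_tail_bound s hs one_pos
  simpa [zzJ, div_eq_mul_inv] using this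

lemma zzJ_diff (s : ℂ) (hs : -2 < s.re) : DifferentiableAt ℂ zzJ s := by
  set f : ℝ → ℂ := (Ioi (1 : ℝ)).indicator (fun x => (zzB x : ℂ)) with hf
  have hfb : ∀ x, ‖f x‖ ≤ 1 / 20 := by
    intro x
    rw [hf]
    refine (norm_indicator_le_norm_self _ _).trans ?_
    rw [Complex.norm_real, Real.norm_eq_abs]; exact zzB_bound x
  have hfm : Measurable f := (measurable_ofReal.comp zzB_meas).indicator measurableSet_Ioi
  have hJ : zzJ = fun s => mellin f (-s - 2) := by
    funext s
    unfold zzJ mellin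
    have : ∀ t : ℝ, (t : ℂ) ^ (-s - 2 - 1) • f t
        = (Ioi (1 : ℝ)).indicator (fun x : ℝ => (zzB x : ℂ) * (x : ℂ) ^ (-s - 3)) t := by
      intro t
      rw [hf, show -s - 2 - 1 = -s - 3 by ring]
      by_cases h : t ∈ Ioi (1 : ℝ)
      · simp only [indicator_of_mem h, smul_eq_mul]; ring
      · simp only [indicator_of_notMem h, smul_zero]
    simp_rw [this]
    rw [setIntegral_indicator measurableSet_Ioi]
    congr 2
    ext x
    simp only [mem_inter_iff, mem_Ioi]
    constructor
    · intro h; exact ⟨by linarith, h⟩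
    · exact fun h => h.2
  rw [hJ]
  have h1 : DifferentiableAt ℂ (mellin f) (-s - 2) := by
    apply mellin_differentiableAt_of_isBigO_rpow (a := 0) (b := (-s - 2).re - 1)
    · intro x hx
      refine ⟨Icc (x - 1) (x + 1), mem_nhdsWithin_of_mem_nhds (Icc_mem_nhds (by linarith) (by linarith)), ?_⟩
      refine Measure.integrableOn_of_bounded (M := 1 / 20) (by simp) hfm.aestronglyMeasurable ?_
      exact Eventually.of_forall hfb
    · simp only [neg_zero, Real.rpow_zero]
      exact Asymptotics.isBigO_of_le' _ (c := 1 / 20) (by simpa using hfb)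
    · simp; linarith
    · refine Asymptotics.IsBigO.of_bound 1 ?_
      have : Ioo (0 : ℝ) 1 ∈ 𝓝[>] (0 : ℝ) := Ioo_mem_nhdsGT one_pos
      filter_upwards [this] with x hx
      have : f x = 0 := by
        rw [hf, indicator_of_notMem]; simp; exact hx.2.le
      rw [this]; simp
    · linarith
  exact DifferentiableAt.comp (f := fun s : ℂ => -s - 2) s h1 (by fun_prop)

/-- `h(s) = (s-1) ζ(s)` by Euler-Maclaurin. -/
noncomputable def zzH (s : ℂ) : ℂ :=
  (s + 2) * (s + 3) / 12 - (s - 1) * s * (s + 1) * (s + 2) / 6 * zzJ s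

lemma zzH_diff (s : ℂ) (hs : -2 < s.re) : DifferentiableAt ℂ zzH s := by
  have := zzJ_diff s hs
  unfold zzH
  fun_prop

lemma zzH_eq (s : ℂ) (hs : 1 < s.re) : zzH s = (s - 1) * riemannZeta s := by
  have hs1 : s ≠ 1 := by rintro rfl; simp at hs
  have h1 : Tendsto (fun K : ℕ => ∑ n ∈ Finset.Ico 1 K, (n : ℂ) ^ (-s)) atTop (𝓝 (riemannZeta s)) := by
    have hz := zeta_eq_tsum_one_div_nat_cpow hs
    have hsum : Summable (fun n : ℕ => 1 / (n : ℂ) ^ s) := Complex.summable_one_div_nat_cpow.2 hs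
    have := hsum.hasSum.tendsto_sum_nat
    rw [← hz] at this
    refine this.congr' ?_
    filter_upwards [eventually_ge_atTop 1] with K hK
    rw [Finset.range_eq_Ico, Finset.sum_eq_sum_Ico_succ_bot (by omega)]
    have : s ≠ 0 := by rintro rfl; simp at hs; linarith
    simp [this, cpow_neg]
  have hpow : ∀ r : ℂ, r.re < 0 → Tendsto (fun K : ℕ => (K : ℂ) ^ r) atTop (𝓝 0) := by
    intro r hr
    rw [tendsto_zero_iff_norm_tendsto_zero]
    have : Tendsto (fun K : ℕ => (K : ℝ) ^ (-(-r.re))) atTop (𝓝 0) :=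
      (tendsto_rpow_neg_atTop (by linarith)).comp tendsto_natCast_atTop_atTop
    refine this.congr' ?_
    filter_upwards [eventually_gt_atTop 0] with K hK
    have hK' : (0 : ℝ) < K := by exact_mod_cast hK
    have := norm_cpow_eq_rpow_re_of_pos hK' r
    simp only [ofReal_natCast] at this
    rw [this, neg_neg]
  have h2 : Tendsto (fun K : ℕ => (1 / (s - 1) + 1 / 2 + s / 12) + ((K : ℂ) ^ (1 - s) / (1 - s) - (K : ℂ) ^ (-s) / 2
        - s / 12 * (K : ℂ) ^ (-s - 1))
      - s * (s + 1) * (s + 2) / 6 * ∫ x in (1 : ℝ)..K, (zzB x : ℂ) * (x : ℂ) ^ (-s - 3)) atTop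
      (𝓝 ((1 / (s - 1) + 1 / 2 + s / 12) + (0 / (1 - s) - 0 / 2 - s / 12 * 0)
        - s * (s + 1) * (s + 2) / 6 * zzJ s)) := by
    refine Tendsto.sub (tendsto_const_nhds.add (((hpow _ (by simp; linarith)).div_const _).sub
      ((hpow _ (by simp; linarith)).div_const _) |>.sub ((hpow _ (by simp; linarith)).const_mul _))) ?_
    refine Tendsto.const_mul _ ?_
    exact intervalIntegral_tendsto_integral_Ioi 1 (zzJ_norm_int s (by linarith) one_pos)
      tendsto_natCast_atTop_atTop
  have h3 := tendsto_nhds_unique (h1.congr' (by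
    filter_upwards [eventually_ge_atTop 1] with K hK
    exact zz_fin s hs1 K hK)) h2
  rw [h3]
  unfold zzH
  have : s - 1 ≠ 0 := sub_ne_zero.2 hs1
  field_simp
  ring

/-- second expression (cut at 2) -/
lemma zzH_two (s : ℂ) (hs : -2 < s.re) (hs1 : s ≠ 1) : zzH s = (s - 1) * (1
    + (2 : ℂ) ^ (-s) * (2 / (s - 1) + 1 / 2 + s / 24)
    - s * (s + 1) * (s + 2) / 6 * ∫ x in Ioi (2 : ℝ), (zzB x : ℂ) * (x : ℂ) ^ (-s - 3)) := by
  have h := zz_fin s hs1 2 (by norm_num)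
  have hJ : zzJ s = (∫ x in (1 : ℝ)..(2 : ℕ), (zzB x : ℂ) * (x : ℂ) ^ (-s - 3))
      + ∫ x in Ioi (2 : ℝ), (zzB x : ℂ) * (x : ℂ) ^ (-s - 3) := by
    unfold zzJ
    have := intervalIntegral.integral_Ioi_sub_Ioi (zzJ_norm_int s hs one_pos) (show (1 : ℝ) ≤ 2 by norm_num)
    push_cast
    rw [← this]; ring
  have e : Finset.Ico 1 2 = {1} := by decide
  rw [e] at h
  simp only [Finset.sum_singleton, Nat.cast_one, one_cpow] at h
  rw [zzH, hJ]
  have hne : s - 1 ≠ 0 := sub_ne_zero.2 hs1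
  have hne' : 1 - s ≠ 0 := fun h => hs1 (sub_eq_zero.1 h).symm
  have e1 : ((2 : ℕ) : ℂ) ^ (1 - s) = 2 * (2 : ℂ) ^ (-s) := by
    rw [sub_eq_add_neg, cpow_add _ _ (by norm_num)]; simp
  have e2 : ((2 : ℕ) : ℂ) ^ (-s - 1) = (2 : ℂ) ^ (-s) / 2 := by
    rw [cpow_sub _ _ (by norm_num)]; simp
  rw [e1, e2] at h
  simp only [Nat.cast_ofNat] at h ⊢
  set I1 := ∫ x in (1 : ℝ)..2, (zzB x : ℂ) * (x : ℂ) ^ (-s - 3)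
  set I2 := ∫ x in Ioi (2 : ℝ), (zzB x : ℂ) * (x : ℂ) ^ (-s - 3)
  set T := (2 : ℂ) ^ (-s)
  have e3 : 2 * T / (1 - s) = - (2 * T / (s - 1)) := by
    rw [← neg_sub s 1, div_neg]
  rw [e3] at h
  have e4 : (s - 1) * (1 / (s - 1)) = 1 := by field_simp
  have e5 : (s - 1) * (2 * T / (s - 1)) = 2 * T := by field_simp
  have e6 : (s - 1) * (T * (2 / (s - 1))) = 2 * T := by field_simp
  linear_combination (-(s - 1)) * h - e4 + e5 - e6


lemma zz_norm_le {z : ℂ} {c : ℝ} (hc : 0 ≤ c) (h : z.re ^ 2 + z.im ^ 2 ≤ c ^ 2) : ‖z‖ ≤ c := by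
  refine abs_le_of_sq_le_sq' ?_ hc |>.2
  rw [Complex.sq_norm, Complex.normSq_apply]; nlinarith

lemma zz_le_norm {z : ℂ} {c : ℝ} (h : c ^ 2 ≤ z.re ^ 2 + z.im ^ 2) : c ≤ ‖z‖ := by
  have h2 : c ^ 2 ≤ ‖z‖ ^ 2 := by
    rw [Complex.sq_norm, Complex.normSq_apply]; nlinarith
  have h3 := sq_le_sq.1 h2
  rw [abs_of_nonneg (norm_nonneg z)] at h3
  exact (le_abs_self c).trans h3

noncomputable def zzQ (r : ℝ) : ℝ :=
  (r + 3) * (r + 4) / 12 + r * (r + 1) * (r + 2) * (r + 3) / 180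

lemma zzQ_mono {a b : ℝ} (ha : 0 ≤ a) (hab : a ≤ b) : zzQ a ≤ zzQ b := by
  have hb : 0 ≤ b := ha.trans hab
  unfold zzQ; gcongr

lemma zzH_up (s : ℂ) (hs : -1 / 2 ≤ s.re) {r : ℝ} (hr : ‖s - 1‖ ≤ r) : ‖zzH s‖ ≤ zzQ r := by
  have hJ := zzJ_bound s (by linarith)
  have hJ' : ‖zzJ s‖ ≤ 1 / 30 := hJ.trans (by
    rw [div_le_iff₀ (by linarith)]; linarith)
  have h0 := norm_nonneg (s - 1)
  have e : ∀ k : ℝ, 0 ≤ k → ‖(s - 1) + (k : ℂ)‖ ≤ r + k := fun k hk => by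
    refine (norm_add_le _ _).trans ?_
    rw [Complex.norm_real, Real.norm_of_nonneg hk]; linarith
  have e1 : ‖s‖ ≤ r + 1 := by
    have := e 1 (by norm_num); simpa using this
  have e2 : ‖s + 1‖ ≤ r + 2 := by
    have := e 2 (by norm_num); push_cast at this; convert this using 2; ring
  have e3 : ‖s + 2‖ ≤ r + 3 := by
    have := e 3 (by norm_num); push_cast at this; convert this using 2; ring
  have e4 : ‖s + 3‖ ≤ r + 4 := by
    have := e 4 (by norm_num); push_cast at this; convert this using 2; ring
  have hr0 : 0 ≤ r := h0.trans hr
  unfold zzH zzQ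
  refine (norm_sub_le _ _).trans ?_
  simp only [norm_mul, norm_div]
  have a1 : ‖s + 2‖ * ‖s + 3‖ ≤ (r + 3) * (r + 4) := by gcongr
  have a2 : ‖s - 1‖ * ‖s‖ * ‖s + 1‖ * ‖s + 2‖ ≤ r * (r + 1) * (r + 2) * (r + 3) := by gcongr
  have a3 : ‖s - 1‖ * ‖s‖ * ‖s + 1‖ * ‖s + 2‖ * ‖zzJ s‖ ≤ r * (r + 1) * (r + 2) * (r + 3) * (1 / 30) := by gcongr
  have n1 : ‖(12 : ℂ)‖ = 12 := by simp
  have n2 : ‖(6 : ℂ)‖ = 6 := by simp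
  rw [n1, n2]
  linarith

lemma zzH_dco (s : ℂ) (hs : 1 / 2 ≤ s.re) : DiffContOnCl ℂ zzH (Metric.ball s 1) := by
  apply DifferentiableOn.diffContOnCl
  intro z hz
  apply (zzH_diff z ?_).differentiableWithinAt
  have := Metric.closure_ball_subset_closedBall hz
  rw [Metric.mem_closedBall, dist_eq_norm] at this
  have h2 := (abs_re_le_norm (z - s)).trans this
  rw [abs_le, sub_re] at h2
  linarith [h2.1]

lemma zzH_sphere (s : ℂ) (hs : 1 / 2 ≤ s.re) {r : ℝ} (hr : ‖s - 1‖ + 1 ≤ r) :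
    ∀ z ∈ Metric.sphere s 1, ‖zzH z‖ ≤ zzQ r := by
  intro z hz
  rw [mem_sphere_iff_norm] at hz
  apply zzH_up
  · have h2 := (abs_re_le_norm (z - s)).trans hz.le
    rw [abs_le, sub_re] at h2
    linarith [h2.1]
  · have : z - 1 = (z - s) + (s - 1) := by ring
    rw [this]
    refine (norm_add_le _ _).trans (by linarith)

lemma zzH_d1 (s : ℂ) (hs : 1 / 2 ≤ s.re) {r : ℝ} (hr : ‖s - 1‖ + 1 ≤ r) :
    ‖deriv zzH s‖ ≤ zzQ r := by
  have := norm_deriv_le_of_forall_mem_sphere_norm_le one_pos (zzH_dco s hs) (zzH_sphere s hs hr)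
  simpa using this

lemma zzH_d2 (s : ℂ) (hs : 1 / 2 ≤ s.re) {r : ℝ} (hr : ‖s - 1‖ + 1 ≤ r) :
    ‖deriv (deriv zzH) s‖ ≤ 2 * zzQ r := by
  have := norm_iteratedDeriv_le_of_forall_mem_sphere_norm_le 2 one_pos (zzH_dco s hs) (zzH_sphere s hs hr)
  rw [iteratedDeriv_succ, iteratedDeriv_one] at this
  simpa using this

noncomputable def zzF (s : ℂ) : ℂ := - deriv zzH s / zzH s

lemma zz_isOpen : IsOpen {s : ℂ | -2 < s.re} := isOpen_lt continuous_const Complex.continuous_re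

lemma zzH_dd (s : ℂ) (hs : -2 < s.re) : DifferentiableAt ℂ (deriv zzH) s := by
  have h : DifferentiableOn ℂ zzH {s : ℂ | -2 < s.re} := fun z hz => (zzH_diff z hz).differentiableWithinAt
  exact (h.deriv zz_isOpen).differentiableAt (zz_isOpen.mem_nhds hs)

lemma zzF_hasDeriv (s : ℂ) (hs : -2 < s.re) (h0 : zzH s ≠ 0) :
    HasDerivAt zzF (- deriv (deriv zzH) s / zzH s + (deriv zzH s / zzH s) ^ 2) s := by
  have h1 := (zzH_dd s hs).hasDerivAt
  have h2 := (zzH_diff s hs).hasDerivAt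
  have k := h1.neg.div h2 h0
  refine k.congr_deriv ?_
  simp only [Pi.neg_apply]
  field_simp
  ring

lemma zzF_bd (s : ℂ) (hs : 1 / 2 ≤ s.re) {r q c : ℝ} (hr : ‖s - 1‖ + 1 ≤ r) (hq : zzQ r ≤ c * q)
    (hq0 : 0 < q) (h : q ≤ ‖zzH s‖) :
    zzH s ≠ 0 ∧ ‖zzF s‖ ≤ c ∧ ‖deriv zzF s‖ ≤ 2 * c + c ^ 2 := by
  have hH : 0 < ‖zzH s‖ := hq0.trans_le h
  have h0 : zzH s ≠ 0 := norm_pos_iff.1 hH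
  have d1 := zzH_d1 s hs hr
  have d2 := zzH_d2 s hs hr
  have hc0 : 0 ≤ c := by
    have : 0 ≤ c * q := (norm_nonneg _).trans (d1.trans hq)
    exact nonneg_of_mul_nonneg_left this hq0
  have hcH : c * q ≤ c * ‖zzH s‖ := by gcongr
  have b1 : ‖deriv zzH s / zzH s‖ ≤ c := by
    rw [norm_div, div_le_iff₀ hH]; linarith
  have b2 : ‖deriv (deriv zzH) s / zzH s‖ ≤ 2 * c := by
    rw [norm_div, div_le_iff₀ hH]; linarith
  refine ⟨h0, ?_, ?_⟩
  · rw [zzF, neg_div, norm_neg]; exact b1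
  · rw [(zzF_hasDeriv s (by linarith) h0).deriv]
    refine (norm_add_le _ _).trans ?_
    rw [neg_div, norm_neg, norm_pow]
    gcongr

/-- region A -/
lemma zz_regA (s : ℂ) (h1 : 1 / 2 ≤ s.re) (h2 : s.re ≤ 11 / 10) (ht : |s.im| ≤ 3) :
    2 / 5 ≤ ‖zzH s‖ := by
  have ht2 : s.im ^ 2 ≤ 9 := by
    rw [← sq_abs]; nlinarith [abs_nonneg s.im]
  have hJ : ‖zzJ s‖ ≤ 1 / 50 := (zzJ_bound s (by linarith)).trans (by
    rw [div_le_iff₀ (by linarith)]; linarith)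
  have e1 : ‖s - 1‖ ≤ 61 / 20 := zz_norm_le (by norm_num) (by simp; nlinarith)
  have e2 : ‖s‖ ≤ 16 / 5 := zz_norm_le (by norm_num) (by nlinarith)
  have e3 : ‖s + 1‖ ≤ 74 / 20 := zz_norm_le (by norm_num) (by simp; nlinarith)
  have e4 : 5 / 2 ≤ ‖s + 2‖ := zz_le_norm (by simp; nlinarith [sq_nonneg s.im])
  have e5 : 7 / 2 ≤ ‖s + 3‖ := zz_le_norm (by simp; nlinarith [sq_nonneg s.im])
  have hH : zzH s = (s + 2) * ((s + 3) / 12 - (s - 1) * s * (s + 1) / 6 * zzJ s) := by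
    unfold zzH; ring
  rw [hH, norm_mul]
  have k1 : ‖(s - 1) * s * (s + 1) / 6 * zzJ s‖ ≤ 61 / 20 * (16 / 5) * (74 / 20) / 6 * (1 / 50) := by
    simp only [norm_mul, norm_div]
    have : ‖(6 : ℂ)‖ = 6 := by simp
    rw [this]; gcongr
  have k2 : ‖(s + 3) / 12‖ = ‖s + 3‖ / 12 := by simp
  have k3 := norm_sub_norm_le ((s + 3) / 12) ((s - 1) * s * (s + 1) / 6 * zzJ s)
  have k4 : 4 / 25 ≤ ‖(s + 3) / 12 - (s - 1) * s * (s + 1) / 6 * zzJ s‖ := by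
    rw [k2] at k3; linarith
  nlinarith

lemma zz_sqrt2 : (2 : ℝ) ^ (-(1 / 2) : ℝ) ≤ 7072 / 10000 := by
  rw [Real.rpow_neg (by norm_num), ← Real.sqrt_eq_rpow]
  rw [inv_le_comm₀ (by positivity) (by norm_num)]
  apply Real.le_sqrt_of_sq_le; norm_num

/-- region B, generic -/
lemma zz_regB (s : ℂ) (h1 : 1 / 2 ≤ s.re) (hs1 : s ≠ 1) {a b : ℝ}
    (hA : ‖2 / (s - 1) + 1 / 2 + s / 24‖ ≤ a) (hb : ‖s‖ * ‖s + 1‖ * ‖s + 2‖ ≤ b) :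
    ‖s - 1‖ * (1 - 7072 / 10000 * a - b * (59 / 100000)) ≤ ‖zzH s‖ := by
  rw [zzH_two s (by linarith) hs1, norm_mul]
  gcongr
  have hT : ‖(2 : ℂ) ^ (-s)‖ ≤ 7072 / 10000 := by
    have := norm_cpow_eq_rpow_re_of_pos (show (0 : ℝ) < 2 by norm_num) (-s)
    push_cast at this
    rw [this, neg_re]
    refine (Real.rpow_le_rpow_of_exponent_le (by norm_num) ?_).trans zz_sqrt2
    linarith
  have hI := zzJ_tail_bound s (by linarith) (show (0 : ℝ) < 2 by norm_num)
  have hI' : ‖∫ x in Ioi (2 : ℝ), (zzB x : ℂ) * (x : ℂ) ^ (-s - 3)‖ ≤ 1 / 20 * (7072 / 10000 / 4 / (5 / 2)) := by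
    refine hI.trans ?_
    have : (2 : ℝ) ^ (-s.re - 2) ≤ 7072 / 10000 / 4 := by
      rw [Real.rpow_sub (by norm_num)]
      have h4 : (2 : ℝ) ^ (2 : ℝ) = 4 := by norm_num
      rw [h4]
      gcongr
      refine (Real.rpow_le_rpow_of_exponent_le (by norm_num) ?_).trans zz_sqrt2
      linarith
    have h5 : (5 / 2 : ℝ) ≤ s.re + 2 := by linarith
    gcongr
  set A := 2 / (s - 1) + 1 / 2 + s / 24
  set I := ∫ x in Ioi (2 : ℝ), (zzB x : ℂ) * (x : ℂ) ^ (-s - 3)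
  have k1 : ‖(2 : ℂ) ^ (-s) * A‖ ≤ 7072 / 10000 * a := by
    rw [norm_mul]; gcongr
  have k2 : ‖s * (s + 1) * (s + 2) / 6 * I‖ ≤ b * (59 / 100000) := by
    rw [norm_mul, norm_div, norm_mul, norm_mul]
    have : ‖(6 : ℂ)‖ = 6 := by simp
    rw [this]
    have hb0 : 0 ≤ b := le_trans (by positivity) hb
    calc ‖s‖ * ‖s + 1‖ * ‖s + 2‖ / 6 * ‖I‖ ≤ b / 6 * (1 / 20 * (7072 / 10000 / 4 / (5 / 2))) := by gcongr
      _ ≤ _ := by linarith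
  have k3 : (1 : ℂ) = (1 + (2 : ℂ) ^ (-s) * A - s * (s + 1) * (s + 2) / 6 * I) + (-((2 : ℂ) ^ (-s) * A) + s * (s + 1) * (s + 2) / 6 * I) := by ring
  have k4 := norm_add_le (1 + (2 : ℂ) ^ (-s) * A - s * (s + 1) * (s + 2) / 6 * I) (-((2 : ℂ) ^ (-s) * A) + s * (s + 1) * (s + 2) / 6 * I)
  rw [← k3, norm_one] at k4
  have k5 := norm_add_le (-((2 : ℂ) ^ (-s) * A)) (s * (s + 1) * (s + 2) / 6 * I)
  rw [norm_neg] at k5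
  linarith

lemma zz_A_re (s : ℂ) : (2 / (s - 1) + 1 / 2 + s / 24).re
    = 2 * (s.re - 1) / ((s.re - 1) ^ 2 + s.im ^ 2) + 1 / 2 + s.re / 24 := by
  have : (2 : ℂ) / (s - 1) = 2 * (s - 1)⁻¹ := by rw [div_eq_mul_inv]
  rw [this]
  simp [Complex.inv_re, Complex.normSq_apply, Complex.mul_re]
  ring

lemma zz_A_im (s : ℂ) : (2 / (s - 1) + 1 / 2 + s / 24).im
    = s.im * (1 / 24 - 2 / ((s.re - 1) ^ 2 + s.im ^ 2)) := by
  have : (2 : ℂ) / (s - 1) = 2 * (s - 1)⁻¹ := by rw [div_eq_mul_inv]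
  rw [this]
  simp [Complex.inv_im, Complex.normSq_apply, Complex.mul_im]
  ring

lemma zz_regB1 (s : ℂ) (h1 : 1 / 2 ≤ s.re) (h2 : s.re ≤ 11 / 10) (ht : 3 ≤ |s.im|) (ht' : |s.im| ≤ 6) :
    3 / 4 ≤ ‖zzH s‖ := by
  have hs1 : s ≠ 1 := by rintro rfl; simp at ht; linarith
  have hsq := sq_abs s.im
  set τ := |s.im| with hτ
  have ht2 : τ ^ 2 ≤ 36 := by nlinarith
  have ht3 : 9 ≤ τ ^ 2 := by nlinarith
  have hA : ‖2 / (s - 1) + 1 / 2 + s / 24‖ ≤ 8 / 10 := by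
    have hre : |(2 / (s - 1) + 1 / 2 + s / 24).re| ≤ 57 / 100 := by
      rw [zz_A_re, ← hsq]
      have hd : 0 < (s.re - 1) ^ 2 + τ ^ 2 := by positivity
      have u1 : 2 * (s.re - 1) / ((s.re - 1) ^ 2 + τ ^ 2) ≤ 23 / 1000 := by
        rw [div_le_iff₀ hd]; nlinarith [sq_nonneg (s.re - 1)]
      have u2 : -(1 / 8) ≤ 2 * (s.re - 1) / ((s.re - 1) ^ 2 + τ ^ 2) := by
        rw [le_div_iff₀ hd]; nlinarith [sq_nonneg (s.re - 1)]
      rw [abs_le]; constructor <;> linarith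
    have him : |(2 / (s - 1) + 1 / 2 + s / 24).im| ≤ 55 / 100 := by
      rw [zz_A_im, abs_mul, ← hτ, ← hsq]
      have hd : 0 < (s.re - 1) ^ 2 + τ ^ 2 := by positivity
      have u1 : 2 / ((s.re - 1) ^ 2 + τ ^ 2) ≤ 2 / τ ^ 2 := by
        gcongr; nlinarith [sq_nonneg (s.re - 1)]
      have u2 : 1 / 24 ≤ 2 / ((s.re - 1) ^ 2 + τ ^ 2) := by
        rw [le_div_iff₀ hd]; nlinarith [sq_nonneg (s.re - 1)]
      rw [abs_of_nonpos (by linarith)]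
      have u3 : τ * (2 / τ ^ 2) = 2 / τ := by field_simp
      have u4 : 2 / τ ≤ 2 / 3 := by gcongr
      nlinarith
    apply zz_norm_le (by norm_num)
    rw [← sq_abs, ← sq_abs (Complex.im _)]
    nlinarith [abs_nonneg (2 / (s - 1) + 1 / 2 + s / 24).re, abs_nonneg (2 / (s - 1) + 1 / 2 + s / 24).im]
  have e1 : ‖s‖ ≤ 611 / 100 := zz_norm_le (by norm_num) (by nlinarith)
  have e2 : ‖s + 1‖ ≤ 64 / 10 := zz_norm_le (by norm_num) (by simp; nlinarith)
  have e3 : ‖s + 2‖ ≤ 68 / 10 := zz_norm_le (by norm_num) (by simp; nlinarith)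
  have e4 : 3 ≤ ‖s - 1‖ := zz_le_norm (by simp; nlinarith [sq_nonneg (s.re - 1)])
  have hb : ‖s‖ * ‖s + 1‖ * ‖s + 2‖ ≤ 611 / 100 * (64 / 10) * (68 / 10) := by gcongr
  have := zz_regB s h1 hs1 hA hb
  nlinarith

lemma zz_regB2 (s : ℂ) (h1 : 1 / 2 ≤ s.re) (h2 : s.re ≤ 11 / 10) (ht : 6 ≤ |s.im|) (ht' : |s.im| ≤ 9) :
    3 / 5 ≤ ‖zzH s‖ := by
  have hs1 : s ≠ 1 := by rintro rfl; simp at ht; linarith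
  have hsq := sq_abs s.im
  set τ := |s.im| with hτ
  have ht2 : τ ^ 2 ≤ 81 := by nlinarith
  have ht3 : 36 ≤ τ ^ 2 := by nlinarith
  have hA : ‖2 / (s - 1) + 1 / 2 + s / 24‖ ≤ 58 / 100 := by
    have hre : |(2 / (s - 1) + 1 / 2 + s / 24).re| ≤ 553 / 1000 := by
      rw [zz_A_re, ← hsq]
      have hd : 0 < (s.re - 1) ^ 2 + τ ^ 2 := by positivity
      have u1 : 2 * (s.re - 1) / ((s.re - 1) ^ 2 + τ ^ 2) ≤ 6 / 1000 := by
        rw [div_le_iff₀ hd]; nlinarith [sq_nonneg (s.re - 1)]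
      have u2 : -(1 / 8) ≤ 2 * (s.re - 1) / ((s.re - 1) ^ 2 + τ ^ 2) := by
        rw [le_div_iff₀ hd]; nlinarith [sq_nonneg (s.re - 1)]
      rw [abs_le]; constructor <;> linarith
    have him : |(2 / (s - 1) + 1 / 2 + s / 24).im| ≤ 16 / 100 := by
      rw [zz_A_im, abs_mul, ← hτ, ← hsq]
      have hx : (s.re - 1) ^ 2 ≤ 1 / 4 := by nlinarith
      have hd : 0 < (s.re - 1) ^ 2 + τ ^ 2 := by positivity
      have u1 : 2 / ((s.re - 1) ^ 2 + τ ^ 2) ≤ 2 / τ ^ 2 := by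
        gcongr; nlinarith [sq_nonneg (s.re - 1)]
      have u2 : 2 / (1 / 4 + τ ^ 2) ≤ 2 / ((s.re - 1) ^ 2 + τ ^ 2) := by
        gcongr
      have u3 : τ * (2 / τ ^ 2) = 2 / τ := by field_simp
      have u4 : 2 / τ ≤ 2 / 6 := by gcongr
      have u5 : 2 / 9 - 2 / 1000 ≤ τ * (2 / (1 / 4 + τ ^ 2)) := by
        rw [mul_div_assoc', le_div_iff₀ (by positivity)]; nlinarith
      rw [← abs_of_nonneg (show 0 ≤ τ by linarith), ← abs_mul, abs_of_nonneg (show 0 ≤ τ by linarith), abs_le]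
      constructor
      · nlinarith
      · nlinarith
    apply zz_norm_le (by norm_num)
    rw [← sq_abs, ← sq_abs (Complex.im _)]
    nlinarith [abs_nonneg (2 / (s - 1) + 1 / 2 + s / 24).re, abs_nonneg (2 / (s - 1) + 1 / 2 + s / 24).im]
  have e1 : ‖s‖ ≤ 907 / 100 := zz_norm_le (by norm_num) (by nlinarith)
  have e2 : ‖s + 1‖ ≤ 925 / 100 := zz_norm_le (by norm_num) (by simp; nlinarith)
  have e3 : ‖s + 2‖ ≤ 953 / 100 := zz_norm_le (by norm_num) (by simp; nlinarith)
  have e4 : 6 ≤ ‖s - 1‖ := zz_le_norm (by simp; nlinarith [sq_nonneg (s.re - 1)])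
  have hb : ‖s‖ * ‖s + 1‖ * ‖s + 2‖ ≤ 907 / 100 * (925 / 100) * (953 / 100) := by gcongr
  have := zz_regB s h1 hs1 hA hb
  nlinarith

lemma zz_exp94 : 9 ≤ Real.exp (9 / 4) := by
  have h := Real.exp_one_gt_d9
  have : Real.exp (9 / 4) ^ 4 = Real.exp 1 ^ 9 := by
    rw [← Real.exp_nat_mul, ← Real.exp_nat_mul]; norm_num
  have h2 : (2.7 : ℝ) ^ 9 ≤ Real.exp 1 ^ 9 := by gcongr; linarith
  refine le_of_pow_le_pow_left₀ (n := 4) (by norm_num) (by positivity) ?_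
  rw [this]; refine le_trans (by norm_num) h2

lemma zz_exp9 : 6561 ≤ Real.exp 9 := by
  have h := zz_exp94
  have : Real.exp 9 = Real.exp (9 / 4) ^ 4 := by
    rw [← Real.exp_nat_mul]; norm_num
  rw [this]
  calc (6561 : ℝ) = 9 ^ 4 := by norm_num
    _ ≤ _ := by gcongr

/-- rectangle bounds -/
lemma zz_rect (s : ℂ) (h1 : 1 / 2 ≤ s.re) (h2 : s.re ≤ 11 / 10) (ht : |s.im| ≤ 9) :
    zzH s ≠ 0 ∧ ‖zzF s‖ ≤ 24 * Real.exp (s.im ^ 2 / 4) ∧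
      ‖deriv zzF s‖ ≤ 625 * Real.exp (s.im ^ 2 / 4) := by
  have hsq := sq_abs s.im
  have h00 := abs_nonneg s.im
  have hx : (s.re - 1) ^ 2 ≤ 1 / 4 := by nlinarith
  rcases le_total |s.im| 3 with h3 | h3
  · have e1 : ‖s - 1‖ ≤ 61 / 20 := zz_norm_le (by norm_num) (by simp; nlinarith)
    have := zzF_bd s h1 (r := 81 / 20) (q := 2 / 5) (c := 24) (by linarith)
      (by unfold zzQ; norm_num) (by norm_num) (zz_regA s h1 h2 h3)
    have he : 1 ≤ Real.exp (s.im ^ 2 / 4) := Real.one_le_exp (by positivity)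
    refine ⟨this.1, this.2.1.trans (by linarith), this.2.2.trans (by linarith)⟩
  rcases le_total |s.im| 6 with h6 | h6
  · have e1 : ‖s - 1‖ ≤ 603 / 100 := zz_norm_le (by norm_num) (by simp; nlinarith)
    have := zzF_bd s h1 (r := 703 / 100) (q := 3 / 4) (c := 51) (by linarith)
      (by unfold zzQ; norm_num) (by norm_num) (zz_regB1 s h1 h2 h3 h6)
    have he : 9 ≤ Real.exp (s.im ^ 2 / 4) := zz_exp94.trans (Real.exp_le_exp.2 (by nlinarith))
    refine ⟨this.1, this.2.1.trans (by linarith), this.2.2.trans (by linarith)⟩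
  · have e1 : ‖s - 1‖ ≤ 902 / 100 := zz_norm_le (by norm_num) (by simp; nlinarith)
    have := zzF_bd s h1 (r := 1002 / 100) (q := 3 / 5) (c := 188) (by linarith)
      (by unfold zzQ; norm_num) (by norm_num) (zz_regB2 s h1 h2 h6 ht)
    have he : 6561 ≤ Real.exp (s.im ^ 2 / 4) := zz_exp9.trans (Real.exp_le_exp.2 (by nlinarith))
    refine ⟨this.1, this.2.1.trans (by linarith), this.2.2.trans (by linarith)⟩


lemma zz_341 {x : ℝ} (hx : 0 < x) (y : ℝ) :
    1 ≤ ‖riemannZeta (1 + x)‖ ^ 3 * ‖riemannZeta (1 + x + I * y)‖ ^ 4 * ‖riemannZeta (1 + x + 2 * I * y)‖ := by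
  have h := DirichletCharacter.norm_LFunction_product_ge_one (N := 1) (1 : DirichletCharacter ℂ 1) hx y
  simp only [DirichletCharacter.LFunctionTrivChar, DirichletCharacter.LFunction_modOne_eq, norm_mul, norm_pow] at h
  exact h

lemma zz_341H {x : ℝ} (hx : 0 < x) (hx1 : x ≤ 1 / 10) (y : ℝ) (hy : 9 ≤ |y|) :
    81 * x ^ 3 ≤ ‖zzH (1 + x + I * y)‖ ^ 4 := by
  have h := zz_341 hx y
  have a0 : zzH (1 + x) = x * riemannZeta (1 + x) := by
    rw [zzH_eq _ (by simp; linarith)]; ring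
  have a1 : zzH (1 + x + I * y) = (x + I * y) * riemannZeta (1 + x + I * y) := by
    rw [zzH_eq _ (by simp; linarith)]; ring
  have a2 : zzH (1 + x + 2 * I * y) = (x + 2 * I * y) * riemannZeta (1 + x + 2 * I * y) := by
    rw [zzH_eq _ (by simp; linarith)]; ring
  have b0 : ‖zzH (1 + x)‖ ≤ 11 / 10 := by
    refine (zzH_up _ (by simp; linarith) (r := 1 / 10) (by simp [abs_of_pos hx]; linarith)).trans ?_
    unfold zzQ; norm_num
  have hsq := sq_abs y
  set r := |y|
  have b2 : ‖zzH (1 + x + 2 * I * y)‖ ≤ 14 / 100 * r ^ 4 := by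
    refine (zzH_up _ (by simp; linarith) (r := 2 * r + 1 / 100) ?_).trans ?_
    · apply zz_norm_le (by positivity)
      simp; nlinarith
    · unfold zzQ
      nlinarith [mul_nonneg (sub_nonneg.2 hy) (sub_nonneg.2 hy), pow_nonneg (sub_nonneg.2 hy) 3, pow_nonneg (sub_nonneg.2 hy) 4]
  rw [a0, norm_mul, norm_real, Real.norm_of_nonneg hx.le] at b0
  rw [a2, norm_mul] at b2
  have c1 : r ≤ ‖(x + I * y : ℂ)‖ := by
    apply zz_le_norm; simp; nlinarith
  have c2 : 2 * r ≤ ‖(x + 2 * I * y : ℂ)‖ := by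
    apply zz_le_norm; simp; nlinarith
  rw [a1, norm_mul, mul_pow]
  set Z0 := ‖riemannZeta (1 + x)‖
  set Z1 := ‖riemannZeta (1 + x + I * y)‖
  set Z2 := ‖riemannZeta (1 + x + 2 * I * y)‖
  have p0 : 0 ≤ Z0 := norm_nonneg _
  have p1 : 0 ≤ Z1 := norm_nonneg _
  have p2 : 0 ≤ Z2 := norm_nonneg _
  have d2 : Z2 ≤ 7 / 100 * r ^ 3 := by
    have : 2 * r * Z2 ≤ 2 * r * (7 / 100 * r ^ 3) := by
      calc 2 * r * Z2 ≤ _ := by gcongr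
        _ ≤ _ := b2
        _ = _ := by ring
    exact le_of_mul_le_mul_left this (by linarith)
  have d0 : (x * Z0) ^ 3 ≤ (11 / 10) ^ 3 := by gcongr
  have : x ^ 3 ≤ (11 / 10) ^ 3 * (7 / 100 * r ^ 3) * Z1 ^ 4 := by
    calc x ^ 3 = x ^ 3 * 1 := by ring
      _ ≤ x ^ 3 * (Z0 ^ 3 * Z1 ^ 4 * Z2) := by gcongr
      _ = (x * Z0) ^ 3 * Z2 * Z1 ^ 4 := by ring
      _ ≤ (11 / 10) ^ 3 * (7 / 100 * r ^ 3) * Z1 ^ 4 := by gcongr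
  calc 81 * x ^ 3 ≤ 81 * ((11 / 10) ^ 3 * (7 / 100 * r ^ 3) * Z1 ^ 4) := by gcongr
    _ = 81 * (11 / 10) ^ 3 * (7 / 100) * (r ^ 3 * Z1 ^ 4) := by ring
    _ ≤ 9 * (r ^ 3 * Z1 ^ 4) := by gcongr; norm_num
    _ ≤ r * (r ^ 3 * Z1 ^ 4) := by gcongr
    _ = r ^ 4 * Z1 ^ 4 := by ring
    _ ≤ _ := by gcongr

lemma zzQ_tail {r : ℝ} (hr : 9 ≤ r) : zzQ (r + 11 / 10) ≤ r ^ 4 / 50 := by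
  unfold zzQ
  nlinarith [mul_nonneg (sub_nonneg.2 hr) (sub_nonneg.2 hr), pow_nonneg (sub_nonneg.2 hr) 3, pow_nonneg (sub_nonneg.2 hr) 4]

lemma zz_tailH (s : ℂ) (h1 : 1 < s.re) (h2 : s.re ≤ 11 / 10) (ht : 9 ≤ |s.im|) :
    10 ^ 6 / |s.im| ^ 12 ≤ ‖zzH s‖ := by
  set t := s.im
  set r := |t| with hr
  have hr0 : 0 < r := by linarith
  set y : ℝ := 100 / r ^ 4 with hy
  have hy0 : 0 < y := by positivity
  have hy1 : y ≤ 1 / 50 := by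
    rw [hy, div_le_iff₀ (by positivity)]
    have : (9 : ℝ) ^ 4 ≤ r ^ 4 := by gcongr
    linarith
  have hyr : y ^ 3 = 10 ^ 6 / r ^ 12 := by rw [hy]; field_simp; norm_num
  rw [← hyr]
  have key : ∀ x : ℝ, y ^ 4 ≤ x → x ≤ 1 / 10 → 3 * y ^ 3 ≤ ‖zzH (1 + x + I * t)‖ := by
    intro x hx hx1
    have h := zz_341H (lt_of_lt_of_le (by positivity) hx) hx1 t ht
    refine le_of_pow_le_pow_left₀ (n := 4) (by norm_num) (norm_nonneg _) (le_trans ?_ h)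
    calc (3 * y ^ 3) ^ 4 = 81 * (y ^ 4) ^ 3 := by ring
      _ ≤ _ := by gcongr
  rcases le_total (y ^ 4) (s.re - 1) with h | h
  · have := key (s.re - 1) h (by linarith)
    have e : (1 + ((s.re - 1 : ℝ) : ℂ) + I * t) = s := by
      apply Complex.ext <;> simp [t]
    rw [e] at this
    linarith [pow_pos hy0 3]
  · have hy4 : y ^ 4 ≤ 1 / 10 := by
      calc y ^ 4 ≤ (1 / 50) ^ 4 := by gcongr
        _ ≤ _ := by norm_num
    have k := key (y ^ 4) le_rfl hy4
    set z : ℂ := 1 + ((y ^ 4 : ℝ) : ℂ) + I * t with hz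
    set S : Set ℂ := {w | 1 / 2 ≤ w.re} ∩ Metric.closedBall (1 + I * t) (1 / 10) with hS
    have hconv : Convex ℝ S := (convex_halfSpace_re_ge _).inter (convex_closedBall _ _)
    have hzS : z ∈ S := by
      have hzre : z.re = 1 + y ^ 4 := by
        rw [hz]; simp only [add_re, one_re, ofReal_re, mul_re, I_re, I_im, ofReal_im]; ring
      refine ⟨?_, ?_⟩
      · change 1 / 2 ≤ z.re
        rw [hzre]; linarith [pow_pos hy0 4]
      rw [mem_closedBall_iff_norm]
      have : z - (1 + I * t) = ((y ^ 4 : ℝ) : ℂ) := by rw [hz]; ring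
      rw [this, norm_real, Real.norm_of_nonneg (by positivity)]; exact hy4
    have hsS : s ∈ S := by
      refine ⟨by simp; linarith, ?_⟩
      rw [mem_closedBall_iff_norm]
      apply zz_norm_le (by norm_num); simp [t]; nlinarith
    have hbd : ∀ w ∈ S, ‖deriv zzH w‖ ≤ r ^ 4 / 50 := by
      intro w hw
      refine (zzH_d1 w hw.1 (r := r + 11 / 10) ?_).trans (zzQ_tail ht)
      have : w - 1 = (w - (1 + I * t)) + I * t := by ring
      rw [this]
      have h3 := mem_closedBall_iff_norm.1 hw.2
      have h4 := norm_add_le (w - (1 + I * t)) (I * t)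
      have h5 : ‖(I * t : ℂ)‖ = r := by simp [hr]
      linarith
    have hmv := hconv.norm_image_sub_le_of_norm_deriv_le
      (fun w hw => zzH_diff w (by have : (1:ℝ) / 2 ≤ w.re := hw.1; linarith)) hbd hsS hzS
    have hzs : ‖z - s‖ ≤ y ^ 4 := by
      apply zz_norm_le (by positivity)
      simp [hz, t]
      have : (1 + y ^ 4 - s.re) ≤ y ^ 4 := by linarith
      have h0 : 0 ≤ (1 + y ^ 4 - s.re) := by linarith
      norm_cast
      simp
      nlinarith
    have hf : r ^ 4 / 50 * ‖z - s‖ ≤ 2 * y ^ 3 := by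
      calc r ^ 4 / 50 * ‖z - s‖ ≤ r ^ 4 / 50 * y ^ 4 := by gcongr
        _ = (r ^ 4 * y) / 50 * y ^ 3 := by ring
        _ = 2 * y ^ 3 := by
          have : r ^ 4 * y = 100 := by rw [hy]; field_simp
          rw [this]; norm_num
    have h6 := norm_sub_norm_le (zzH z) (zzH s)
    linarith

lemma zz_pow_exp {r : ℝ} (hr : 9 ≤ r) : r ^ 32 ≤ 9 ^ 32 / (48 * 10 ^ 7) * Real.exp (r ^ 2 / 4) := by
  have h1 : (r / 9) ^ 32 ≤ Real.exp (r ^ 2 / 4 - 81 / 4) := by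
    have : r / 9 ≤ Real.exp (r / 9 - 1) := by
      have := Real.add_one_le_exp (r / 9 - 1); linarith
    calc (r / 9) ^ 32 ≤ Real.exp (r / 9 - 1) ^ 32 := by gcongr
      _ = Real.exp (32 * (r / 9 - 1)) := by rw [← Real.exp_nat_mul]; norm_num
      _ ≤ _ := Real.exp_le_exp.2 (by nlinarith)
  have h2 : 48 * 10 ^ 7 ≤ Real.exp (81 / 4) := by
    have h := Real.exp_one_gt_d9
    calc (48 * 10 ^ 7 : ℝ) ≤ 2.7182818283 ^ 20 := by norm_num
      _ ≤ Real.exp 1 ^ 20 := by gcongr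
      _ = Real.exp 20 := by rw [← Real.exp_nat_mul]; norm_num
      _ ≤ _ := Real.exp_le_exp.2 (by norm_num)
  rw [Real.exp_sub, div_pow, div_le_div_iff₀ (by positivity) (by positivity)] at h1
  rw [div_mul_eq_mul_div, le_div_iff₀ (by positivity)]
  calc r ^ 32 * (48 * 10 ^ 7) ≤ r ^ 32 * Real.exp (81 / 4) := by gcongr
    _ ≤ _ := by linarith

lemma zz_tail (s : ℂ) (h1 : 1 < s.re) (h2 : s.re ≤ 11 / 10) (ht : 9 ≤ |s.im|) :
    zzH s ≠ 0 ∧ ‖zzF s‖ ≤ 4 * 10 ^ 6 * Real.exp (s.im ^ 2 / 4) ∧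
      ‖deriv zzF s‖ ≤ 4 * 10 ^ 6 * Real.exp (s.im ^ 2 / 4) := by
  have hl := zz_tailH s h1 h2 ht
  have hsq := sq_abs s.im
  set r := |s.im| with hr
  have hr0 : 0 < r := by linarith
  have hw : ‖s - 1‖ + 1 ≤ r + 11 / 10 := by
    have : ‖s - 1‖ ≤ r + 1 / 10 := by
      apply zz_norm_le (by positivity); simp; nlinarith
    linarith
  have := zzF_bd s (by linarith) (r := r + 11 / 10) (q := 10 ^ 6 / r ^ 12) (c := r ^ 16 / (5 * 10 ^ 7))
    hw ((zzQ_tail ht).trans (le_of_eq (by field_simp; norm_num))) (by positivity) hl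
  have hp := zz_pow_exp ht
  rw [hsq] at hp
  have h16 : (9 : ℝ) ^ 16 ≤ r ^ 16 := by gcongr
  have hc : 2 * (r ^ 16 / (5 * 10 ^ 7)) + (r ^ 16 / (5 * 10 ^ 7)) ^ 2 ≤ 4 * 10 ^ 6 * Real.exp (s.im ^ 2 / 4) := by
    have e : (r ^ 16 / (5 * 10 ^ 7)) ^ 2 = r ^ 32 / (25 * 10 ^ 14) := by ring
    have e2 : r ^ 16 * 9 ^ 16 ≤ r ^ 32 := by
      calc r ^ 16 * 9 ^ 16 ≤ r ^ 16 * r ^ 16 := by gcongr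
        _ = r ^ 32 := by ring
    rw [e]
    linarith
  refine ⟨this.1, this.2.1.trans ?_, this.2.2.trans hc⟩
  have : 0 ≤ (r ^ 16 / (5 * 10 ^ 7)) := by positivity
  nlinarith


noncomputable def zzA (U x : ℝ) : ℝ :=
  ∑ n ∈ Finset.Icc 1 ⌊x⌋₊, ArithmeticFunction.vonMangoldt n * (2 * U - Real.log n)

noncomputable def zzr (U v : ℝ) : ℝ :=
  zzA U (Real.exp v) - (2 * U * (Real.exp v - 1) - (v * Real.exp v - Real.exp v + 1))

lemma zz_lin_le_exp (a δ v : ℝ) (hδ : 0 < δ) (ha : 0 ≤ a) (hv : 0 ≤ v) :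
    a + v ≤ (a + 1 / δ) * Real.exp (δ * v) := by
  have h1 := Real.add_one_le_exp (δ * v)
  have h2 : 0 < 1 / δ := by positivity
  have h3 : (1 / δ) * (δ * v + 1) ≤ (1 / δ) * Real.exp (δ * v) := by gcongr
  have h4 : (1 / δ) * (δ * v + 1) = v + 1 / δ := by field_simp
  have h5 : 1 ≤ Real.exp (δ * v) := Real.one_le_exp (by positivity)
  nlinarith

lemma zzA_abs (U : ℝ) (hU : 0 ≤ U) (δ : ℝ) (hδ : 0 < δ) : ∃ K : ℝ, 0 ≤ K ∧ ∀ x : ℝ, 1 ≤ x →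
    ∑ n ∈ Finset.Icc 1 ⌊x⌋₊, |ArithmeticFunction.vonMangoldt n * (2 * U - Real.log n)|
      ≤ K * x ^ (1 + δ) := by
  refine ⟨(2 * U + 1 / δ) * (Real.log 4 + 4), by positivity, fun x hx => ?_⟩
  have hx0 : 0 < x := by linarith
  have hl : 0 ≤ Real.log x := Real.log_nonneg hx
  have h1 : ∑ n ∈ Finset.Icc 1 ⌊x⌋₊, |ArithmeticFunction.vonMangoldt n * (2 * U - Real.log n)|
      ≤ ∑ n ∈ Finset.Icc 1 ⌊x⌋₊, ArithmeticFunction.vonMangoldt n * (2 * U + Real.log x) := by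
    apply Finset.sum_le_sum
    intro n hn
    rw [Finset.mem_Icc] at hn
    have hn1 : (1:ℝ) ≤ n := by exact_mod_cast hn.1
    have hnx : (n:ℝ) ≤ x := (Nat.le_floor_iff hx0.le).1 hn.2
    have hln : 0 ≤ Real.log n := Real.log_nonneg hn1
    have hlx : Real.log n ≤ Real.log x := Real.log_le_log (by linarith) hnx
    rw [abs_mul, abs_of_nonneg ArithmeticFunction.vonMangoldt_nonneg]
    have h0 : |2 * U - Real.log n| ≤ 2 * U + Real.log x := by rw [abs_le]; constructor <;> linarith
    exact mul_le_mul_of_nonneg_left h0 ArithmeticFunction.vonMangoldt_nonneg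
  rw [← Finset.sum_mul] at h1
  have h2 : ∑ n ∈ Finset.Icc 1 ⌊x⌋₊, ArithmeticFunction.vonMangoldt n = Chebyshev.psi x := by
    rw [Chebyshev.psi_eq_sum_Icc]
    symm
    rw [← Finset.sum_subset (Finset.Icc_subset_Icc_left (Nat.zero_le 1))]
    intro n hn hn'
    have : n = 0 := by
      simp only [Finset.mem_Icc] at hn hn'; omega
    simp [this]
  rw [h2] at h1
  have h3 := Chebyshev.psi_le_const_mul_self hx0.le
  have h4 := zz_lin_le_exp (2*U) δ (Real.log x) hδ (by linarith) hl
  have h5 : Real.exp (δ * Real.log x) = x ^ δ := by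
    rw [Real.rpow_def_of_pos hx0, mul_comm]
  rw [h5] at h4
  rw [Real.rpow_add hx0, Real.rpow_one]
  calc _ ≤ _ := h1
    _ ≤ ((Real.log 4 + 4) * x) * ((2 * U + 1 / δ) * x ^ δ) := by
        gcongr
    _ = _ := by ring

lemma zzA_meas (U : ℝ) : Measurable (zzA U) := by
  unfold zzA
  exact (measurable_from_top (f := fun k : ℕ => ∑ n ∈ Finset.Icc 1 k, ArithmeticFunction.vonMangoldt n * (2 * U - Real.log n))).comp Nat.measurable_floor

lemma zzr_meas (U : ℝ) : Measurable (zzr U) := by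
  unfold zzr
  have := (zzA_meas U).comp Real.measurable_exp
  simp only [Function.comp_def] at this
  fun_prop

lemma zzA_int (U : ℝ) (hU : 0 ≤ U) (s : ℂ) (hs : 1 < s.re) :
    IntegrableOn (fun v : ℝ => (zzA U (Real.exp v) : ℂ) * cexp (-s * v)) (Ioi 0) := by
  obtain ⟨K, hK0, hK⟩ := zzA_abs U hU ((s.re - 1)/2) (by linarith)
  have hi : IntegrableOn (fun v : ℝ => K * Real.exp (-((s.re - 1)/2) * v)) (Ioi 0) :=
    (exp_neg_integrableOn_Ioi 0 (by linarith)).const_mul K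
  refine hi.mono' ?_ ?_
  · have := (zzA_meas U).comp Real.measurable_exp
    simp only [Function.comp_def] at this
    apply Measurable.aestronglyMeasurable
    fun_prop
  · filter_upwards [self_mem_ae_restrict measurableSet_Ioi] with v hv
    have hv0 : (0:ℝ) < v := hv
    rw [norm_mul, Complex.norm_exp]
    have h1 : ‖(zzA U (Real.exp v) : ℂ)‖ ≤ K * (Real.exp v)^(1 + (s.re-1)/2) := by
      rw [Complex.norm_real, Real.norm_eq_abs]
      exact (Finset.abs_sum_le_sum_abs _ _).trans (hK _ (Real.one_le_exp hv0.le))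
    rw [← Real.exp_mul] at h1
    calc _ ≤ (K * Real.exp (v * (1 + (s.re-1)/2))) * Real.exp (-s * v).re := by gcongr
      _ = _ := by
        rw [mul_assoc, ← Real.exp_add]; congr 2; simp; ring

lemma zz_subst (g : ℝ → ℂ) : ∫ t in Ioi (1:ℝ), g t = ∫ v in Ioi (0:ℝ), (Real.exp v : ℂ) * g (Real.exp v) := by
  have himg : Real.exp '' (Ioi 0) = Ioi 1 := by
    ext t; constructor
    · rintro ⟨v, hv, rfl⟩; exact Real.one_lt_exp_iff.2 hv
    · intro ht; exact ⟨Real.log t, Real.log_pos ht, Real.exp_log (by have : (1:ℝ) < t := ht; linarith)⟩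
  rw [← himg, integral_image_eq_integral_abs_deriv_smul measurableSet_Ioi
    (fun x _ => (Real.hasDerivAt_exp x).hasDerivWithinAt) Real.exp_injective.injOn]
  apply setIntegral_congr_fun measurableSet_Ioi
  intro v _
  simp [abs_of_pos (Real.exp_pos v)]

lemma zzA_laplace (U : ℝ) (hU : 0 ≤ U) (s : ℂ) (hs : 1 < s.re) :
    LSeries (fun n => ((ArithmeticFunction.vonMangoldt n * (2 * U - Real.log n) : ℝ) : ℂ)) s
     = s * ∫ v in Ioi (0:ℝ), (zzA U (Real.exp v) : ℂ) * cexp (-s * v) := by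
  obtain ⟨K, hK0, hK⟩ := zzA_abs U hU ((s.re - 1)/2) (by linarith)
  rw [LSeries_eq_mul_integral' _ (r := 1 + (s.re-1)/2) (by linarith) (by linarith)]
  · rw [zz_subst]
    congr 1
    apply setIntegral_congr_fun measurableSet_Ioi
    intro v _
    simp only [zzA]
    rw [Complex.cpow_def_of_ne_zero (by exact_mod_cast (Real.exp_pos v).ne'), ← Complex.ofReal_log (Real.exp_pos v).le, Real.log_exp]
    push_cast
    rw [mul_left_comm, ← Complex.exp_add]
    congr 2; ring
  · apply Asymptotics.IsBigO.of_bound K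
    filter_upwards [eventually_ge_atTop 1] with n hn
    have h := hK n (by exact_mod_cast hn)
    rw [Nat.floor_natCast] at h
    rw [Real.norm_of_nonneg (Finset.sum_nonneg fun _ _ => norm_nonneg _), Real.norm_of_nonneg (by positivity)]
    simpa only [Complex.norm_real, Real.norm_eq_abs] using h

lemma zz_LΛ (s : ℂ) (hs : 1 < s.re) :
    LSeries (fun n => (ArithmeticFunction.vonMangoldt n : ℂ)) s = zzF s + 1 / (s - 1) := by
  rw [ArithmeticFunction.LSeries_vonMangoldt_eq_deriv_riemannZeta_div hs]
  have hz : riemannZeta s ≠ 0 := riemannZeta_ne_zero_of_one_le_re hs.le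
  have h1 : s - 1 ≠ 0 := by
    intro h; have : s = 1 := by linear_combination h
    rw [this] at hs; simp at hs
  have hd : HasDerivAt riemannZeta (deriv riemannZeta s) s :=
    (differentiableAt_riemannZeta (by intro h; apply h1; rw [h]; ring)).hasDerivAt
  have h2 : zzH =ᶠ[𝓝 s] fun s => (s-1) * riemannZeta s := by
    have : {z : ℂ | 1 < z.re} ∈ 𝓝 s := (isOpen_lt continuous_const Complex.continuous_re).mem_nhds hs
    filter_upwards [this] with z hz using zzH_eq z hz
  have h3 : deriv zzH s = riemannZeta s + (s-1) * deriv riemannZeta s := by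
    rw [h2.deriv_eq]
    have := (((hasDerivAt_id s).sub_const 1).mul hd).deriv
    simp only [id] at this
    rw [show (fun s => (s-1) * riemannZeta s) = (fun x : ℂ => x - 1) * riemannZeta from rfl, this]
    ring
  unfold zzF
  rw [h3, zzH_eq s hs]
  field_simp
  ring

lemma zz_Lf (U : ℝ) (s : ℂ) (hs : 1 < s.re) :
    LSeries (fun n => ((ArithmeticFunction.vonMangoldt n * (2 * U - Real.log n) : ℝ) : ℂ)) s
     = 2 * U * (zzF s + 1 / (s-1)) + (deriv zzF s - 1 / (s-1)^2) := by
  have h1 : s - 1 ≠ 0 := by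
    intro h; have : s = 1 := by linear_combination h
    rw [this] at hs; simp at hs
  have hab : LSeries.abscissaOfAbsConv (fun n => (ArithmeticFunction.vonMangoldt n : ℂ)) ≤ 1 :=
    LSeries.abscissaOfAbsConv_le_of_forall_lt_LSeriesSummable' fun y hy => by
      apply ArithmeticFunction.LSeriesSummable_vonMangoldt
      simpa using (by exact_mod_cast hy)
  have hab' : LSeries.abscissaOfAbsConv (fun n => (ArithmeticFunction.vonMangoldt n : ℂ)) < s.re :=
    lt_of_le_of_lt hab (by exact_mod_cast hs)
  have hd := LSeries_deriv hab'
  have hS1 := ArithmeticFunction.LSeriesSummable_vonMangoldt hs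
  have hS2 := LSeriesSummable_logMul_of_lt_re hab'
  have h2 : LSeries (fun n => (ArithmeticFunction.vonMangoldt n : ℂ)) =ᶠ[𝓝 s] fun s => zzF s + 1 / (s - 1) := by
    have : {z : ℂ | 1 < z.re} ∈ 𝓝 s := (isOpen_lt continuous_const Complex.continuous_re).mem_nhds hs
    filter_upwards [this] with z hz using zz_LΛ z hz
  have hH0 : zzH s ≠ 0 := by
    rw [zzH_eq s hs]; exact mul_ne_zero h1 (riemannZeta_ne_zero_of_one_le_re hs.le)
  have hF := (zzF_hasDeriv s (by linarith) hH0).differentiableAt.hasDerivAt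
  have h3 : HasDerivAt (fun s : ℂ => zzF s + 1 / (s - 1)) (deriv zzF s - 1 / (s-1)^2) s := by
    have := hF.add (((hasDerivAt_id s).sub_const 1).inv h1)
    have e : (fun s : ℂ => zzF s + 1 / (s - 1)) = zzF + (fun x => id x - 1)⁻¹ := by
      ext z; simp
    rw [e]
    refine this.congr_deriv ?_
    simp only [id]; ring
  rw [h2.deriv_eq, h3.deriv] at hd
  have h4 : (fun n : ℕ => ((ArithmeticFunction.vonMangoldt n * (2 * U - Real.log n) : ℝ) : ℂ))
    = (2 * U : ℂ) • (fun n : ℕ => (ArithmeticFunction.vonMangoldt n : ℂ)) - LSeries.logMul (fun n => (ArithmeticFunction.vonMangoldt n : ℂ)) := by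
    ext n
    simp [LSeries.logMul, Complex.natCast_log]
    ring
  rw [h4, LSeries_sub (hS1.smul _) hS2, LSeries_smul, zz_LΛ s hs]
  linear_combination -hd

lemma zz_Mint (s : ℂ) (hs : 1 < s.re) (U : ℝ) :
   IntegrableOn (fun v : ℝ => ((2 * U * (Real.exp v - 1) - (v * Real.exp v - Real.exp v + 1) : ℝ) : ℂ) * cexp (-s * v)) (Ioi 0) ∧
   ∫ v in Ioi (0:ℝ), ((2 * U * (Real.exp v - 1) - (v * Real.exp v - Real.exp v + 1) : ℝ) : ℂ) * cexp (-s * v) = (2 * U / (s-1) - 1 / (s-1)^2) / s := by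
  have h1 : s - 1 ≠ 0 := by
    intro h; have : s = 1 := by linear_combination h
    rw [this] at hs; simp at hs
  have h0 : s ≠ 0 := by
    intro h; rw [h] at hs; simp at hs; linarith
  have i0 : IntegrableOn (fun v : ℝ => cexp (-s * v)) (Ioi 0) := integrableOn_exp_mul_complex_Ioi (by simp; linarith) 0
  have i1 : IntegrableOn (fun v : ℝ => cexp (-(s-1) * v)) (Ioi 0) := integrableOn_exp_mul_complex_Ioi (by simp; linarith) 0
  have e0 : ∫ v in Ioi (0:ℝ), cexp (-s * v) = 1 / s := by
    rw [integral_exp_mul_complex_Ioi (by simp; linarith)]; simp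
  have e1 : ∫ v in Ioi (0:ℝ), cexp (-(s-1) * v) = 1 / (s-1) := by
    rw [integral_exp_mul_complex_Ioi (by simp; linarith)]; rw [neg_div, ← div_neg]; simp
  have i2 : IntegrableOn (fun v : ℝ => (v:ℂ) * cexp (-(s-1) * v)) (Ioi 0) := by
    have hi : IntegrableOn (fun v : ℝ => (0 + 1/((s.re-1)/2)) * Real.exp (-((s.re - 1)/2) * v)) (Ioi 0) :=
      (exp_neg_integrableOn_Ioi 0 (by linarith)).const_mul _
    refine hi.mono' (Measurable.aestronglyMeasurable (by fun_prop)) ?_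
    filter_upwards [self_mem_ae_restrict measurableSet_Ioi] with v hv
    have hv0 : (0:ℝ) < v := hv
    rw [norm_mul, Complex.norm_exp, Complex.norm_real, Real.norm_of_nonneg hv0.le]
    have := zz_lin_le_exp 0 ((s.re-1)/2) v (by linarith) le_rfl hv0.le
    rw [zero_add] at this
    calc _ ≤ ((0 + 1/((s.re-1)/2)) * Real.exp ((s.re-1)/2 * v)) * Real.exp (-(s-1) * v).re := by gcongr
      _ = _ := by
        rw [mul_assoc, ← Real.exp_add]; congr 2; simp; ring
  have e2 : ∫ v in Ioi (0:ℝ), (v:ℂ) * cexp (-(s-1) * v) = 1 / (s-1)^2 := by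
    have hder : ∀ v ∈ Ici (0:ℝ), HasDerivAt (fun v : ℝ => -((v:ℂ)/(s-1) + 1/(s-1)^2) * cexp (-(s-1)*v)) ((v:ℂ) * cexp (-(s-1) * v)) v := by
      intro v _
      have a1 : HasDerivAt (fun v : ℝ => (v:ℂ)) 1 v := Complex.ofRealCLM.hasDerivAt
      have := (((a1.div_const (s-1)).add_const (1/(s-1)^2)).neg).mul ((a1.const_mul (-(s-1))).cexp)
      refine this.congr_deriv ?_
      simp only [Pi.neg_apply]
      field_simp
      ring
    have hlim : Tendsto (fun v : ℝ => -((v:ℂ)/(s-1) + 1/(s-1)^2) * cexp (-(s-1)*v)) atTop (𝓝 0) := by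
      apply tendsto_zero_of_hasDerivAt_of_integrableOn_Ioi (a := 0) (f' := fun v : ℝ => (v:ℂ) * cexp (-(s-1) * v))
      · intro v hv; exact hder v (mem_Ici.2 (le_of_lt (mem_Ioi.1 hv)))
      · exact i2
      · have := (i2.div_const (s-1)).neg.sub (i1.div_const ((s-1)^2))
        refine Integrable.congr this (Eventually.of_forall fun v => ?_)
        simp only [Pi.sub_apply, Pi.neg_apply]
        ring
    rw [integral_Ioi_of_hasDerivAt_of_tendsto' hder i2 hlim]
    simp
  have hc : ∀ v : ℝ, ((2 * U * (Real.exp v - 1) - (v * Real.exp v - Real.exp v + 1) : ℝ) : ℂ) * cexp (-s * v)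
     = (2 * U + 1) * cexp (-(s-1) * v) - (2 * U + 1) * cexp (-s * v) - (v:ℂ) * cexp (-(s-1) * v) := by
    intro v
    have : cexp (-(s-1)*v) = cexp v * cexp (-s * v) := by rw [← Complex.exp_add]; congr 1; ring
    rw [this]; push_cast; ring
  simp_rw [hc]
  have j : IntegrableOn (fun v : ℝ => (2 * U + 1 : ℂ) * cexp (-(s-1) * v) - (2 * U + 1 : ℂ) * cexp (-s * v)) (Ioi 0) := ((i1.const_mul (2*U+1:ℂ)).sub (i0.const_mul (2*U+1:ℂ)))
  refine ⟨j.sub i2, ?_⟩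
  rw [integral_sub j i2, integral_sub (i1.const_mul _) (i0.const_mul _), integral_const_mul, integral_const_mul, e0, e1, e2]
  field_simp
  ring

lemma zzr_laplace (U : ℝ) (hU : 0 ≤ U) (s : ℂ) (hs : 1 < s.re) :
   IntegrableOn (fun v : ℝ => (zzr U v : ℂ) * cexp (-s * v)) (Ioi 0) ∧
   ∫ v in Ioi (0:ℝ), (zzr U v : ℂ) * cexp (-s * v) = (2 * U * zzF s + deriv zzF s) / s := by
  have h0 : s ≠ 0 := by
    intro h; rw [h] at hs; simp at hs; linarith
  obtain ⟨i1, e1⟩ := zz_Mint s hs U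
  have i2 := zzA_int U hU s hs
  have e2 := zzA_laplace U hU s hs
  rw [zz_Lf U s hs] at e2
  have hc : ∀ v : ℝ, (zzr U v : ℂ) * cexp (-s * v) = (zzA U (Real.exp v) : ℂ) * cexp (-s * v) - ((2 * U * (Real.exp v - 1) - (v * Real.exp v - Real.exp v + 1) : ℝ) : ℂ) * cexp (-s * v) := by
    intro v; unfold zzr; push_cast; ring
  simp_rw [hc]
  refine ⟨i2.sub i1, ?_⟩
  rw [integral_sub i2 i1, e1]
  generalize (∫ (v : ℝ) in Ioi 0, (zzA U (Real.exp v) : ℂ) * cexp (-s * v)) = I at e2 ⊢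
  have : I = (2 * U * (zzF s + 1 / (s - 1)) + (deriv zzF s - 1 / (s - 1) ^ 2)) / s := by
    rw [e2]; field_simp
  rw [this]; ring


lemma zz_gaussF (ε y : ℝ) : Integrable (fun t : ℝ => cexp (((ε:ℂ) + t * I)^2/2 + ((ε:ℂ) + t * I) * y)) ∧
   ∫ t : ℝ, cexp (((ε:ℂ) + t * I)^2/2 + ((ε:ℂ) + t * I) * y) = Real.sqrt (2 * Real.pi) * Real.exp (-y^2/2) := by
  have hc : ∀ t : ℝ, ((ε:ℂ) + t * I)^2/2 + ((ε:ℂ) + t * I) * y = (-1/2 : ℂ) * (t:ℂ)^2 + (I * (ε + y)) * t + ((ε:ℂ)^2/2 + ε * y) := by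
    intro t
    linear_combination ((t:ℂ)^2/2) * Complex.I_sq
  simp_rw [hc]
  have hb : (-1/2 : ℂ).re < 0 := by norm_num
  refine ⟨integrable_cexp_quadratic' hb _ _, ?_⟩
  rw [integral_cexp_quadratic hb]
  congr 1
  · have h2 : (Real.pi : ℂ) / -(-1/2) = ((2 * Real.pi : ℝ) : ℂ) := by push_cast; ring
    have h3 : (1/2 : ℂ) = ((1/2 : ℝ) : ℂ) := by push_cast; ring
    have h4 : (0:ℝ) ≤ 2 * Real.pi := by positivity
    rw [Real.sqrt_eq_rpow, Complex.ofReal_cpow h4, h2, h3]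
  · rw [Complex.ofReal_exp]
    congr 1
    push_cast
    linear_combination (((ε:ℂ)+y)^2/2) * Complex.I_sq

noncomputable def zzK (U u ε t : ℝ) : ℂ :=
  (2 * U * zzF (1 + ε + t * I) + deriv zzF (1 + ε + t * I)) / (1 + ε + t * I) * cexp (((ε:ℂ) + t * I)^2/2 + ((ε:ℂ) + t * I) * u)

lemma zz_fourier (U u ε : ℝ) (hU : 0 ≤ U) (hε : 0 < ε) :
    Integrable (zzK U u ε) ∧
    IntegrableOn (fun v : ℝ => zzr U v * Real.exp (-v) * Real.exp (-(u-v)^2/2)) (Ioi 0) ∧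
    ((Real.sqrt (2 * Real.pi) * ∫ v in Ioi (0:ℝ), zzr U v * Real.exp (-v) * Real.exp (-(u-v)^2/2) : ℝ) : ℂ) = ∫ t : ℝ, zzK U u ε t := by
  have hre : ∀ t : ℝ, (1 + (ε:ℂ) + t * I).re = 1 + ε := by intro t; simp
  have h1 := (zzr_laplace U hU (1 + ε) (by simp; linarith)).1
  have h2 := (zz_gaussF ε u).1
  have h3 := Integrable.mul_prod (ν := volume) h1 h2
  have h4 : Integrable (fun z : ℝ × ℝ => cexp (-(z.2 * I) * z.1) * ((zzr U z.1 * cexp (-(1 + ε) * z.1)) * cexp (((ε:ℂ) + z.2 * I)^2/2 + ((ε:ℂ) + z.2 * I) * u))) ((volume.restrict (Ioi (0:ℝ))).prod volume) := by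
    refine Integrable.bdd_mul (c := 1) h3 (Continuous.aestronglyMeasurable (by fun_prop)) (Eventually.of_forall fun z => ?_)
    rw [Complex.norm_exp]; simp
  have e1 : ∀ v t : ℝ, cexp (-(t * I) * v) * ((zzr U v * cexp (-(1 + ε) * v)) * cexp (((ε:ℂ) + t * I)^2/2 + ((ε:ℂ) + t * I) * u))
     = (zzr U v * Real.exp (-v)) * cexp (((ε:ℂ) + t * I)^2/2 + ((ε:ℂ) + t * I) * ((u - v : ℝ) : ℂ)) := by
    intro v t
    have : cexp (((ε:ℂ) + t * I)^2/2 + ((ε:ℂ) + t * I) * ((u - v : ℝ) : ℂ)) = cexp (-(t * I) * v) * cexp (- (ε:ℂ) * v) * cexp (((ε:ℂ) + t * I)^2/2 + ((ε:ℂ) + t * I) * u) := by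
      rw [← Complex.exp_add, ← Complex.exp_add]; congr 1; push_cast; ring
    rw [this]
    have : cexp (-(1 + ε) * v) = Real.exp (-v) * cexp (- (ε:ℂ) * v) := by
      rw [Complex.ofReal_exp, ← Complex.exp_add]; congr 1; push_cast; ring
    rw [this]; ring
  have e2 : ∀ v t : ℝ, cexp (-(t * I) * v) * ((zzr U v * cexp (-(1 + ε) * v)) * cexp (((ε:ℂ) + t * I)^2/2 + ((ε:ℂ) + t * I) * u))
     = (zzr U v * cexp (-(1 + ε + t * I) * v)) * cexp (((ε:ℂ) + t * I)^2/2 + ((ε:ℂ) + t * I) * u) := by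
    intro v t
    have : cexp (-(1 + ε + t * I) * v) = cexp (-(t * I) * v) * cexp (-(1 + ε) * v) := by
      rw [← Complex.exp_add]; congr 1; ring
    rw [this]; ring
  have f2 : ∀ t : ℝ, ∫ v in Ioi (0:ℝ), cexp (-(t * I) * v) * ((zzr U v * cexp (-(1 + ε) * v)) * cexp (((ε:ℂ) + t * I)^2/2 + ((ε:ℂ) + t * I) * u)) = zzK U u ε t := by
    intro t
    simp_rw [e2]
    rw [integral_mul_const, (zzr_laplace U hU (1 + ε + t * I) (by rw [hre]; linarith)).2]
    rfl
  have f1 : ∀ v : ℝ, ∫ t : ℝ, cexp (-(t * I) * v) * ((zzr U v * cexp (-(1 + ε) * v)) * cexp (((ε:ℂ) + t * I)^2/2 + ((ε:ℂ) + t * I) * u))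
     = ((Real.sqrt (2 * Real.pi) * (zzr U v * Real.exp (-v) * Real.exp (-(u-v)^2/2)) : ℝ) : ℂ) := by
    intro v
    simp_rw [e1]
    rw [integral_const_mul, (zz_gaussF ε (u-v)).2]
    push_cast; ring
  have g2 := h4.integral_prod_right
  have g1 := h4.integral_prod_left
  simp only [f2] at g2
  simp only [f1] at g1
  have hs : (Real.sqrt (2 * Real.pi)) ≠ 0 := by positivity
  refine ⟨g2, ?_, ?_⟩
  · have := (g1.re).const_mul (Real.sqrt (2 * Real.pi))⁻¹
    refine Integrable.congr this (Eventually.of_forall fun v => ?_)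
    simp only [RCLike.re_eq_complex_re, Complex.ofReal_re]
    field_simp
  · have := integral_integral_swap (f := fun v t : ℝ => cexp (-(t * I) * v) * ((zzr U v * cexp (-(1 + ε) * v)) * cexp (((ε:ℂ) + t * I)^2/2 + ((ε:ℂ) + t * I) * u))) h4
    simp only [f1, f2] at this
    rw [← this, ← integral_const_mul]
    exact (integral_ofReal (𝕜 := ℂ)).symm


lemma zz_O_open : IsOpen {s : ℂ | -2 < s.re ∧ zzH s ≠ 0} := by
  have h1 : IsOpen {s : ℂ | -2 < s.re} := isOpen_lt continuous_const Complex.continuous_re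
  have h2 : ContinuousOn zzH {s : ℂ | -2 < s.re} := fun s hs => (zzH_diff s hs).continuousAt.continuousWithinAt
  exact h2.isOpen_inter_preimage h1 isOpen_compl_singleton

lemma zzF_dO : DifferentiableOn ℂ zzF {s : ℂ | -2 < s.re ∧ zzH s ≠ 0} := fun s hs =>
  (zzF_hasDeriv s hs.1 hs.2).differentiableAt.differentiableWithinAt

lemma zzF_dA (s : ℂ) (h1 : -2 < s.re) (h2 : zzH s ≠ 0) : DifferentiableAt ℂ zzF s ∧ DifferentiableAt ℂ (deriv zzF) s := by
  have hm := zz_O_open.mem_nhds (show s ∈ {s : ℂ | -2 < s.re ∧ zzH s ≠ 0} from ⟨h1, h2⟩)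
  exact ⟨zzF_dO.differentiableAt hm, (zzF_dO.deriv zz_O_open).differentiableAt hm⟩

lemma zz_e81 : Real.exp (-(81/4)) ≤ 0.0000000021 := by
  have h1 : Real.exp (-(81/4)) ≤ Real.exp (-20) := Real.exp_le_exp.2 (by norm_num)
  have h2 : Real.exp (-20) = (Real.exp 1 ^ 20)⁻¹ := by
    rw [← Real.exp_nat_mul, Real.exp_neg]; norm_num
  have h3 : (2.718:ℝ)^20 ≤ Real.exp 1 ^ 20 := by
    have := Real.exp_one_gt_d9
    gcongr; linarith
  rw [h2] at h1
  refine h1.trans ((inv_anti₀ (by norm_num) h3).trans (by norm_num))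

lemma zz_tgauss : IntegrableOn (fun t : ℝ => t * Real.exp (-t^2/4)) (Ioi 9) ∧
    ∫ t in Ioi (9:ℝ), t * Real.exp (-t^2/4) = 2 * Real.exp (-(81/4)) := by
  have hi : IntegrableOn (fun t : ℝ => t * Real.exp (-t^2/4)) (Ioi 9) := by
    have := (integrable_mul_exp_neg_mul_sq (b := 1/4) (by norm_num)).integrableOn (s := Ioi 9)
    refine Integrable.congr this (Eventually.of_forall fun t => ?_)
    simp only; congr 2; ring
  refine ⟨hi, ?_⟩
  have hd : ∀ t ∈ Ici (9:ℝ), HasDerivAt (fun t : ℝ => -2 * Real.exp (-t^2/4)) (t * Real.exp (-t^2/4)) t := by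
    intro t _
    have := ((((hasDerivAt_pow 2 t).neg).div_const 4).exp).const_mul (-2)
    refine this.congr_deriv ?_
    simp; ring
  have hlim : Tendsto (fun t : ℝ => -2 * Real.exp (-t^2/4)) atTop (𝓝 0) := by
    have h1 : Tendsto (fun t : ℝ => -t^2/4) atTop atBot := by
      have : Tendsto (fun t : ℝ => t^2) atTop atTop := tendsto_pow_atTop (by norm_num)
      exact (tendsto_neg_atTop_atBot.comp this).atBot_div_const (by norm_num)
    simpa using (Real.tendsto_exp_atBot.comp h1).const_mul (-2)
  rw [integral_Ioi_of_hasDerivAt_of_tendsto' hd hi hlim]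
  norm_num

lemma zz_wexp (x y u : ℝ) : ‖cexp (((x:ℂ) + y * I)^2/2 + ((x:ℂ) + y * I) * u)‖ = Real.exp ((x^2 - y^2)/2 + x * u) := by
  rw [Complex.norm_exp]
  congr 1
  have : ((x:ℂ) + y * I)^2/2 + ((x:ℂ) + y * I) * u = (((x^2 - y^2)/2 + x * u : ℝ) : ℂ) + ((x*y + y * u : ℝ) : ℂ) * I := by
    push_cast
    linear_combination ((y:ℂ)^2/2) * Complex.I_sq
  rw [this, Complex.add_re, Complex.re_ofReal_mul, Complex.I_re, mul_zero, add_zero, Complex.ofReal_re]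

set_option maxHeartbeats 1000000 in
lemma zz_tailint (u U η : ℝ) (hu : 37/2 ≤ u) (hU0 : 0 ≤ U) (hU : U ≤ u) (hη : η^2 = 1) :
    ‖∫ t in Ioi (9:ℝ), zzK U u (1/u) (η * t)‖ ≤ 1/25 := by
  have hu0 : 0 < u := by linarith
  set ε : ℝ := 1/u with hε
  have hε0 : 0 < ε := by positivity
  have hε1 : ε ≤ 1/10 := by
    rw [hε]; exact one_div_le_one_div_of_le (by norm_num) (by linarith)
  have hεu : ε * u = 1 := by rw [hε]; field_simp
  have hηa : |η| = 1 := by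
    rw [← sq_eq_sq₀ (abs_nonneg _) (by norm_num), sq_abs, hη]; norm_num
  have habs : ∀ t : ℝ, 0 ≤ t → |η * t| = t := by
    intro t ht; rw [abs_mul, hηa, abs_of_nonneg ht, one_mul]
  -- basic data
  let w : ℝ → ℂ := fun t => (ε:ℂ) + ((η * t : ℝ) : ℂ) * I
  let E : ℝ → ℂ := fun t => cexp ((w t)^2/2 + w t * u)
  let P : ℝ → ℂ := fun t => zzF (1 + w t) / (1 + w t) * E t
  let Q : ℝ → ℂ := fun t => deriv zzF (1 + w t) / (1 + w t) * E t
  let B : ℝ → ℂ := fun t => (w t - 1 / (1 + w t)) * P t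
  have hre : ∀ t, (1 + w t).re = 1 + ε := by intro t; simp [w]
  have him : ∀ t, (1 + w t).im = η * t := by intro t; simp [w]
  have hne : ∀ t, 1 + w t ≠ 0 := by
    intro t h; have := hre t; rw [h] at this; simp at this; linarith
  have hT : ∀ t : ℝ, 9 ≤ t → zzH (1 + w t) ≠ 0 ∧ ‖zzF (1 + w t)‖ ≤ 4*10^6*Real.exp (t^2/4) ∧ ‖deriv zzF (1 + w t)‖ ≤ 4*10^6*Real.exp (t^2/4) := by
    intro t ht
    have := zz_tail (1 + w t) (by rw [hre]; linarith) (by rw [hre]; linarith) (by rw [him, habs t (by linarith)]; exact ht)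
    rw [him, mul_pow, hη, one_mul] at this
    exact this
  have hnorm : ∀ t : ℝ, 9 ≤ t → t ≤ ‖1 + w t‖ := by
    intro t ht
    have := Complex.abs_im_le_norm (1 + w t)
    rwa [him, habs t (by linarith)] at this
  have hE : ∀ t, ‖E t‖ ≤ 2.8 * Real.exp (-t^2/2) := by
    intro t
    simp only [E, w]
    rw [zz_wexp, hεu, mul_pow, hη, one_mul]
    have h1 : (ε^2 - t^2)/2 + 1 = (ε^2/2 + 1) + (-t^2/2) := by ring
    rw [h1, Real.exp_add]
    gcongr
    have h2 : ε^2/2 ≤ 1/200 := by nlinarith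
    rw [Real.exp_add]
    have h3 := Real.exp_one_lt_d9
    have h4 : Real.exp (ε^2/2) ≤ 1.01 := by
      have h5 := Real.exp_bound_div_one_sub_of_interval (x := 1/200) (by norm_num) (by norm_num)
      exact (Real.exp_le_exp.2 h2).trans (h5.trans (by norm_num))
    have h5 := Real.exp_pos (ε^2/2)
    nlinarith
  have hEE : ∀ t : ℝ, Real.exp (t^2/4) * Real.exp (-t^2/2) = Real.exp (-t^2/4) := by
    intro t; rw [← Real.exp_add]; congr 1; ring
  have hgen : ∀ t : ℝ, 9 ≤ t → ∀ z : ℂ, ‖z‖ ≤ 4*10^6*Real.exp (t^2/4) → ‖z / (1 + w t) * E t‖ ≤ (11200000 / t) * Real.exp (-t^2/4) := by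
    intro t ht z hz
    have ht0 : 0 < t := by linarith
    rw [norm_mul, norm_div]
    calc _ ≤ (4*10^6*Real.exp (t^2/4)) / t * (2.8 * Real.exp (-t^2/2)) := by
          gcongr
          · exact hnorm t ht
          · exact hE t
      _ = (11200000 / t) * (Real.exp (t^2/4) * Real.exp (-t^2/2)) := by ring
      _ = _ := by rw [hEE]
  have hP : ∀ t : ℝ, 9 ≤ t → ‖P t‖ ≤ (11200000 / t) * Real.exp (-t^2/4) := fun t ht => hgen t ht _ (hT t ht).2.1
  have hQ : ∀ t : ℝ, 9 ≤ t → ‖Q t‖ ≤ (11200000 / t) * Real.exp (-t^2/4) := fun t ht => hgen t ht _ (hT t ht).2.2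
  have hinv : ∀ t : ℝ, 9 ≤ t → 11200000 / t ≤ 140000 * t := by
    intro t ht
    rw [div_le_iff₀ (by linarith)]; nlinarith
  have hB : ∀ t : ℝ, 9 ≤ t → ‖B t‖ ≤ 1900000 * t * Real.exp (-t^2/4) := by
    intro t ht
    have ht0 : 0 < t := by linarith
    have h1 : ‖w t - 1/(1 + w t)‖ ≤ t + 1 := by
      have a1 : ‖w t‖ ≤ ε + t := by
        simp only [w]
        refine (norm_add_le _ _).trans ?_
        rw [norm_mul, Complex.norm_I, mul_one, Complex.norm_real, Complex.norm_real, Real.norm_eq_abs, Real.norm_eq_abs, habs t ht0.le, abs_of_pos hε0]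
      have a2 : ‖1/(1 + w t)‖ ≤ 1/9 := by
        rw [norm_div, norm_one]
        exact one_div_le_one_div_of_le (by norm_num) (ht.trans (hnorm t ht))
      refine (norm_sub_le _ _).trans ?_
      linarith
    simp only [B]
    rw [norm_mul]
    calc _ ≤ (t+1) * ((11200000 / t) * Real.exp (-t^2/4)) := by
          gcongr
          exact hP t ht
      _ = ((t+1) * (11200000 / t)) * Real.exp (-t^2/4) := by ring
      _ ≤ _ := by
          refine mul_le_mul_of_nonneg_right ?_ (Real.exp_pos _).le
          rw [mul_div_assoc', div_le_iff₀ ht0]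
          nlinarith
  -- regularity
  have hwd : ∀ t, HasDerivAt w (η * I) t := by
    intro t
    have a1 : HasDerivAt (fun t : ℝ => ((η * t : ℝ):ℂ)) η t := by
      have := ((hasDerivAt_id t).const_mul η).ofReal_comp
      simpa using this
    exact (a1.mul_const I).const_add (ε:ℂ)
  have hwc : Continuous w := by simp only [w]; fun_prop
  have hEc : Continuous E := by simp only [E]; fun_prop
  have hFc : ContinuousOn (fun t => zzF (1 + w t)) (Ioi 9) := by
    intro t ht
    have ht' : 9 ≤ t := le_of_lt (mem_Ioi.1 ht)
    have h1 := (zzF_dA (1 + w t) (by rw [hre]; linarith) (hT t ht').1).1.continuousAt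
    have h2 : ContinuousAt (fun t => 1 + w t) t := by fun_prop
    exact (ContinuousAt.comp (f := fun t => 1 + w t) h1 h2).continuousWithinAt
  have hFc' : ContinuousOn (fun t => deriv zzF (1 + w t)) (Ioi 9) := by
    intro t ht
    have ht' : 9 ≤ t := le_of_lt (mem_Ioi.1 ht)
    have h1 := (zzF_dA (1 + w t) (by rw [hre]; linarith) (hT t ht').1).2.continuousAt
    have h2 : ContinuousAt (fun t => 1 + w t) t := by fun_prop
    exact (ContinuousAt.comp (f := fun t => 1 + w t) h1 h2).continuousWithinAt
  have hsc : ContinuousOn (fun t => 1 + w t) (Ioi 9) := by fun_prop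
  have hPc : ContinuousOn P (Ioi 9) := (hFc.div hsc fun t _ => hne t).mul hEc.continuousOn
  have hQc : ContinuousOn Q (Ioi 9) := (hFc'.div hsc fun t _ => hne t).mul hEc.continuousOn
  have hBc : ContinuousOn B (Ioi 9) :=
    (hwc.continuousOn.sub (continuousOn_const.div hsc fun t _ => hne t)).mul hPc
  have hintg : ∀ f : ℝ → ℂ, ContinuousOn f (Ioi 9) → (∀ t : ℝ, 9 ≤ t → ‖f t‖ ≤ 1900000 * t * Real.exp (-t^2/4)) → IntegrableOn f (Ioi 9) := by
    intro f hf hb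
    refine (zz_tgauss.1.const_mul 1900000).mono' (hf.aestronglyMeasurable measurableSet_Ioi) ?_
    filter_upwards [self_mem_ae_restrict measurableSet_Ioi] with t ht
    rw [← mul_assoc]
    exact hb t (le_of_lt (mem_Ioi.1 ht))
  have hsm : ∀ t : ℝ, 9 ≤ t → (11200000 / t) * Real.exp (-t^2/4) ≤ 140000 * t * Real.exp (-t^2/4) := by
    intro t ht; have := hinv t ht; gcongr
  have hsm2 : ∀ t : ℝ, 9 ≤ t → 140000 * t * Real.exp (-t^2/4) ≤ 1900000 * t * Real.exp (-t^2/4) := by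
    intro t ht; gcongr; norm_num
  have hPi := hintg P hPc (fun t ht => (hP t ht).trans ((hsm t ht).trans (hsm2 t ht)))
  have hQi := hintg Q hQc (fun t ht => (hQ t ht).trans ((hsm t ht).trans (hsm2 t ht)))
  have hBi := hintg B hBc hB
  have hPd : ∀ t ∈ Ici (9:ℝ), HasDerivAt P ((η * I) * (Q t + B t + u * P t)) t := by
    intro t ht
    have ht' : 9 ≤ t := mem_Ici.1 ht
    have h1 := (zzF_dA (1 + w t) (by rw [hre]; linarith) (hT t ht').1).1.hasDerivAt
    have h2 : HasDerivAt (fun t => 1 + w t) (η * I) t := (hwd t).const_add 1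
    have h3 : HasDerivAt (fun t => zzF (1 + w t)) (deriv zzF (1 + w t) * (η * I)) t := HasDerivAt.comp (h₂ := zzF) (h := fun t => 1 + w t) t h1 h2
    have h4 : HasDerivAt E (E t * ((2 * w t * (η * I))/2 + (η * I) * u)) t := by
      have := ((((hwd t).pow 2).div_const 2).add ((hwd t).mul_const (u:ℂ))).cexp
      refine this.congr_deriv ?_
      simp [E]
    refine ((h3.div h2 (hne t)).mul h4).congr_deriv ?_
    simp only [Q, B, P]
    have := hne t
    simp only [Pi.div_apply]
    generalize zzF (1 + w t) = f
    generalize deriv zzF (1 + w t) = f'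
    generalize E t = e
    field_simp
    ring
  have hdi : IntegrableOn (fun t => (η * I) * (Q t + B t + u * P t)) (Ioi 9) :=
    ((hQi.add hBi).add (hPi.const_mul (u:ℂ))).const_mul (η * I)
  have hlim : Tendsto P atTop (𝓝 0) := tendsto_zero_of_hasDerivAt_of_integrableOn_Ioi (a := 9)
    (fun t ht => hPd t (mem_Ici.2 (le_of_lt (mem_Ioi.1 ht)))) hdi hPi
  have hI := integral_Ioi_of_hasDerivAt_of_tendsto' hPd hdi hlim
  -- decomposition
  have hηc : (η:ℂ)^2 = 1 := by exact_mod_cast hη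
  have huc : (u:ℂ) ≠ 0 := by exact_mod_cast hu0.ne'
  have hdec : ∀ t : ℝ, zzK U u ε (η * t) = (-(2*U/u) * η * I) * ((η * I) * (Q t + B t + u * P t)) + ((1 - 2*U/u) * Q t + (-(2*U/u)) * B t) := by
    intro t
    have : zzK U u ε (η * t) = 2 * U * P t + Q t := by
      simp only [zzK, P, Q, E, w]
      rw [add_assoc]
      ring
    rw [this]
    have h2 : (-(2*U/u) * η * I) * ((η * I) * (Q t + B t + u * P t)) = (2*U/u) * (Q t + B t + u * P t) := by
      linear_combination (-(2*U/u) * (η:ℂ)^2 * (Q t + B t + u * P t)) * Complex.I_sq + ((2*U/u)* (Q t + B t + u * P t)) * hηc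
    rw [h2]
    field_simp
    ring
  simp_rw [hdec]
  have hRi : IntegrableOn (fun t => (1 - 2*U/u : ℂ) * Q t + (-(2*U/u) : ℂ) * B t) (Ioi 9) :=
    (hQi.const_mul _).add (hBi.const_mul _)
  rw [integral_add (hdi.const_mul _) hRi, integral_const_mul, hI]
  have hr1 : |2 * U / u| ≤ 2 := by
    rw [abs_of_nonneg (by positivity), div_le_iff₀ hu0]; linarith
  have hr2 : |1 - 2 * U / u| ≤ 1 := by
    rw [abs_of_nonneg (by positivity)] at hr1
    have : 0 ≤ 2 * U / u := by positivity
    rw [abs_le]; constructor <;> linarith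
  have c1 : ‖(-(2*U/u) : ℂ)‖ ≤ 2 := by
    have : (-(2*U/u) : ℂ) = ((-(2*U/u) : ℝ) : ℂ) := by push_cast; ring
    rw [this, Complex.norm_real, Real.norm_eq_abs, abs_neg]; exact hr1
  have c2 : ‖(1 - 2*U/u : ℂ)‖ ≤ 1 := by
    have : (1 - 2*U/u : ℂ) = ((1 - 2*U/u : ℝ) : ℂ) := by push_cast; ring
    rw [this, Complex.norm_real, Real.norm_eq_abs]; exact hr2
  have b1 : ‖(-(2*U/u) * η * I : ℂ) * (0 - P 9)‖ ≤ 2 * (11200000/9 * 0.0000000021) := by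
    rw [norm_mul, norm_mul, norm_mul, Complex.norm_I, mul_one, Complex.norm_real, Real.norm_eq_abs, hηa, mul_one, zero_sub, norm_neg]
    have := hP 9 le_rfl
    have e : (-9^2/4 : ℝ) = -(81/4) := by norm_num
    rw [e] at this
    have h81 := zz_e81
    refine mul_le_mul (by simpa only [norm_neg] using c1) ((norm_neg (P 9)).le.trans (this.trans ?_)) (norm_nonneg _) (by norm_num)
    gcongr
  have b2 : ‖∫ t in Ioi (9:ℝ), ((1 - 2*U/u : ℂ) * Q t + (-(2*U/u) : ℂ) * B t)‖ ≤ ∫ t in Ioi (9:ℝ), 3940000 * (t * Real.exp (-t^2/4)) := by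
    refine norm_integral_le_of_norm_le (zz_tgauss.1.const_mul _) ?_
    filter_upwards [self_mem_ae_restrict measurableSet_Ioi] with t ht
    have ht' : 9 ≤ t := le_of_lt (mem_Ioi.1 ht)
    refine (norm_add_le _ _).trans ?_
    rw [norm_mul (1 - 2*U/u : ℂ) (Q t), norm_mul (-(2*U/u) : ℂ) (B t)]
    have q1 := (hQ t ht').trans (hsm t ht')
    have q2 := hB t ht'
    calc _ ≤ 1 * (140000 * t * Real.exp (-t^2/4)) + 2 * (1900000 * t * Real.exp (-t^2/4)) :=
          add_le_add (mul_le_mul c2 q1 (norm_nonneg _) (by norm_num)) (mul_le_mul c1 q2 (norm_nonneg _) (by norm_num))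
      _ = _ := by ring
  rw [integral_const_mul, zz_tgauss.2] at b2
  have := zz_e81
  calc _ ≤ _ := norm_add_le _ _
    _ ≤ 2 * (11200000/9 * 0.0000000021) + 3940000 * (2 * 0.0000000021) := by
        gcongr
        exact b2.trans (by gcongr)
    _ ≤ _ := by norm_num


noncomputable def zzKc (U u : ℝ) (z : ℂ) : ℂ :=
  (2 * U * zzF (1 + z) + deriv zzF (1 + z)) / (1 + z) * cexp (z^2/2 + z * u)

lemma zzKc_bound (U u x y : ℝ) (hU : 0 ≤ U) (hx1 : -(1/2) ≤ x) (hx2 : x ≤ 1/10) (hy : |y| ≤ 9) :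
    DifferentiableAt ℂ (zzKc U u) (x + y * I) ∧
    ‖zzKc U u (x + y * I)‖ ≤ 2 * (48 * U + 625) * Real.exp (x^2/2 + x * u - y^2/4) := by
  have hre : (1 + ((x:ℂ) + y * I)).re = 1 + x := by simp
  have him : (1 + ((x:ℂ) + y * I)).im = y := by simp
  obtain ⟨h0, h1, h2⟩ := zz_rect (1 + ((x:ℂ) + y * I)) (by rw [hre]; linarith) (by rw [hre]; linarith) (by rw [him]; exact hy)
  rw [him] at h1 h2
  have hs : 1/2 ≤ ‖1 + ((x:ℂ) + y * I)‖ := by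
    have := Complex.re_le_norm (1 + ((x:ℂ) + y * I))
    rw [hre] at this; linarith
  constructor
  · obtain ⟨d1, d2⟩ := zzF_dA (1 + ((x:ℂ) + y * I)) (by rw [hre]; linarith) h0
    have e : DifferentiableAt ℂ (fun z : ℂ => 1 + z) (x + y * I) := by fun_prop
    have d1' : DifferentiableAt ℂ (fun z : ℂ => zzF (1 + z)) (x + y * I) :=
      DifferentiableAt.comp (g := zzF) (f := fun z : ℂ => 1 + z) _ d1 e
    have d2' : DifferentiableAt ℂ (fun z : ℂ => deriv zzF (1 + z)) (x + y * I) :=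
      DifferentiableAt.comp (g := deriv zzF) (f := fun z : ℂ => 1 + z) _ d2 e
    have hne : 1 + ((x:ℂ) + y * I) ≠ 0 := by
      intro h; rw [h, norm_zero] at hs; norm_num at hs
    unfold zzKc
    exact (((d1'.const_mul _).add d2').div e hne).mul (by fun_prop)
  · unfold zzKc
    rw [norm_mul, norm_div, zz_wexp]
    have hn : ‖2 * (U:ℂ) * zzF (1 + (x + y * I)) + deriv zzF (1 + (x + y * I))‖ ≤ (48 * U + 625) * Real.exp (y^2/4) := by
      refine (norm_add_le _ _).trans ?_
      rw [norm_mul, norm_mul, Complex.norm_real, Real.norm_of_nonneg hU, Complex.norm_ofNat]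
      have : 2 * U * ‖zzF (1 + (x + y * I))‖ ≤ 2 * U * (24 * Real.exp (y^2/4)) := by gcongr
      linarith
    calc _ ≤ ((48 * U + 625) * Real.exp (y^2/4)) / (1/2) * Real.exp ((x^2-y^2)/2 + x * u) := by
          gcongr
      _ = 2 * (48 * U + 625) * (Real.exp (y^2/4) * Real.exp ((x^2-y^2)/2 + x * u)) := by ring
      _ = _ := by
          rw [← Real.exp_add]; congr 2; ring

lemma zz_expint (a b u : ℝ) (hu : u ≠ 0) : ∫ x in a..b, Real.exp (x * u) = (Real.exp (b * u) - Real.exp (a * u)) / u := by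
  have hd : ∀ x ∈ uIcc a b, HasDerivAt (fun x => Real.exp (x * u) / u) (Real.exp (x * u)) x := by
    intro x _
    have := (((hasDerivAt_id x).mul_const u).exp).div_const u
    refine this.congr_deriv ?_
    simp; field_simp
  rw [intervalIntegral.integral_eq_sub_of_hasDerivAt hd (Continuous.intervalIntegrable (by fun_prop) _ _)]
  ring

lemma zz_e18 : Real.exp (1/8) ≤ 1.2 := by
  have h5 := Real.exp_bound_div_one_sub_of_interval (x := 1/8) (by norm_num) (by norm_num)
  exact h5.trans (by norm_num)

lemma zz_horiz (U u y : ℝ) (hu : 37/2 ≤ u) (hU0 : 0 ≤ U) (hU : U ≤ u) (hy : y^2 = 81) :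
    ‖∫ x in (-(1/2):ℝ)..(1/u), zzKc U u (x + y * I)‖ ≤ 1/100 := by
  have hu0 : 0 < u := by linarith
  have hε1 : 1/u ≤ 1/10 := one_div_le_one_div_of_le (by norm_num) (by linarith)
  have hε0 : 0 < 1/u := by positivity
  have hy9 : |y| ≤ 9 := by
    rw [← sq_le_sq₀ (abs_nonneg _) (by norm_num), sq_abs, hy]; norm_num
  have h1 : ‖∫ x in (-(1/2):ℝ)..(1/u), zzKc U u (x + y * I)‖ ≤ ∫ x in (-(1/2):ℝ)..(1/u), (2 * (48 * U + 625) * (1.2 * 0.0000000021)) * Real.exp (x * u) := by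
    refine intervalIntegral.norm_integral_le_of_norm_le (by linarith) (Eventually.of_forall fun x hx => ?_) (Continuous.intervalIntegrable (by fun_prop) _ _)
    have hx1 : -(1/2) ≤ x := hx.1.le
    have hx2 : x ≤ 1/10 := hx.2.trans hε1
    refine (zzKc_bound U u x y hU0 hx1 hx2 hy9).2.trans ?_
    rw [mul_assoc (2 * (48 * U + 625))]
    refine mul_le_mul_of_nonneg_left ?_ (by positivity)
    rw [hy]
    have e : x^2/2 + x * u - 81/4 = x^2/2 + -(81/4) + x * u := by ring
    rw [e, Real.exp_add, Real.exp_add]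
    have e1 := zz_e81
    have e2 : Real.exp (x^2/2) ≤ 1.2 := (Real.exp_le_exp.2 (by nlinarith)).trans zz_e18
    gcongr
  refine h1.trans ?_
  rw [intervalIntegral.integral_const_mul, zz_expint _ _ _ hu0.ne']
  have e3 : Real.exp (1/u * u) ≤ 2.72 := by
    rw [one_div_mul_cancel hu0.ne']
    have := Real.exp_one_lt_d9; linarith
  have e4 := Real.exp_pos (-(1/2) * u)
  have e5 : (Real.exp (1/u * u) - Real.exp (-(1/2) * u)) / u ≤ 2.72 / u := by gcongr; linarith
  calc _ ≤ 2 * (48 * U + 625) * (1.2 * 0.0000000021) * (2.72 / u) := by gcongr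
    _ ≤ 1/100 := by
      rw [mul_div_assoc', div_le_iff₀ hu0]
      nlinarith

lemma zz_mid (U u : ℝ) (hu : 37/2 ≤ u) (hU0 : 0 ≤ U) (hU : U ≤ u) :
    ‖∫ t in (-9:ℝ)..9, zzK U u (1/u) t‖ ≤ 2 * (48 * U + 625) * Real.exp (1/8 - u/2) * (2 * Real.sqrt Real.pi) + 1/50 := by
  have hu0 : 0 < u := by linarith
  have hε1 : 1/u ≤ 1/10 := one_div_le_one_div_of_le (by norm_num) (by linarith)
  have hε0 : 0 < 1/u := by positivity
  have hK : ∀ t : ℝ, zzK U u (1/u) t = zzKc U u (((1/u : ℝ) : ℂ) + t * I) := by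
    intro t; unfold zzK zzKc; rw [add_assoc]
  have hdiff : DifferentiableOn ℂ (zzKc U u) (uIcc (-(1/2) : ℝ) (1/u) ×ℂ uIcc (-9:ℝ) 9) := by
    intro z hz
    rw [mem_reProdIm, uIcc_of_le (by linarith), uIcc_of_le (by norm_num)] at hz
    have := (zzKc_bound U u z.re z.im hU0 hz.1.1 (hz.1.2.trans hε1) (abs_le.2 ⟨hz.2.1, hz.2.2⟩)).1
    rw [Complex.re_add_im] at this
    exact this.differentiableWithinAt
  have hrect := Complex.integral_boundary_rect_eq_zero_of_differentiableOn (zzKc U u) ⟨-(1/2), -9⟩ ⟨1/u, 9⟩ hdiff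
  simp only at hrect
  simp_rw [hK]
  have b1 := zz_horiz U u (-9) hu hU0 hU (by norm_num)
  have b2 := zz_horiz U u 9 hu hU0 hU (by norm_num)
  have b3 : ‖∫ y in (-9:ℝ)..9, zzKc U u (((-(1/2) : ℝ):ℂ) + y * I)‖ ≤ 2 * (48 * U + 625) * Real.exp (1/8 - u/2) * (2 * Real.sqrt Real.pi) := by
    have hg : Integrable (fun y : ℝ => Real.exp (-(1/4) * y^2)) := integrable_exp_neg_mul_sq (by norm_num)
    have a1 : ‖∫ y in (-9:ℝ)..9, zzKc U u (((-(1/2) : ℝ):ℂ) + y * I)‖ ≤ ∫ y in (-9:ℝ)..9, 2 * (48 * U + 625) * Real.exp (1/8 - u/2) * Real.exp (-(1/4) * y^2) := by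
      refine intervalIntegral.norm_integral_le_of_norm_le (by norm_num) (Eventually.of_forall fun y hy => ?_) (Continuous.intervalIntegrable (by fun_prop) _ _)
      refine (zzKc_bound U u (-(1/2)) y hU0 le_rfl (by norm_num) (abs_le.2 ⟨hy.1.le, hy.2⟩)).2.trans ?_
      rw [mul_assoc (2 * (48 * U + 625)), ← Real.exp_add]
      refine le_of_eq ?_
      have : ((-(1/2))^2/2 + -(1/2)*u - y^2/4 : ℝ) = 1/8 - u/2 + -(1/4) * y^2 := by ring
      rw [this]
    refine a1.trans ?_
    rw [intervalIntegral.integral_const_mul, intervalIntegral.integral_of_le (by norm_num)]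
    refine mul_le_mul_of_nonneg_left ?_ (by positivity)
    refine (setIntegral_le_integral hg (Eventually.of_forall fun y => (Real.exp_pos _).le)).trans ?_
    rw [integral_gaussian]
    have : Real.pi / (1/4) = 2^2 * Real.pi := by ring
    rw [this, Real.sqrt_mul (by norm_num), Real.sqrt_sq (by norm_num)]
  push_cast at hrect b1 b2 b3 ⊢
  simp only [smul_eq_mul] at hrect
  set R := ∫ t in (-9:ℝ)..9, zzKc U u (1/(u:ℂ) + t * I)
  set L := ∫ y in (-9:ℝ)..9, zzKc U u (-(1/2) + y * I)
  set T := ∫ x in (-(1/2):ℝ)..(1/u), zzKc U u (x + 9 * I)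
  set D := ∫ x in (-(1/2):ℝ)..(1/u), zzKc U u (x + -9 * I)
  have hR : R = L + I * D - I * T := by
    linear_combination (-I) * hrect + (R - L) * Complex.I_sq
  rw [hR]
  calc _ ≤ ‖L + I * D‖ + ‖I * T‖ := norm_sub_le _ _
    _ ≤ (‖L‖ + ‖I * D‖) + ‖I * T‖ := by gcongr; exact norm_add_le _ _
    _ ≤ _ := by
      rw [norm_mul, norm_mul, Complex.norm_I, one_mul, one_mul]
      linarith

lemma zz_total (U u : ℝ) (hu : 37/2 ≤ u) (hU0 : 0 ≤ U) (hU : U ≤ u) :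
    ‖∫ t : ℝ, zzK U u (1/u) t‖ ≤ 2 * (48 * U + 625) * Real.exp (1/8 - u/2) * (2 * Real.sqrt Real.pi) + 1/10 := by
  have hu0 : 0 < u := by linarith
  have hi := (zz_fourier U u (1/u) hU0 (by positivity)).1
  have h1 := intervalIntegral.integral_Iic_add_Ioi (b := 9) hi.integrableOn hi.integrableOn
  have h2 := intervalIntegral.integral_Iic_sub_Iic (a := -9) (b := 9) (μ := volume) (f := zzK U u (1/u)) hi.integrableOn hi.integrableOn
  have h3 := integral_comp_neg_Ioi 9 (zzK U u (1/u))
  have t1 := zz_tailint u U 1 hu hU0 hU (by norm_num)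
  have t2 := zz_tailint u U (-1) hu hU0 hU (by norm_num)
  simp only [one_mul, neg_mul] at t1 t2
  rw [h3] at t2
  have m := zz_mid U u hu hU0 hU
  have e : ∫ t : ℝ, zzK U u (1/u) t = (∫ t in (-9:ℝ)..9, zzK U u (1/u) t) + (∫ t in Iic (-9:ℝ), zzK U u (1/u) t) + ∫ t in Ioi (9:ℝ), zzK U u (1/u) t := by
    rw [← h1, ← h2]; ring
  rw [e]
  calc _ ≤ _ := norm_add₃_le
    _ ≤ _ := by linarith


lemma zz_psi_eq (x : ℝ) : ∑ n ∈ Finset.Icc 1 ⌊x⌋₊, ArithmeticFunction.vonMangoldt n = Chebyshev.psi x := by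
  rw [Chebyshev.psi_eq_sum_Icc]
  symm
  rw [← Finset.sum_subset (Finset.Icc_subset_Icc_left (Nat.zero_le 1))]
  intro n hn hn'
  have : n = 0 := by
    simp only [Finset.mem_Icc] at hn hn'; omega
  simp [this]

lemma zz_theta_eq (x : ℝ) : ∑ n ∈ Finset.Icc 1 ⌊x⌋₊ with n.Prime, Real.log n = Chebyshev.theta x := by
  rw [Chebyshev.theta]; rfl

lemma zz_pi_eq (x : ℝ) : (Finset.filter Nat.Prime (Finset.Icc 1 ⌊x⌋₊)).card = Nat.primeCounting ⌊x⌋₊ := by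
  rw [Nat.primeCounting, Nat.primeCounting', Nat.count_eq_card_filter_range]
  congr 1
  ext n
  simp only [Finset.mem_filter, Finset.mem_Icc, Finset.mem_range]
  constructor
  · rintro ⟨⟨_, h⟩, hp⟩; exact ⟨by omega, hp⟩
  · rintro ⟨h, hp⟩; exact ⟨⟨hp.pos, by omega⟩, hp⟩

lemma zzA_le (U x : ℝ) (hU : 0 ≤ U) (hx : 1 ≤ x) :
    zzA U x ≤ U^2 * Nat.primeCounting ⌊x⌋₊ + 4 * U * (Real.sqrt x * Real.log x) := by
  have h1 : zzA U x ≤ ∑ n ∈ Finset.Icc 1 ⌊x⌋₊, ((if n.Prime then U^2 else 0) + 2 * U * (ArithmeticFunction.vonMangoldt n - if n.Prime then Real.log n else 0)) := by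
    unfold zzA
    apply Finset.sum_le_sum
    intro n hn
    rw [Finset.mem_Icc] at hn
    have hn1 : (1:ℝ) ≤ n := by exact_mod_cast hn.1
    have hln : 0 ≤ Real.log n := Real.log_nonneg hn1
    have h0 : 0 ≤ ArithmeticFunction.vonMangoldt n := ArithmeticFunction.vonMangoldt_nonneg
    split_ifs with hp
    · rw [ArithmeticFunction.vonMangoldt_apply_prime hp]
      nlinarith [sq_nonneg (U - Real.log n)]
    · nlinarith [mul_nonneg h0 hln]
  rw [Finset.sum_add_distrib, ← Finset.mul_sum, Finset.sum_sub_distrib, zz_psi_eq, ← Finset.sum_filter, ← Finset.sum_filter, zz_theta_eq, Finset.sum_const, zz_pi_eq, nsmul_eq_mul] at h1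
  have h2 := Chebyshev.psi_sub_theta_le hx
  nlinarith

lemma zz_g1 (u c : ℝ) : Integrable (fun v : ℝ => Real.exp (c*v) * Real.exp (-(u-v)^2/2)) ∧
    ∫ v : ℝ, Real.exp (c*v) * Real.exp (-(u-v)^2/2) = Real.sqrt (2*Real.pi) * Real.exp (c*u + c^2/2) := by
  have h0 : Integrable (fun y : ℝ => Real.exp (-(1/2) * y^2)) := integrable_exp_neg_mul_sq (by norm_num)
  have e : (fun v : ℝ => Real.exp (c*v) * Real.exp (-(u-v)^2/2)) = fun v => Real.exp (c*u + c^2/2) * Real.exp (-(1/2) * (v - (u + c))^2) := by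
    funext v
    rw [← Real.exp_add, ← Real.exp_add]; congr 1; ring
  rw [e]
  refine ⟨(h0.comp_sub_right (u+c)).const_mul _, ?_⟩
  rw [integral_const_mul, integral_sub_right_eq_self (fun y : ℝ => Real.exp (-(1/2) * y^2)) (u+c), integral_gaussian, mul_comm]
  congr 2; ring

lemma zz_g2 (u : ℝ) : Integrable (fun v : ℝ => v * Real.exp (-(u-v)^2/2)) ∧
    ∫ v : ℝ, v * Real.exp (-(u-v)^2/2) = Real.sqrt (2*Real.pi) * u := by
  have h0 : Integrable (fun y : ℝ => y * Real.exp (-(1/2) * y^2)) := integrable_mul_exp_neg_mul_sq (by norm_num)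
  have hz : ∫ y : ℝ, y * Real.exp (-(1/2) * y^2) = 0 := by
    have := integral_neg_eq_self (fun y : ℝ => y * Real.exp (-(1/2) * y^2)) volume
    simp only [neg_mul, even_two, Even.neg_pow, integral_neg] at this ⊢
    linarith
  obtain ⟨g1, g2⟩ := zz_g1 u 0
  simp only [zero_mul, Real.exp_zero, one_mul, zero_add] at g1 g2
  have e : (fun v : ℝ => v * Real.exp (-(u-v)^2/2)) = fun v => (v - u) * Real.exp (-(1/2) * (v - u)^2) + u * Real.exp (-(u-v)^2/2) := by
    funext v
    have : -(u-v)^2/2 = -(1/2) * (v-u)^2 := by ring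
    rw [this]; ring
  rw [e]
  refine ⟨(h0.comp_sub_right u).add (g1.const_mul u), ?_⟩
  rw [integral_add (h0.comp_sub_right u) (g1.const_mul u), integral_const_mul, g2, integral_sub_right_eq_self (fun y : ℝ => y * Real.exp (-(1/2) * y^2)) u, hz]
  norm_num; ring

lemma zz_num (U : ℝ) (hU : 18 ≤ U) :
    (2*U+1) * Real.exp (-U) + 4*U*(U+1/2) * Real.exp (1/8 - (U+1/2)/2)
      + ((48*U+625) * Real.exp (1/8 - (U+1/2)/2) * (4 * Real.sqrt Real.pi) + 1/10) / (2 * Real.pi) < 1/2 := by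
  set E := Real.exp (1/8 - (U+1/2)/2) with hE
  have hpi : 0 < Real.pi := Real.pi_pos
  have hs : 0 < Real.sqrt Real.pi := Real.sqrt_pos.2 hpi
  have hs2 : Real.sqrt Real.pi ^ 2 = Real.pi := Real.sq_sqrt hpi.le
  have hs3 : 1.77 ≤ Real.sqrt Real.pi := Real.le_sqrt_of_sq_le (by have := Real.pi_gt_d2; norm_num at this ⊢; linarith)
  have e1 : ((48*U+625) * E * (4 * Real.sqrt Real.pi) + 1/10) / (2 * Real.pi) = (48*U+625) * E * (2 / Real.sqrt Real.pi) + 1/(20 * Real.pi) := by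
    generalize Real.sqrt Real.pi = w at hs hs2
    rw [← hs2]; field_simp; ring
  rw [e1]
  have e2 : 2 / Real.sqrt Real.pi ≤ 1.13 := by
    rw [div_le_iff₀ hs]; nlinarith
  have e3 : 1/(20 * Real.pi) ≤ 1/60 := by
    apply one_div_le_one_div_of_le (by norm_num); have := Real.pi_gt_three; linarith
  have hE0 : 0 < E := Real.exp_pos _
  have e4 : Real.exp (-U) ≤ E := Real.exp_le_exp.2 (by linarith)
  set y := (U - 18)/2 with hy
  have hy0 : 0 ≤ y := by rw [hy]; linarith
  have e5 : E * (8000 * (1 + y + y^2/2)) ≤ 1 := by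
    have h9 : (8000:ℝ) ≤ Real.exp 9 := by
      have := Real.exp_one_gt_d9
      have h : Real.exp 9 = Real.exp 1 ^ 9 := by rw [← Real.exp_nat_mul]; norm_num
      rw [h]
      calc (8000:ℝ) ≤ 2.718 ^ 9 := by norm_num
        _ ≤ _ := by gcongr; linarith
    have hq := Real.quadratic_le_exp_of_nonneg hy0
    calc E * (8000 * (1 + y + y^2/2)) ≤ E * (Real.exp 9 * Real.exp y) := by gcongr
      _ = Real.exp (-(1/8)) := by rw [hE, ← Real.exp_add, ← Real.exp_add]; congr 1; rw [hy]; ring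
      _ ≤ 1 := Real.exp_le_one_iff.2 (by norm_num)
  have hUy : U = 18 + 2*y := by rw [hy]; ring
  have hE1 : (2*U+1) * Real.exp (-U) ≤ (2*U+1) * E := by gcongr
  have hE2 : (48*U+625) * E * (2 / Real.sqrt Real.pi) ≤ (48*U+625) * E * 1.13 := by gcongr
  have hE3 : (2*U+1) * E + 4*U*(U+1/2) * E + (48*U+625) * E * 1.13 ≤ 0.4 * (E * (8000 * (1 + y + y^2/2))) := by
    have : (2*U+1) + 4*U*(U+1/2) + (48*U+625) * 1.13 ≤ 0.4 * (8000 * (1 + y + y^2/2)) := by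
      rw [hUy]; nlinarith
    nlinarith
  linarith

set_option maxHeartbeats 1000000 in
lemma zz_large (U C m : ℝ) (hU : 18 ≤ U) (hm : m = U + 1) (hC : C = Real.exp U / U)
    (h : ∀ x : ℝ, 1 ≤ x → m * Nat.primeCounting ⌊x⌋₊ ≤ x + C) : False := by
  have hm0 : 0 < m := by linarith
  have hU0 : 0 < U := by linarith
  set u := U + 1/2 with hu
  have hu0 : 0 < u := by linarith
  obtain ⟨_, hintg, hF⟩ := zz_fourier U u (1/u) hU0.le (by positivity)
  have htot := zz_total U u (by linarith) hU0.le (by linarith)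
  rw [← hF, Complex.norm_real, Real.norm_eq_abs] at htot
  set J := ∫ v in Ioi 0, zzr U v * Real.exp (-v) * Real.exp (-(u-v)^2/2) with hJ
  set c := 1/u - 1/2 with hc
  set B := U^2*C/m + (2*U+1) with hB
  set D := 4*U*u*Real.exp (-1) with hD
  set a := U^2/m - (2*U+1) with ha
  have hC0 : 0 ≤ C := by rw [hC]; positivity
  have ha1 : 0 ≤ U^2*C/m := by positivity
  have ha2 : 0 ≤ U^2/m := by positivity
  have hD0 : 0 ≤ D := by positivity
  obtain ⟨g01, g02⟩ := zz_g1 u 0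
  simp only [zero_mul, Real.exp_zero, one_mul, zero_add] at g01 g02
  obtain ⟨g11, g12⟩ := zz_g1 u (-1)
  obtain ⟨g21, g22⟩ := zz_g1 u c
  obtain ⟨g31, g32⟩ := zz_g2 u
  set H : ℝ → ℝ := fun v => ((a * Real.exp (-(u-v)^2/2) + v * Real.exp (-(u-v)^2/2)) + B * (Real.exp (-1*v) * Real.exp (-(u-v)^2/2))) + D * (Real.exp (c*v) * Real.exp (-(u-v)^2/2)) with hH
  have i1 := (g01.const_mul a).add g31
  have i2 := i1.add (g11.const_mul B)
  have hHi : Integrable H := i2.add (g21.const_mul D)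
  have hHv : ∫ v, H v = Real.sqrt (2*Real.pi) * (a + u + B * Real.exp (-1*u+(-1)^2/2) + D * Real.exp (c*u+c^2/2)) := by
    have s1 := integral_add i2 (g21.const_mul D)
    have s2 := integral_add i1 (g11.const_mul B)
    have s3 := integral_add (g01.const_mul a) g31
    simp only [Pi.add_apply] at s1 s2 s3
    rw [hH, s1, s2, s3, integral_const_mul, integral_const_mul, integral_const_mul, g02, g12, g22, g32]
    norm_num; ring
  have hneg : ∀ v ≤ 0, 0 ≤ H v := by
    intro v hv
    have h1 : H v = (a + v + B * Real.exp (-1*v) + D * Real.exp (c*v)) * Real.exp (-(u-v)^2/2) := by rw [hH]; ring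
    rw [h1]
    apply mul_nonneg _ (Real.exp_pos _).le
    have h2 := Real.add_one_le_exp (-1*v)
    have h3 : 0 ≤ D * Real.exp (c*v) := mul_nonneg hD0 (Real.exp_pos _).le
    have h4 : 0 ≤ U^2*C/m * Real.exp (-1*v) := mul_nonneg ha1 (Real.exp_pos _).le
    have h5 : (2*U+1) * (-1*v+1) ≤ (2*U+1) * Real.exp (-1*v) := by gcongr
    rw [hB, ha, add_mul]
    nlinarith
  have hpos : ∀ v ∈ Ioi (0:ℝ), zzr U v * Real.exp (-v) * Real.exp (-(u-v)^2/2) ≤ H v := by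
    intro v hv
    have hv0 : (0:ℝ) < v := hv
    have h1 : H v = (a + v + B * Real.exp (-1*v) + D * Real.exp (c*v)) * Real.exp (-(u-v)^2/2) := by rw [hH]; ring
    rw [h1]
    apply mul_le_mul_of_nonneg_right _ (Real.exp_pos _).le
    have hx : 1 ≤ Real.exp v := Real.one_le_exp hv0.le
    have k1 := zzA_le U (Real.exp v) hU0.le hx
    have k2 : (Nat.primeCounting ⌊Real.exp v⌋₊ : ℝ) ≤ (Real.exp v + C)/m := by
      rw [le_div_iff₀ hm0, mul_comm]; exact h _ hx
    have k3 : U^2 * (Nat.primeCounting ⌊Real.exp v⌋₊ : ℝ) ≤ U^2 * ((Real.exp v + C)/m) := by gcongr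
    have k4 : v ≤ u * Real.exp (v/u - 1) := by
      have := Real.add_one_le_exp (v/u - 1)
      have h' : u * (v/u) ≤ u * Real.exp (v/u - 1) := by gcongr; linarith
      rwa [mul_div_cancel₀ _ hu0.ne'] at h'
    have k5 : Real.sqrt (Real.exp v) = Real.exp (v/2) := by rw [Real.exp_half]
    rw [Real.log_exp, k5] at k1
    have hev : Real.exp v * Real.exp (-v) = 1 := by rw [← Real.exp_add]; simp
    have k6 : 4*U*(Real.exp (v/2) * v) * Real.exp (-v) ≤ D * Real.exp (c*v) := by
      calc 4*U*(Real.exp (v/2) * v) * Real.exp (-v) ≤ 4*U*(Real.exp (v/2) * (u * Real.exp (v/u - 1))) * Real.exp (-v) := by gcongr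
        _ = 4*U*u*(Real.exp (v/2) * Real.exp (v/u - 1) * Real.exp (-v)) := by ring
        _ = 4*U*u*(Real.exp (-1) * Real.exp (c*v)) := by
          rw [← Real.exp_add, ← Real.exp_add, ← Real.exp_add]; congr 2; rw [hc]; ring
        _ = _ := by rw [hD]; ring
    have k7 : zzr U v * Real.exp (-v) ≤ (U^2 * ((Real.exp v + C)/m) + 4*U*(Real.exp (v/2) * v) - (2 * U * (Real.exp v - 1) - (v * Real.exp v - Real.exp v + 1))) * Real.exp (-v) := by
      apply mul_le_mul_of_nonneg_right _ (Real.exp_pos _).le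
      unfold zzr; linarith
    have k8 : (U^2 * ((Real.exp v + C)/m) + 4*U*(Real.exp (v/2) * v) - (2 * U * (Real.exp v - 1) - (v * Real.exp v - Real.exp v + 1))) * Real.exp (-v) = (U^2/m - (2*U+1) + v) * (Real.exp v * Real.exp (-v)) + B * Real.exp (-v) + 4*U*(Real.exp (v/2) * v) * Real.exp (-v) := by
      rw [hB]; ring
    rw [k8, hev, mul_one] at k7
    rw [neg_one_mul, ha]
    linarith
  have hJ1 : J ≤ ∫ v, H v := by
    calc J ≤ ∫ v in Ioi 0, H v := setIntegral_mono_on hintg hHi.integrableOn measurableSet_Ioi hpos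
      _ ≤ ∫ v, H v := by
        rw [← intervalIntegral.integral_Iic_add_Ioi (b := 0) hHi.integrableOn hHi.integrableOn]
        have : 0 ≤ ∫ v in Iic (0:ℝ), H v := setIntegral_nonneg measurableSet_Iic (fun v hv => hneg v hv)
        linarith
  have hsq : 0 < Real.sqrt (2*Real.pi) := Real.sqrt_pos.2 (by positivity)
  have hsq2 : Real.sqrt (2*Real.pi) * Real.sqrt (2*Real.pi) = 2*Real.pi := Real.mul_self_sqrt (by positivity)
  have hlow := neg_le_of_abs_le htot
  have h3 : Real.sqrt (2*Real.pi) * J ≤ (2*Real.pi) * (a + u + B * Real.exp (-1*u+(-1)^2/2) + D * Real.exp (c*u+c^2/2)) := by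
    have h' := mul_le_mul_of_nonneg_left hJ1 hsq.le
    rwa [hHv, ← mul_assoc, hsq2] at h'
  have h4 : a + u + B * Real.exp (-1*u+(-1)^2/2) = -(1/2) + (2*U+1) * Real.exp (-U) := by
    have e1 : -1*u+(-1)^2/2 = -U := by rw [hu]; ring
    have e2 : Real.exp U * Real.exp (-U) = 1 := by rw [← Real.exp_add]; simp
    rw [e1, ha, hB, hC, hu]
    have e3 : (U^2 * (Real.exp U / U)/m) * Real.exp (-U) = U/m := by
      calc _ = (U/m) * (Real.exp U * Real.exp (-U)) := by field_simp
        _ = _ := by rw [e2, mul_one]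
    rw [add_mul, e3]
    have e4 : U^2/m + U/m = U := by rw [hm]; field_simp
    linarith
  have h5 : D * Real.exp (c*u+c^2/2) ≤ 4*U*u*Real.exp (1/8-u/2) := by
    rw [hD, mul_assoc, ← Real.exp_add]
    gcongr
    have e1 : c*u = 1 - u/2 := by rw [hc]; field_simp
    have e2 : c^2 ≤ 1/4 := by
      have h1 : 0 < 1/u := by positivity
      have h2 : 1/u ≤ 1 := by rw [div_le_one hu0]; linarith
      exact sq_le_sq' (by rw [hc]; linarith) (by rw [hc]; linarith) |>.trans (by norm_num : ((1/2:ℝ))^2 ≤ 1/4)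
    linarith
  have hn := zz_num U hU
  rw [← hu] at hn
  have hpi : 0 < 2*Real.pi := by positivity
  set T := ((48*U+625) * Real.exp (1/8 - u/2) * (4 * Real.sqrt Real.pi) + 1/10) / (2 * Real.pi) with hT
  have hT2 : 2*Real.pi * T = (48*U+625) * Real.exp (1/8 - u/2) * (4 * Real.sqrt Real.pi) + 1/10 := by
    rw [hT]; field_simp
  rw [h4] at h3
  have h6 : 2*Real.pi * (-T) ≤ 2*Real.pi * (-(1/2) + (2*U+1) * Real.exp (-U) + D * Real.exp (c*u+c^2/2)) := by
    linarith
  have h7 := le_of_mul_le_mul_left h6 hpi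
  linarith


def zzList (z : ℕ) : List ℕ := (List.range (z+1)).filter
  (fun d => Nat.ble 2 d && (Nat.ble d 47 || Nat.beq (Nat.gcd d (Nat.factorial 47)) 1))
def zzX (T : ℕ) (l : List ℕ) : ℕ :=
  l.foldr (fun d X => Nat.lor (Nat.div T (Nat.sub (Nat.pow 2 d) 1)) X) 0
def zzPc (X M : ℕ) : ℕ → ℕ
  | 0 => 0
  | j+1 => Nat.add (zzPc X M j) (Nat.mod (Nat.land (Nat.div X (Nat.pow 2 j)) M) 16777215)
def zzCount (K z : ℕ) : ℕ :=
  zzPc (zzX (Nat.pow 2 (24*K)) (zzList z)) (Nat.div (Nat.pow 2 (24*K)) 16777215) 24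
def zzChk (m K z C : ℕ) : Bool :=
  Nat.ble (24*K) (z*z) && Nat.ble K 16777214 &&
    Nat.ble (m * zzCount K z + 24*K + C + m) (m*(24*K))

def zzg (b : ℕ → Bool) (K : ℕ) : ℕ := ∑ i ∈ Finset.range K, (b i).toNat * (2^24)^i

lemma zzg_succ (b : ℕ → Bool) (K : ℕ) : zzg b (K+1) = (b 0).toNat + 2^24 * zzg (fun i => b (i+1)) K := by
  unfold zzg
  rw [Finset.sum_range_succ', Finset.mul_sum, add_comm]
  congr 1
  · simp
  · apply Finset.sum_congr rfl; intro i _; ring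

lemma zzg_testBit (b : ℕ → Bool) (K n : ℕ) :
    (zzg b K).testBit n = (decide (n % 24 = 0) && decide (n / 24 < K) && b (n/24)) := by
  induction K generalizing b n with
  | zero => simp [zzg]
  | succ K ih =>
    rw [zzg_succ, add_comm]
    have hb : (b 0).toNat < 2^24 := lt_of_le_of_lt (Bool.toNat_le _) (by norm_num)
    rw [Nat.testBit_two_pow_mul_add _ hb]
    split_ifs with h
    · have h0 : n / 24 = 0 := by omega
      rw [h0]
      rcases Nat.eq_zero_or_pos n with rfl | hn
      · cases b 0 <;> simp
      · have : ¬ n % 24 = 0 := by omega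
        simp only [this, decide_false, Bool.false_and]
        rw [Nat.testBit_lt_two_pow]
        calc (b 0).toNat < 2^1 := lt_of_le_of_lt (Bool.toNat_le _) (by norm_num)
          _ ≤ 2^n := Nat.pow_le_pow_right (by norm_num) hn
    · rw [ih]
      have e1 : (n-24) % 24 = n % 24 := by omega
      have e2 : (n-24)/24 + 1 = n/24 := by omega
      have e3 : (n-24)/24 < K ↔ n/24 < K+1 := by omega
      rw [e1, e2]; simp only [e3]

lemma zzg_true (K : ℕ) : Nat.div (Nat.pow 2 (24*K)) 16777215 = zzg (fun _ => true) K := by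
  have h : 16777215 * zzg (fun _ => true) K + 1 = (2^24)^K := by
    induction K with
    | zero => simp [zzg]
    | succ K ih =>
      have : zzg (fun _ => true) (K+1) = zzg (fun _ => true) K + (2^24)^K := by
        unfold zzg; rw [Finset.sum_range_succ]; simp
      rw [this, pow_succ (2^24) K]; omega
  change (2^(24*K)) / 16777215 = _
  rw [pow_mul, ← h]; omega

lemma zzg_mod (b : ℕ → Bool) (K : ℕ) (hK : K ≤ 16777214) :
    zzg b K % 16777215 = ∑ i ∈ Finset.range K, (b i).toNat := by
  have h1 : zzg b K ≡ ∑ i ∈ Finset.range K, (b i).toNat [MOD 16777215] := by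
    unfold zzg
    induction K with
    | zero => rfl
    | succ K ih =>
      rw [Finset.sum_range_succ, Finset.sum_range_succ]
      refine (ih (by omega)).add ?_
      have : (2^24)^K ≡ 1^K [MOD 16777215] := Nat.ModEq.pow _ (by decide)
      simpa using this.mul_left (b K).toNat
  have h2 : ∑ i ∈ Finset.range K, (b i).toNat ≤ K := by
    calc _ ≤ ∑ i ∈ Finset.range K, 1 := Finset.sum_le_sum (fun i _ => Bool.toNat_le _)
      _ = K := by simp
  rw [h1, Nat.mod_eq_of_lt (by omega)]

lemma zzPc_eq (X K : ℕ) (hK : K ≤ 16777214) (w : ℕ) :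
    zzPc X (zzg (fun _ => true) K) w = ∑ j ∈ Finset.range w, ∑ i ∈ Finset.range K, (X.testBit (24*i+j)).toNat := by
  induction w with
  | zero => simp [zzPc]
  | succ w ih =>
    rw [Finset.sum_range_succ, ← ih, ← zzg_mod (fun i => X.testBit (24*i+w)) K hK, zzPc]
    change _ + ((X / 2^w) &&& zzg (fun _ => true) K) % 16777215 = _
    congr 2
    apply Nat.eq_of_testBit_eq
    intro n
    rw [Nat.testBit_and, zzg_testBit, zzg_testBit, Nat.testBit_div_two_pow]
    by_cases h : n % 24 = 0
    · have : 24 * (n/24) + w = n + w := by omega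
      rw [this]; simp only [h]
      cases X.testBit (n+w) <;> simp
    · simp [h]

lemma zz_sumblock (f : ℕ → ℕ) (K : ℕ) :
    ∑ x ∈ Finset.range (24*K), f x = ∑ j ∈ Finset.range 24, ∑ i ∈ Finset.range K, f (24*i+j) := by
  rw [Finset.sum_comm]
  induction K with
  | zero => simp
  | succ K ih => rw [Finset.sum_range_succ, ← ih, Nat.mul_succ, Finset.sum_range_add]

lemma zz_mark (d L i : ℕ) (hd : 2 ≤ d) (hi : 1 ≤ i) (h : d*i ≤ L) :
    (2^L / (2^d-1)).testBit (L - d*i) = true := by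
  have h4 : 4 ≤ 2^d := by
    calc 4 = 2^2 := by norm_num
      _ ≤ 2^d := Nat.pow_le_pow_right (by norm_num) hd
  rw [Nat.testBit_eq_decide_div_mod_eq, decide_eq_true_eq, Nat.div_div_eq_div_mul]
  have e : 2^L = 2^(d*i) * 2^(L-d*i) := by rw [← pow_add]; congr 1; omega
  rw [e, Nat.mul_div_mul_right _ _ (by positivity)]
  have h1 : 2^(d*i) % (2^d-1) = 1 := by
    have h2 : 2^d ≡ 1 [MOD (2^d-1)] := by
      have := Nat.modEq_sub (show 1 ≤ 2^d by omega)
      exact this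
    have h3 := h2.pow i
    rw [← pow_mul, one_pow] at h3
    rw [h3, Nat.mod_eq_of_lt (by omega)]
  have h2 := Nat.div_add_mod (2^(d*i)) (2^d-1)
  rw [h1] at h2
  have h3 : 2^(d*i) % 2 = 0 := Nat.mod_eq_zero_of_dvd (dvd_pow_self 2 (by positivity))
  by_contra h5
  have h6 : 2 ∣ (2^d-1) * (2^(d*i)/(2^d-1)) := Dvd.dvd.mul_left (by omega) _
  omega

lemma zzX_mark (T n d : ℕ) (l : List ℕ) (hd : d ∈ l) (h : (T / (2^d-1)).testBit n = true) :
    (zzX T l).testBit n = true := by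
  induction l with
  | nil => simp at hd
  | cons a l ih =>
    change (((T / (2^a-1)) ||| zzX T l)).testBit n = true
    rw [Nat.testBit_or]
    rcases List.mem_cons.1 hd with rfl | hd
    · simp [h]
    · simp [ih hd]

lemma zzList_mem (z p : ℕ) (hp : p.Prime) (h : p ≤ z) : p ∈ zzList z := by
  unfold zzList
  rw [List.mem_filter, List.mem_range]
  refine ⟨by omega, ?_⟩
  have h2 : Nat.ble 2 p = true := by rw [Nat.ble_eq]; exact hp.two_le
  rw [h2, Bool.true_and, Bool.or_eq_true]
  by_cases h47 : p ≤ 47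
  · left; rw [Nat.ble_eq]; exact h47
  · right
    have : Nat.Coprime p (Nat.factorial 47) := (Nat.Prime.coprime_iff_not_dvd hp).2 (fun hd => h47 ((Nat.Prime.dvd_factorial hp).1 hd))
    rw [Nat.beq_eq]; exact this

lemma zzChk_pi (m K z C : ℕ) (h : zzChk m K z C = true) :
    24*K + C ≤ m * Nat.primeCounting (24*K) := by
  unfold zzChk at h
  rw [Bool.and_eq_true, Bool.and_eq_true, Nat.ble_eq, Nat.ble_eq, Nat.ble_eq] at h
  obtain ⟨⟨hz, hK⟩, hm⟩ := h
  unfold zzCount at hm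
  set X := zzX (Nat.pow 2 (24*K)) (zzList z) with hX
  rw [zzg_true, zzPc_eq X K hK, ← zz_sumblock (fun x => (X.testBit x).toNat)] at hm
  set L := 24*K with hL
  set A := (Finset.range L).filter (fun x => X.testBit x = true) with hA
  have hc : ∑ x ∈ Finset.range L, (X.testBit x).toNat = A.card := by
    rw [hA, Finset.card_filter]
    apply Finset.sum_congr rfl; intro x _
    cases X.testBit x <;> simp
  rw [hc] at hm
  have h1 : (Finset.range L \ (insert (L-1) A)).card ≤ Nat.primeCounting L := by
    rw [Nat.primeCounting, Nat.primeCounting', Nat.count_eq_card_filter_range]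
    refine Finset.card_le_card_of_injOn (fun x => L - x) ?_ ?_
    · intro x hx
      simp only [Finset.coe_sdiff, Set.mem_sdiff, Finset.mem_coe, Finset.mem_range, Finset.mem_insert, not_or] at hx
      obtain ⟨hx1, hx2, hx3⟩ := hx
      simp only [Finset.coe_filter, Finset.mem_range, Set.mem_ofPred_eq]
      refine ⟨by omega, ?_⟩
      by_contra hp
      apply hx3
      rw [hA, Finset.mem_filter, Finset.mem_range]
      refine ⟨hx1, ?_⟩
      have hn1 : L - x ≠ 1 := by omega
      have hpp := Nat.minFac_prime hn1
      have hsq := Nat.minFac_sq_le_self (by omega : 0 < L - x) hp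
      have hpz : (L-x).minFac ≤ z := by
        by_contra hlt
        push Not at hlt
        have h1 := Nat.mul_lt_mul'' hlt hlt
        rw [pow_two] at hsq
        omega
      obtain ⟨i, hi⟩ := Nat.minFac_dvd (L-x)
      have hi1 : 1 ≤ i := by
        rcases Nat.eq_zero_or_pos i with rfl | h0
        · omega
        · exact h0
      have hmk := zz_mark (L-x).minFac L i hpp.two_le hi1 (by omega)
      rw [← hi, Nat.sub_sub_self hx1.le] at hmk
      exact zzX_mark _ _ _ _ (zzList_mem z _ hpp hpz) hmk
    · intro x hx y hy hxy
      simp only [Finset.coe_sdiff, Set.mem_sdiff, Finset.mem_coe, Finset.mem_range] at hx hy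
      simp only at hxy
      omega
  have h2 := Finset.le_card_sdiff (insert (L-1) A) (Finset.range L)
  rw [Finset.card_range] at h2
  have h3 := Finset.card_insert_le (L-1) A
  have h4 : L ≤ Nat.primeCounting L + A.card + 1 := by omega
  have h5 := Nat.mul_le_mul_left m h4
  rw [Nat.mul_add, Nat.mul_add, Nat.mul_one] at h5
  generalize m * L = q1 at *
  generalize m * A.card = q2 at *
  generalize m * Nat.primeCounting L = q3 at *
  omega

lemma zz_nth (k x : ℕ) (hk : 0 < k) (h : k ≤ Nat.primeCounting x) : nthPrime k ≤ x := by
  have : Nat.nth Nat.Prime (k-1) < x + 1 := Nat.nth_lt_of_lt_count (by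
    change k - 1 < Nat.primeCounting x
    omega)
  unfold nthPrime
  omega

lemma zz_S (m : ℕ) (S : ℤ) (hS : IsS m S) (k x : ℕ) (hk : 0 < k) (h : k ≤ Nat.primeCounting x) :
    (k:ℝ) * m - x ≤ S := by
  have h1 := hS.2 ⟨k, hk, rfl⟩
  have h2 := zz_nth k x hk h
  have h3 : (k:ℤ) * m - x ≤ S := by
    have : (nthPrime k : ℤ) ≤ x := by exact_mod_cast h2
    linarith
  exact_mod_cast h3

lemma zz_expb (n : ℕ) : Real.exp n ≤ 2.7182818286 ^ n := by
  have h : Real.exp n = Real.exp 1 ^ n := by rw [← Real.exp_nat_mul]; norm_num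
  rw [h]
  have := Real.exp_one_lt_d9
  gcongr

lemma zz_finb (n : ℕ) (hn : 0 < n) (C : ℕ) (S : ℤ) (hC : (C:ℝ) ≤ S) (hb : (2.7182818286:ℝ) ^ n < C * n) :
    (S:ℝ) > Real.exp (((n+1 : ℕ):ℝ) - 1) / (((n+1 : ℕ):ℝ) - 1) := by
  have e : (((n+1 : ℕ):ℝ) - 1) = n := by push_cast; ring
  rw [e, gt_iff_lt]
  have hn' : (0:ℝ) < n := by exact_mod_cast hn
  refine lt_of_lt_of_le ?_ hC
  rw [div_lt_iff₀ hn']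
  exact (zz_expb n).trans_lt hb

lemma zz_chk (n K z C : ℕ) (hn : 0 < n) (hC : 0 < C) (S : ℤ) (hS : IsS (n+1) S)
    (h : zzChk (n+1) K z C = true) (hb : (2.7182818286:ℝ) ^ n < C * n) :
    (S:ℝ) > Real.exp (((n+1 : ℕ):ℝ) - 1) / (((n+1 : ℕ):ℝ) - 1) := by
  have h1 := zzChk_pi _ _ _ _ h
  have h0 : 0 < Nat.primeCounting (24*K) := by
    rcases Nat.eq_zero_or_pos (Nat.primeCounting (24*K)) with h0 | h0
    · rw [h0] at h1; omega
    · exact h0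
  have h2 := zz_S _ S hS _ (24*K) h0 le_rfl
  refine zz_finb n hn C S ?_ hb
  have h3 : ((24*K:ℕ):ℝ) + C ≤ ((n+1:ℕ):ℝ) * Nat.primeCounting (24*K) := by exact_mod_cast h1
  linarith

lemma zz_k (n k x C : ℕ) (hn : 0 < n) (S : ℤ) (hS : IsS (n+1) S) (hk : 0 < k)
    (h : k ≤ Nat.primeCounting x) (hC : x + C ≤ k * (n+1)) (hb : (2.7182818286:ℝ) ^ n < C * n) :
    (S:ℝ) > Real.exp (((n+1 : ℕ):ℝ) - 1) / (((n+1 : ℕ):ℝ) - 1) := by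
  have h2 := zz_S _ S hS k x hk h
  refine zz_finb n hn C S ?_ hb
  have h3 : (x:ℝ) + C ≤ (k:ℝ) * ((n+1:ℕ):ℝ) := by exact_mod_cast hC
  linarith

lemma zz_small (m : ℕ) (hm : 3 ≤ m) (hm' : m ≤ 18) (S : ℤ) (hS : IsS m S) :
    (S : ℝ) > Real.exp ((m : ℝ) - 1) / ((m : ℝ) - 1) := by
  interval_cases m
  · exact zz_k 2 4 7 5 (by norm_num) S hS (by norm_num) (by decide +kernel) (by norm_num) (by norm_num)
  · exact zz_k 3 4 7 9 (by norm_num) S hS (by norm_num) (by decide +kernel) (by norm_num) (by norm_num)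
  · exact zz_k 4 6 13 17 (by norm_num) S hS (by norm_num) (by decide +kernel) (by norm_num) (by norm_num)
  · exact zz_k 5 9 23 31 (by norm_num) S hS (by norm_num) (by decide +kernel) (by norm_num) (by norm_num)
  · exact zz_chk 6 10 16 69 (by norm_num) (by norm_num) S hS (by decide +kernel) (by norm_num)
  · exact zz_chk 7 18 21 158 (by norm_num) (by norm_num) S hS (by decide +kernel) (by norm_num)
  · exact zz_chk 8 36 30 374 (by norm_num) (by norm_num) S hS (by decide +kernel) (by norm_num)
  · exact zz_chk 9 87 46 902 (by norm_num) (by norm_num) S hS (by decide +kernel) (by norm_num)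
  · exact zz_chk 10 226 74 2204 (by norm_num) (by norm_num) S hS (by decide +kernel) (by norm_num)
  · exact zz_chk 11 580 118 5445 (by norm_num) (by norm_num) S hS (by decide +kernel) (by norm_num)
  · exact zz_chk 12 1566 194 13566 (by norm_num) (by norm_num) S hS (by decide +kernel) (by norm_num)
  · exact zz_chk 13 4296 322 34037 (by norm_num) (by norm_num) S hS (by decide +kernel) (by norm_num)
  · exact zz_chk 14 11845 534 85910 (by norm_num) (by norm_num) S hS (by decide +kernel) (by norm_num)
  · exact zz_chk 15 32691 886 217958 (by norm_num) (by norm_num) S hS (by decide +kernel) (by norm_num)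
  · exact zz_chk 16 90010 1470 555439 (by norm_num) (by norm_num) S hS (by decide +kernel) (by norm_num)
  · exact zz_chk 17 248928 2445 1421023 (by norm_num) (by norm_num) S hS (by decide +kernel) (by norm_num)

lemma zz_big (m : ℕ) (hm : 19 ≤ m) (S : ℤ) (hS : IsS m S) :
    (S : ℝ) > Real.exp ((m : ℝ) - 1) / ((m : ℝ) - 1) := by
  by_contra hcon
  rw [gt_iff_lt, not_lt] at hcon
  have hm' : (19:ℝ) ≤ m := by exact_mod_cast hm
  refine zz_large ((m:ℝ)-1) _ m (by linarith) (by ring) rfl ?_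
  intro x hx
  rcases Nat.eq_zero_or_pos (Nat.primeCounting ⌊x⌋₊) with h0 | h0
  · rw [h0]
    have : 0 < Real.exp ((m : ℝ) - 1) / ((m : ℝ) - 1) := div_pos (Real.exp_pos _) (by linarith)
    push_cast; linarith
  · have h1 := zz_S m S hS _ ⌊x⌋₊ h0 le_rfl
    have h2 := Nat.floor_le (show 0 ≤ x by linarith)
    linarith

end ZZ

theorem stmt4 (m : ℕ) (hm : 3 ≤ m) (S : ℤ) (hS : IsS m S) :
    (S : ℝ) > Real.exp ((m : ℝ) - 1) / ((m : ℝ) - 1) := by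
  rcases Nat.lt_or_ge m 19 with h | h
  · exact zz_small m hm (by omega) S hS
  · exact zz_big m h S hS
end

section
/- The limit as m → ∞ of S(m)^{1/m} equals e. -/
open MeasureTheory Filter Topology Set

noncomputable def fejK (x : ℝ) : ℝ := Real.sinc (x / 2) ^ 2

lemma fejK_nonneg (x : ℝ) : 0 ≤ fejK x := sq_nonneg _

lemma fejK_continuous : Continuous fejK := by
  unfold fejK
  have := Real.continuous_sinc
  fun_prop

lemma fejK_le_one (x : ℝ) : fejK x ≤ 1 := by
  unfold fejK
  rw [sq_le_one_iff_abs_le_one]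
  exact Real.abs_sinc_le_one _

lemma fejK_zero : fejK 0 = 1 := by simp [fejK]

lemma fejK_eq {x : ℝ} (hx : x ≠ 0) : fejK x = 2 * (1 - Real.cos x) / x ^ 2 := by
  unfold fejK
  rw [Real.sinc_of_ne_zero (by positivity)]
  have : Real.cos x = 1 - 2 * Real.sin (x / 2) ^ 2 := by
    have h := Real.cos_two_mul (x / 2)
    have h2 := Real.sin_sq_add_cos_sq (x / 2)
    rw [show 2 * (x / 2) = x by ring] at h
    linarith
  rw [this]
  field_simp
  ring

lemma fejK_le (x : ℝ) : fejK x ≤ 5 * (1 + x ^ 2)⁻¹ := by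
  rw [← div_eq_mul_inv, le_div_iff₀ (by positivity)]
  have h1 := fejK_le_one x
  have h0 := fejK_nonneg x
  by_cases hx : x = 0
  · subst hx; rw [fejK_zero]; norm_num
  have h2 : fejK x * x ^ 2 ≤ 4 := by
    rw [fejK_eq hx]
    field_simp
    linarith [Real.neg_one_le_cos x]
  linarith

lemma fejK_integrable : Integrable fejK := by
  refine (integrable_inv_one_add_sq.const_mul 5).mono' fejK_continuous.aestronglyMeasurable ?_
  refine Eventually.of_forall fun x => ?_
  rw [Real.norm_of_nonneg (fejK_nonneg x)]
  exact fejK_le x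

lemma fejK_integral_pos : 0 < ∫ x, fejK x := by
  refine integral_pos_of_integrable_nonneg_nonzero (x := 0) fejK_continuous fejK_integrable
    fejK_nonneg ?_
  rw [fejK_zero]; norm_num

lemma fejK_fourier (x : ℝ) : ∫ t in (0:ℝ)..1, 2 * (1 - t) * Real.cos (t * x) = fejK x := by
  by_cases hx : x = 0
  · subst hx
    rw [fejK_zero]
    have : ∀ t ∈ uIcc (0:ℝ) 1, HasDerivAt (fun t : ℝ => 2 * t - t ^ 2)
        (2 * (1 - t) * Real.cos (t * 0)) t := by
      intro t _
      have h := ((hasDerivAt_id t).const_mul 2).sub ((hasDerivAt_id t).pow 2)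
      refine h.congr_deriv ?_
      simp; ring
    rw [intervalIntegral.integral_eq_sub_of_hasDerivAt this]
    · norm_num
    · exact Continuous.intervalIntegrable (by fun_prop) _ _
  · rw [fejK_eq hx]
    have : ∀ t ∈ uIcc (0:ℝ) 1, HasDerivAt
        (fun t : ℝ => 2 * ((1 - t) * Real.sin (t * x) / x - Real.cos (t * x) / x ^ 2))
        (2 * (1 - t) * Real.cos (t * x)) t := by
      intro t _
      have hm : HasDerivAt (fun t : ℝ => t * x) x t := by
        simpa using (hasDerivAt_id t).mul_const x
      have h := (((((hasDerivAt_id t).const_sub 1).mul hm.sin).div_const x).sub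
        (hm.cos.div_const (x ^ 2))).const_mul 2
      refine h.congr_deriv ?_
      simp
      field_simp
      ring
    rw [intervalIntegral.integral_eq_sub_of_hasDerivAt this]
    · simp; field_simp; ring
    · exact Continuous.intervalIntegrable (by fun_prop) _ _

lemma exp_neg_integrableOn {δ : ℝ} (hδ : 0 < δ) :
    IntegrableOn (fun u : ℝ => Real.exp (-δ * u)) (Ioi 0) :=
  integrableOn_exp_mul_Ioi (by linarith) 0

lemma smooth_ident {f : ℝ → ℝ} (hf : Measurable f) {C : ℝ} (hC : ∀ u, |f u| ≤ C)
    {G : ℂ → ℂ}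
    (hG : ∀ s : ℂ, 0 < s.re → ∫ u in Ioi (0:ℝ), (f u : ℂ) * Complex.exp (-s * u) = G s)
    (l y : ℝ) {δ : ℝ} (hδ : 0 < δ) :
    ∫ u in Ioi (0:ℝ), f u * Real.exp (-δ * u) * fejK (l * (y - u)) =
    ∫ t in (0:ℝ)..1, ((2 * (1 - t) : ℝ) * Complex.exp ((t * l * y : ℝ) * Complex.I) *
        G (δ + (t * l : ℝ) * Complex.I)).re := by
  have hC0 : 0 ≤ C := (abs_nonneg _).trans (hC 0)
  have e1 : ∀ u : ℝ, f u * Real.exp (-δ * u) * fejK (l * (y - u)) =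
      ∫ t in Ioc (0:ℝ) 1, f u * Real.exp (-δ * u) * (2 * (1 - t) * Real.cos (t * (l * (y - u)))) := by
    intro u
    rw [← fejK_fourier, intervalIntegral.integral_of_le zero_le_one, ← integral_const_mul]
  simp_rw [e1]
  rw [integral_integral_swap, intervalIntegral.integral_of_le zero_le_one]
  · refine integral_congr_ae (Eventually.of_forall fun t => ?_)
    simp only
    rw [← hG _ (by simpa using hδ), ← integral_const_mul]
    have hint : Integrable (fun u : ℝ => ((2 * (1 - t) : ℝ) * Complex.exp ((t * l * y : ℝ) * Complex.I) *
        ((f u : ℂ) * Complex.exp (-(δ + (t * l : ℝ) * Complex.I) * u)))) (volume.restrict (Ioi 0)) := by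
      refine Integrable.const_mul ?_ _
      refine ((exp_neg_integrableOn hδ).const_mul C).mono' ?_ ?_
      · apply Measurable.aestronglyMeasurable
        fun_prop
      · refine Eventually.of_forall fun u => ?_
        rw [norm_mul, Complex.norm_real, Complex.norm_exp]
        have : (-((δ:ℂ) + (t * l : ℝ) * Complex.I) * u).re = -δ * u := by simp
        rw [this]
        exact mul_le_mul_of_nonneg_right (hC u) (Real.exp_pos _).le
    have hre := integral_re hint
    simp only [RCLike.re_eq_complex_re] at hre
    rw [← hre]
    refine integral_congr_ae (Eventually.of_forall fun u => ?_)
    simp only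
    have : ((2 * (1 - t) : ℝ) * Complex.exp ((t * l * y : ℝ) * Complex.I) *
        ((f u : ℂ) * Complex.exp (-(δ + (t * l : ℝ) * Complex.I) * u))) =
        ((2 * (1 - t) * f u * Real.exp (-δ * u) : ℝ) : ℂ) *
          Complex.exp ((t * (l * (y - u)) : ℝ) * Complex.I) := by
      rw [show (-(δ + (t * l : ℝ) * Complex.I) * u) = ((-δ * u : ℝ) : ℂ) + (-(t * l * u) : ℝ) * Complex.I by
        push_cast; ring, Complex.exp_add,
        show ((t * (l * (y - u)) : ℝ) * Complex.I) = (t * l * y : ℝ) * Complex.I + (-(t * l * u) : ℝ) * Complex.I by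
        push_cast; ring, Complex.exp_add]
      push_cast
      ring
    rw [this, Complex.re_ofReal_mul, Complex.exp_ofReal_mul_I_re]
    ring
  · have h1 : Integrable (fun u : ℝ => C * Real.exp (-δ * u)) (volume.restrict (Ioi 0)) :=
      (exp_neg_integrableOn hδ).const_mul C
    have h2 : Integrable (fun _ : ℝ => (2:ℝ)) (volume.restrict (Ioc (0:ℝ) 1)) := integrable_const _
    refine (h1.mul_prod h2).mono' ?_ ?_
    · apply Measurable.aestronglyMeasurable
      unfold Function.uncurry
      fun_prop
    · have : ∀ᵐ p : ℝ × ℝ ∂((volume.restrict (Ioi (0:ℝ))).prod (volume.restrict (Ioc (0:ℝ) 1))),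
          p.2 ∈ Ioc (0:ℝ) 1 := by
        rw [Measure.prod_restrict]
        filter_upwards [ae_restrict_mem (measurableSet_Ioi.prod measurableSet_Ioc)] with p hp
        exact hp.2
      filter_upwards [this] with p hp
      simp only [Function.uncurry, norm_mul, Real.norm_eq_abs, Real.abs_exp]
      have a1 : |1 - p.2| ≤ 1 := by rw [abs_le]; constructor <;> linarith [hp.1, hp.2]
      have a2 := Real.abs_cos_le_one (p.2 * (l * (y - p.1)))
      have a3 := hC p.1
      have a4 : |(2:ℝ)| = 2 := by norm_num
      rw [a4]
      have a5 : |1 - p.2| * |Real.cos (p.2 * (l * (y - p.1)))| ≤ 1 * 1 := by gcongr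
      have : 2 * |1 - p.2| * |Real.cos (p.2 * (l * (y - p.1)))| ≤ 2 := by linarith
      gcongr

lemma fejK_comp_integrable {l : ℝ} (hl : 0 < l) (y : ℝ) :
    Integrable (fun u => fejK (l * (y - u))) :=
  (fejK_integrable.comp_mul_left' hl.ne').comp_sub_left y

lemma smooth_ident_zero {f : ℝ → ℝ} (hf : Measurable f) {C : ℝ} (hC : ∀ u, |f u| ≤ C)
    {G : ℂ → ℂ} (hGc : ContinuousOn G {s | 0 ≤ s.re})
    (hG : ∀ s : ℂ, 0 < s.re → ∫ u in Ioi (0:ℝ), (f u : ℂ) * Complex.exp (-s * u) = G s)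
    {l : ℝ} (hl : 0 < l) (y : ℝ) :
    ∫ u in Ioi (0:ℝ), f u * fejK (l * (y - u)) =
    ∫ t in (0:ℝ)..1, ((2 * (1 - t) : ℝ) * Complex.exp ((t * l * y : ℝ) * Complex.I) *
        G ((t * l : ℝ) * Complex.I)).re := by
  have hC0 : 0 ≤ C := (abs_nonneg _).trans (hC 0)
  have L1 : Tendsto (fun δ : ℝ => ∫ u in Ioi (0:ℝ), f u * Real.exp (-δ * u) * fejK (l * (y - u)))
      (𝓝[>] 0) (𝓝 (∫ u in Ioi (0:ℝ), f u * fejK (l * (y - u)))) := by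
    refine tendsto_integral_filter_of_dominated_convergence
      (fun u => C * fejK (l * (y - u))) ?_ ?_ ?_ ?_
    · refine Eventually.of_forall fun δ => Measurable.aestronglyMeasurable ?_
      have := fejK_continuous.measurable
      fun_prop
    · filter_upwards [self_mem_nhdsWithin] with δ hδ
      filter_upwards [ae_restrict_mem measurableSet_Ioi] with u hu
      have hδ' : 0 < δ := hδ
      have hu' : 0 < u := hu
      simp only [norm_mul, Real.norm_eq_abs, Real.abs_exp]
      rw [abs_of_nonneg (fejK_nonneg _)]
      refine mul_le_mul_of_nonneg_right ?_ (fejK_nonneg _)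
      have : Real.exp (-δ * u) ≤ 1 := by
        rw [Real.exp_le_one_iff]; nlinarith
      calc |f u| * Real.exp (-δ * u) ≤ C * 1 :=
            mul_le_mul (hC u) this (Real.exp_pos _).le hC0
        _ = C := mul_one C
    · exact ((fejK_comp_integrable hl y).const_mul C).integrableOn
    · refine Eventually.of_forall fun u => ?_
      have : Continuous (fun δ : ℝ => f u * Real.exp (-δ * u) * fejK (l * (y - u))) := by fun_prop
      have h := (this.tendsto 0).mono_left (nhdsWithin_le_nhds (s := Ioi 0))
      simpa using h
  have hcpt : IsCompact ((fun p : ℝ × ℝ => (p.1 : ℂ) + (p.2 * l : ℝ) * Complex.I) ''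
      (Icc (0:ℝ) 1 ×ˢ Icc (0:ℝ) 1)) := by
    apply (isCompact_Icc.prod isCompact_Icc).image
    fun_prop
  have hsub : ((fun p : ℝ × ℝ => (p.1 : ℂ) + (p.2 * l : ℝ) * Complex.I) ''
      (Icc (0:ℝ) 1 ×ˢ Icc (0:ℝ) 1)) ⊆ {s | 0 ≤ s.re} := by
    rintro _ ⟨p, hp, rfl⟩
    simpa using hp.1.1
  obtain ⟨M, hM⟩ := hcpt.exists_bound_of_continuousOn (hGc.mono hsub)
  have L2 : Tendsto (fun δ : ℝ => ∫ t in (0:ℝ)..1, ((2 * (1 - t) : ℝ) *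
        Complex.exp ((t * l * y : ℝ) * Complex.I) * G (δ + (t * l : ℝ) * Complex.I)).re)
      (𝓝[>] 0) (𝓝 (∫ t in (0:ℝ)..1, ((2 * (1 - t) : ℝ) *
        Complex.exp ((t * l * y : ℝ) * Complex.I) * G ((t * l : ℝ) * Complex.I)).re)) := by
    refine intervalIntegral.tendsto_integral_filter_of_dominated_convergence
      (fun _ => 2 * M) ?_ ?_ ?_ ?_
    · filter_upwards [self_mem_nhdsWithin] with δ hδ
      apply Continuous.aestronglyMeasurable
      have : Continuous (fun t : ℝ => G (δ + (t * l : ℝ) * Complex.I)) := by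
        refine hGc.comp_continuous (by fun_prop) fun t => ?_
        simpa using (le_of_lt hδ)
      exact Complex.continuous_re.comp (Continuous.mul (by fun_prop) this)
    · have : ∀ᶠ δ : ℝ in 𝓝[>] 0, δ < 1 := nhdsWithin_le_nhds (Iio_mem_nhds zero_lt_one)
      filter_upwards [self_mem_nhdsWithin, this] with δ hδ hδ1
      refine Eventually.of_forall fun t ht => ?_
      rw [uIoc_of_le zero_le_one] at ht
      have hm := hM _ ⟨(δ, t), ⟨⟨le_of_lt hδ, hδ1.le⟩, ⟨ht.1.le, ht.2⟩⟩, rfl⟩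
      refine (Complex.abs_re_le_norm _).trans ?_
      rw [norm_mul, norm_mul, Complex.norm_exp_ofReal_mul_I, Complex.norm_real, mul_one,
        Real.norm_eq_abs]
      have : |2 * (1 - t)| ≤ 2 := by rw [abs_le]; constructor <;> linarith [ht.1, ht.2]
      exact mul_le_mul this hm (norm_nonneg _) (by norm_num)
    · exact intervalIntegrable_const
    · refine Eventually.of_forall fun t ht => ?_
      have h0 : Tendsto (fun δ : ℝ => G (δ + (t * l : ℝ) * Complex.I)) (𝓝[>] 0)
          (𝓝 (G ((t * l : ℝ) * Complex.I))) := by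
        have hw := hGc ((t * l : ℝ) * Complex.I) (by simp)
        refine hw.tendsto.comp (tendsto_nhdsWithin_iff.2 ⟨?_, ?_⟩)
        · have : Continuous (fun δ : ℝ => (δ : ℂ) + (t * l : ℝ) * Complex.I) := by fun_prop
          have h := (this.tendsto 0).mono_left (nhdsWithin_le_nhds (s := Ioi 0))
          simpa using h
        · filter_upwards [self_mem_nhdsWithin] with δ hδ
          simpa using (le_of_lt hδ)
      exact (Complex.continuous_re.tendsto _).comp (h0.const_mul _)
  refine tendsto_nhds_unique L1 (L2.congr' ?_)
  filter_upwards [self_mem_nhdsWithin] with δ hδ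
  exact (smooth_ident hf hC hG l y hδ).symm

lemma smooth_tendsto {f : ℝ → ℝ} (hf : Measurable f) {C : ℝ} (hC : ∀ u, |f u| ≤ C)
    {G : ℂ → ℂ} (hGc : ContinuousOn G {s | 0 ≤ s.re})
    (hG : ∀ s : ℂ, 0 < s.re → ∫ u in Ioi (0:ℝ), (f u : ℂ) * Complex.exp (-s * u) = G s)
    {l : ℝ} (hl : 0 < l) :
    Tendsto (fun y => ∫ u in Ioi (0:ℝ), f u * fejK (l * (y - u))) atTop (𝓝 0) := by
  simp_rw [smooth_ident_zero hf hC hGc hG hl]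
  have hc : Continuous (fun t : ℝ => G ((t * l : ℝ) * Complex.I)) := by
    refine hGc.comp_continuous (by fun_prop) fun t => ?_
    simp
  set g : ℝ → ℂ := (Ioc (0:ℝ) 1).indicator
    (fun t => (2 * (1 - t) : ℝ) * G ((t * l : ℝ) * Complex.I)) with hg
  have RL := Real.tendsto_integral_exp_smul_cocompact g
  have hw : Tendsto (fun y : ℝ => -(l * y / (2 * Real.pi))) atTop (cocompact ℝ) := by
    have : Tendsto (fun y : ℝ => -(l * y / (2 * Real.pi))) atTop atBot := by
      refine tendsto_neg_atTop_atBot.comp ?_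
      exact (tendsto_id.const_mul_atTop hl).atTop_div_const (by positivity)
    exact this.mono_right atBot_le_cocompact
  have h2 := (Complex.continuous_re.tendsto _).comp (RL.comp hw)
  rw [Complex.zero_re] at h2
  refine h2.congr fun y => ?_
  have hii : Integrable (fun t : ℝ => ((2 * (1 - t) : ℝ) *
        Complex.exp ((t * l * y : ℝ) * Complex.I) * G ((t * l : ℝ) * Complex.I)))
        (volume.restrict (Ioc (0:ℝ) 1)) := by
    refine (Continuous.integrableOn_Icc (Continuous.mul (by fun_prop) hc)).mono_set Ioc_subset_Icc_self
  have hre := integral_re hii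
  simp only [RCLike.re_eq_complex_re] at hre
  rw [intervalIntegral.integral_of_le zero_le_one, hre, ← integral_indicator measurableSet_Ioc]
  simp only [Function.comp]
  congr 2
  ext t
  by_cases ht : t ∈ Ioc (0:ℝ) 1
  · simp only [hg, indicator_of_mem ht]
    rw [Circle.smul_def, Real.fourierChar_apply, smul_eq_mul]
    rw [show 2 * Real.pi * -(t * -(l * y / (2 * Real.pi))) = t * l * y by
      have := Real.pi_pos; field_simp]
    ring
  · simp only [hg, indicator_of_notMem ht, smul_zero]

lemma tauber_window {f : ℝ → ℝ} (hf : Measurable f) {C : ℝ} (hC : ∀ u, |f u| ≤ C)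
    (hT : ∀ l : ℝ, 0 < l →
      Tendsto (fun y => ∫ u in Ioi (0:ℝ), f u * fejK (l * (y - u))) atTop (𝓝 0))
    {c η : ℝ} (hc : 0 < c) (hη : 0 < η) :
    ∀ᶠ y in atTop, ∃ u ∈ Icc (y - η) (y + η), -c < f u := by
  have hC0 : 0 ≤ C := (abs_nonneg _).trans (hC 0)
  set T := ∫ x, fejK x with hTdef
  have hTpos : 0 < T := fejK_integral_pos
  have hlim : Tendsto (fun r : ℝ => ∫ x in (-r)..r, fejK x) atTop (𝓝 T) :=
    intervalIntegral_tendsto_integral fejK_integrable tendsto_neg_atTop_atBot tendsto_id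
  have hlt : C * T / (C + c) < T := by
    rw [div_lt_iff₀ (by positivity)]; nlinarith
  obtain ⟨r, hr1, hr0⟩ := ((hlim.eventually (lt_mem_nhds hlt)).and (eventually_gt_atTop 0)).exists
  set l := r / η with hl
  have hlpos : 0 < l := by positivity
  set W := ∫ x in (-r)..r, fejK x with hW
  have hgap : C * T < (C + c) * W := by
    rw [div_lt_iff₀ (by positivity)] at hr1; linarith
  have hε : 0 < l⁻¹ * ((C + c) * W - C * T) := by
    have : 0 < l⁻¹ := by positivity
    apply mul_pos this; linarith
  filter_upwards [(hT l hlpos).eventually (lt_mem_nhds (neg_lt_zero.2 hε)),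
    eventually_gt_atTop η] with y hy hyη
  by_contra hcon
  push Not at hcon
  have hKi := fejK_comp_integrable hlpos y
  have hK0 : ∀ u, 0 ≤ fejK (l * (y - u)) := fun u => fejK_nonneg _
  have htot : ∫ u, fejK (l * (y - u)) = l⁻¹ * T := by
    rw [integral_sub_left_eq_self (fun u => fejK (l * u)) volume y,
      Measure.integral_comp_mul_left, abs_of_pos (by positivity), smul_eq_mul]
  have hwin : ∫ u in Icc (y - η) (y + η), fejK (l * (y - u)) = l⁻¹ * W := by
    rw [integral_Icc_eq_integral_Ioc, ← intervalIntegral.integral_of_le (by linarith),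
      intervalIntegral.integral_comp_sub_left (fun u => fejK (l * u)),
      intervalIntegral.integral_comp_mul_left _ hlpos.ne', smul_eq_mul, hW]
    congr 2
    · rw [hl]; field_simp; ring
    · rw [hl]; field_simp; ring
  have hfi : IntegrableOn (fun u => f u * fejK (l * (y - u))) (Ioi 0) := by
    refine (hKi.const_mul C).integrableOn.mono' ?_ ?_
    · have := fejK_continuous.measurable
      apply Measurable.aestronglyMeasurable
      fun_prop
    · refine Eventually.of_forall fun u => ?_
      rw [norm_mul, Real.norm_eq_abs, Real.norm_eq_abs, abs_of_nonneg (hK0 u)]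
      exact mul_le_mul_of_nonneg_right (hC u) (hK0 u)
  have hindi : IntegrableOn (fun u => C * fejK (l * (y - u)) -
      (Icc (y - η) (y + η)).indicator (fun u => (C + c) * fejK (l * (y - u))) u) (Ioi 0) :=
    ((hKi.const_mul C).sub ((hKi.const_mul (C + c)).indicator measurableSet_Icc)).integrableOn
  have hle : ∫ u in Ioi (0:ℝ), f u * fejK (l * (y - u)) ≤
      ∫ u in Ioi (0:ℝ), (C * fejK (l * (y - u)) -
      (Icc (y - η) (y + η)).indicator (fun u => (C + c) * fejK (l * (y - u))) u) := by
    refine integral_mono hfi hindi fun u => ?_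
    simp only
    by_cases hu : u ∈ Icc (y - η) (y + η)
    · rw [indicator_of_mem hu]
      have := mul_le_mul_of_nonneg_right (hcon u hu) (hK0 u)
      linarith
    · rw [indicator_of_notMem hu]
      have := mul_le_mul_of_nonneg_right ((le_abs_self _).trans (hC u)) (hK0 u)
      linarith
  rw [integral_sub (hKi.const_mul C).integrableOn
    ((hKi.const_mul (C + c)).indicator measurableSet_Icc).integrableOn,
    integral_const_mul, setIntegral_indicator measurableSet_Icc,
    inter_eq_self_of_subset_right, integral_const_mul, hwin] at hle
  · have h3 : ∫ u in Ioi (0:ℝ), fejK (l * (y - u)) ≤ l⁻¹ * T := by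
      rw [← htot]
      exact setIntegral_le_integral hKi (Eventually.of_forall hK0)
    have := mul_le_mul_of_nonneg_left h3 hC0
    nlinarith
  · intro u hu
    have := hu.1
    simp only [mem_Ioi]; linarith

noncomputable def psiB (u : ℝ) : ℝ := Chebyshev.psi (Real.exp u) * Real.exp (-u)

lemma psiB_nonneg (u : ℝ) : 0 ≤ psiB u :=
  mul_nonneg (Chebyshev.psi_nonneg _) (Real.exp_pos _).le

lemma psiB_le (u : ℝ) : psiB u ≤ Real.log 4 + 4 := by
  unfold psiB
  have := Chebyshev.psi_le_const_mul_self (Real.exp_pos u).le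
  calc _ ≤ (Real.log 4 + 4) * Real.exp u * Real.exp (-u) :=
        mul_le_mul_of_nonneg_right this (Real.exp_pos _).le
    _ = _ := by rw [mul_assoc, ← Real.exp_add]; simp

lemma psiB_measurable : Measurable psiB := by
  unfold psiB
  have := Chebyshev.psi_mono.measurable
  fun_prop

lemma psiB_mono {u v : ℝ} (h : u ≤ v) : psiB u ≤ psiB v * Real.exp (v - u) := by
  unfold psiB
  rw [mul_assoc, ← Real.exp_add, show -v + (v - u) = -u by ring]
  exact mul_le_mul_of_nonneg_right (Chebyshev.psi_mono (Real.exp_le_exp.2 h)) (Real.exp_pos _).le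

noncomputable def auxG (s : ℂ) : ℂ :=
  (ArithmeticFunction.vonMangoldt.LFunctionResidueClassAux (q := 1) 1 (1 + s) - 1) / (1 + s)

lemma auxG_cont : ContinuousOn auxG {s | 0 ≤ s.re} := by
  unfold auxG
  have h := ArithmeticFunction.vonMangoldt.continuousOn_LFunctionResidueClassAux (q := 1) 1
  refine ContinuousOn.div (ContinuousOn.sub (h.comp (by fun_prop) ?_) continuousOn_const)
    (by fun_prop) ?_
  · intro s hs
    simpa using hs
  · intro s hs h0
    have := congrArg Complex.re h0
    simp at this hs
    linarith

lemma laplace_psiB {s : ℂ} (hs : 0 < s.re) :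
    LSeries (fun n => (ArithmeticFunction.vonMangoldt n : ℂ)) (1 + s) =
      (1 + s) * ∫ u in Ioi (0:ℝ), (psiB u : ℂ) * Complex.exp (-s * u) := by
  have hsum : ∀ x : ℝ, ∑ k ∈ Finset.Icc 1 ⌊x⌋₊, ArithmeticFunction.vonMangoldt k = Chebyshev.psi x := by
    intro x; rfl
  rw [LSeries_eq_mul_integral_of_nonneg _ (r := 1) zero_le_one (by simpa using hs) _
    (fun n => ArithmeticFunction.vonMangoldt_nonneg)]
  · congr 1
    have himg : Real.exp '' (Ioi 0) = Ioi 1 := by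
      ext x
      simp only [mem_image, mem_Ioi]
      constructor
      · rintro ⟨u, hu, rfl⟩; exact Real.one_lt_exp_iff.2 hu
      · intro hx; exact ⟨Real.log x, Real.log_pos hx, Real.exp_log (by linarith)⟩
    rw [← himg, integral_image_eq_integral_abs_deriv_smul measurableSet_Ioi
      (fun x _ => (Real.hasDerivAt_exp x).hasDerivWithinAt) Real.exp_injective.injOn]
    refine integral_congr_ae (Eventually.of_forall fun u => ?_)
    simp only
    rw [← Complex.ofReal_sum, hsum, abs_of_pos (Real.exp_pos u), psiB, Complex.real_smul]
    have : ((Real.exp u : ℝ) : ℂ) ^ (-(1 + s + 1)) = Complex.exp (-(1 + s + 1) * u) := by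
      rw [Complex.cpow_def_of_ne_zero (by exact_mod_cast (Real.exp_pos u).ne'),
        ← Complex.ofReal_log (Real.exp_pos u).le, Real.log_exp, mul_comm]
    rw [this]
    push_cast
    rw [show -(1 + s + 1) * (u:ℂ) = -u + -u + -s * u by ring, Complex.exp_add, Complex.exp_add]
    have h1 : Complex.exp u * Complex.exp (-u) = 1 := by rw [← Complex.exp_add]; simp
    linear_combination ((Chebyshev.psi (Real.exp u) : ℝ) : ℂ) * Complex.exp (-u) * Complex.exp (-s * u) * h1
  · refine Asymptotics.IsBigO.of_bound (Real.log 4 + 4) (Eventually.of_forall fun n => ?_)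
    have h1 := hsum n
    rw [Nat.floor_natCast] at h1
    rw [h1, Real.rpow_one, Real.norm_of_nonneg (Chebyshev.psi_nonneg _), Real.norm_natCast]
    exact Chebyshev.psi_le_const_mul_self (Nat.cast_nonneg n)

lemma laplace_f {s : ℂ} (hs : 0 < s.re) :
    ∫ u in Ioi (0:ℝ), ((psiB u - 1 : ℝ) : ℂ) * Complex.exp (-s * u) = auxG s := by
  have hs0 : s ≠ 0 := by rintro rfl; simp at hs
  have hs1 : 1 + s ≠ 0 := by
    intro h
    have := congrArg Complex.re h
    simp at this; linarith
  have hexp : IntegrableOn (fun u : ℝ => Complex.exp (-s * u)) (Ioi 0) :=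
    integrableOn_exp_mul_complex_Ioi (by simpa using hs) 0
  have hB : IntegrableOn (fun u : ℝ => (psiB u : ℂ) * Complex.exp (-s * u)) (Ioi 0) := by
    have := psiB_measurable
    refine (hexp.norm.const_mul (Real.log 4 + 4)).mono' ?_ ?_
    · apply Measurable.aestronglyMeasurable; fun_prop
    · refine Eventually.of_forall fun u => ?_
      rw [norm_mul, Complex.norm_real, Real.norm_of_nonneg (psiB_nonneg u)]
      exact mul_le_mul_of_nonneg_right (psiB_le u) (norm_nonneg _)
  have h1 : ∫ u in Ioi (0:ℝ), Complex.exp (-s * u) = 1 / s := by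
    rw [integral_exp_mul_complex_Ioi (by simpa using hs)]
    simp [neg_div_neg_eq]
  have h2 := ArithmeticFunction.vonMangoldt.eqOn_LFunctionResidueClassAux (q := 1) (a := 1)
    isUnit_one (x := 1 + s) (by simpa using hs)
  have h3 : (fun n : ℕ => ((ArithmeticFunction.vonMangoldt.residueClass (1 : ZMod 1) n : ℝ) : ℂ)) =
      fun n => (ArithmeticFunction.vonMangoldt n : ℂ) := by
    ext n
    congr 1
    unfold ArithmeticFunction.vonMangoldt.residueClass
    rw [indicator_of_mem]
    exact Subsingleton.elim _ _
  simp only at h2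
  rw [h3, laplace_psiB hs] at h2
  unfold auxG
  rw [h2]
  have : ∀ u : ℝ, ((psiB u - 1 : ℝ) : ℂ) * Complex.exp (-s * u) =
    (psiB u : ℂ) * Complex.exp (-s * u) - Complex.exp (-s * u) := by
    intro u; push_cast; ring
  simp_rw [this]
  rw [integral_sub hB hexp, h1]
  simp
  field_simp
  ring

lemma psiB_tendsto : Tendsto psiB atTop (𝓝 1) := by
  have hlog : 0 ≤ Real.log 4 := Real.log_nonneg (by norm_num)
  have hb : ∀ u, |psiB u - 1| ≤ Real.log 4 + 5 := by
    intro u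
    have := psiB_nonneg u
    have := psiB_le u
    rw [abs_le]; constructor <;> linarith
  have hm : Measurable (fun u => psiB u - 1) := psiB_measurable.sub_const 1
  have hT : ∀ l : ℝ, 0 < l →
      Tendsto (fun y => ∫ u in Ioi (0:ℝ), (psiB u - 1) * fejK (l * (y - u))) atTop (𝓝 0) :=
    fun l hl => smooth_tendsto hm hb auxG_cont (fun s hs => laplace_f hs) hl
  have hT' : ∀ l : ℝ, 0 < l →
      Tendsto (fun y => ∫ u in Ioi (0:ℝ), (-(psiB u - 1)) * fejK (l * (y - u))) atTop (𝓝 0) := by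
    intro l hl
    have := (hT l hl).neg
    rw [neg_zero] at this
    refine this.congr fun y => ?_
    rw [← integral_neg]
    simp only [neg_mul]
  rw [Metric.tendsto_nhds]
  intro ε hε
  have c1 : Tendsto (fun η : ℝ => (1 + ε / 2) * Real.exp (2 * η)) (𝓝[>] 0) (𝓝 (1 + ε / 2)) := by
    have : Continuous (fun η : ℝ => (1 + ε / 2) * Real.exp (2 * η)) := by fun_prop
    simpa using (this.tendsto 0).mono_left (nhdsWithin_le_nhds (s := Ioi 0))
  have c2 : Tendsto (fun η : ℝ => (1 - ε / 2) * Real.exp (-(2 * η))) (𝓝[>] 0) (𝓝 (1 - ε / 2)) := by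
    have : Continuous (fun η : ℝ => (1 - ε / 2) * Real.exp (-(2 * η))) := by fun_prop
    simpa using (this.tendsto 0).mono_left (nhdsWithin_le_nhds (s := Ioi 0))
  obtain ⟨η, ⟨h1, h2⟩, hη⟩ := (((c1.eventually (gt_mem_nhds (show 1 + ε / 2 < 1 + ε by linarith))).and
    (c2.eventually (lt_mem_nhds (show 1 - ε < 1 - ε / 2 by linarith)))).and
    (self_mem_nhdsWithin)).exists
  have hη' : 0 < η := hη
  have w1 := tauber_window hm hb hT (half_pos hε) hη'
  have w2 := tauber_window hm.neg (fun u => by simpa [abs_sub_comm] using hb u) hT' (half_pos hε) hη'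
  have w1' := (tendsto_atTop_add_const_right atTop (-η) tendsto_id).eventually w1
  have w2' := (tendsto_atTop_add_const_right atTop η tendsto_id).eventually w2
  filter_upwards [w1', w2'] with y hy1 hy2
  obtain ⟨u, ⟨hu1, hu2⟩, hu⟩ := hy1
  obtain ⟨v, ⟨hv1, hv2⟩, hv⟩ := hy2
  simp only [id, Pi.neg_apply] at *
  rw [Real.dist_eq, abs_lt]
  constructor
  · have m := psiB_mono (show u ≤ y by linarith)
    have e : Real.exp (y - u) ≤ Real.exp (2 * η) := Real.exp_le_exp.2 (by linarith)
    have m2 : psiB u ≤ psiB y * Real.exp (2 * η) :=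
      m.trans (mul_le_mul_of_nonneg_left e (psiB_nonneg y))
    have m3 : psiB u * Real.exp (-(2 * η)) ≤ psiB y := by
      have := mul_le_mul_of_nonneg_right m2 (Real.exp_pos (-(2 * η))).le
      rwa [mul_assoc, ← Real.exp_add, add_neg_cancel, Real.exp_zero, mul_one] at this
    have m4 : (1 - ε / 2) * Real.exp (-(2 * η)) ≤ psiB u * Real.exp (-(2 * η)) :=
      mul_le_mul_of_nonneg_right (by linarith) (Real.exp_pos _).le
    linarith
  · have m := psiB_mono (show y ≤ v by linarith)
    have e : Real.exp (v - y) ≤ Real.exp (2 * η) := Real.exp_le_exp.2 (by linarith)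
    have m2 : psiB y ≤ psiB v * Real.exp (2 * η) :=
      m.trans (mul_le_mul_of_nonneg_left e (psiB_nonneg v))
    have m4 : psiB v * Real.exp (2 * η) ≤ (1 + ε / 2) * Real.exp (2 * η) :=
      mul_le_mul_of_nonneg_right (by linarith) (Real.exp_pos _).le
    linarith

lemma psi_div_tendsto : Tendsto (fun x : ℝ => Chebyshev.psi x / x) atTop (𝓝 1) := by
  refine (psiB_tendsto.comp Real.tendsto_log_atTop).congr' ?_
  filter_upwards [eventually_gt_atTop 0] with x hx
  simp [psiB, Real.exp_log hx, Real.exp_neg, div_eq_mul_inv]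

lemma theta_div_tendsto : Tendsto (fun x : ℝ => Chebyshev.theta x / x) atTop (𝓝 1) := by
  obtain ⟨C, hC⟩ := Chebyshev.psi_sub_theta_le_mul_sqrt
  have h0 : Tendsto (fun x : ℝ => C * (Real.sqrt x)⁻¹) atTop (𝓝 0) := by
    simpa using (tendsto_inv_atTop_zero.comp Real.tendsto_sqrt_atTop).const_mul C
  have h1 : Tendsto (fun x : ℝ => (Chebyshev.psi x - Chebyshev.theta x) / x) atTop (𝓝 0) := by
    refine squeeze_zero' ?_ ?_ h0
    · filter_upwards [eventually_gt_atTop 0] with x hx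
      exact div_nonneg (sub_nonneg.2 (Chebyshev.theta_le_psi x)) hx.le
    · filter_upwards [eventually_gt_atTop 0] with x hx
      rw [div_le_iff₀ hx]
      refine (hC x).trans (le_of_eq ?_)
      have h := Real.sq_sqrt hx.le
      have h' := Real.sqrt_pos.2 hx
      rw [mul_assoc]
      congr 1
      rw [eq_inv_mul_iff_mul_eq₀ h'.ne']
      nlinarith
  have := psi_div_tendsto.sub h1
  rw [sub_zero] at this
  refine this.congr fun x => ?_
  ring

lemma pnt : Tendsto (fun x : ℝ => (Nat.primeCounting ⌊x⌋₊ : ℝ) * Real.log x / x) atTop (𝓝 1) := by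
  obtain ⟨c, hc⟩ := Chebyshev.primeCounting_sub_theta_div_log_isBigO.bound
  have h0 : Tendsto (fun x : ℝ => c * (Real.log x)⁻¹) atTop (𝓝 0) := by
    simpa using (tendsto_inv_atTop_zero.comp Real.tendsto_log_atTop).const_mul c
  have h1 : Tendsto (fun x : ℝ => ((Nat.primeCounting ⌊x⌋₊ : ℝ) - Chebyshev.theta x / Real.log x) *
      (Real.log x / x)) atTop (𝓝 0) := by
    refine squeeze_zero_norm' ?_ h0
    filter_upwards [hc, eventually_gt_atTop 1] with x hx hx1
    have hl := Real.log_pos hx1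
    rw [norm_mul, Real.norm_of_nonneg (show 0 ≤ Real.log x / x by positivity)]
    rw [Real.norm_of_nonneg (show 0 ≤ x / Real.log x ^ 2 by positivity)] at hx
    refine (mul_le_mul_of_nonneg_right hx (by positivity)).trans (le_of_eq ?_)
    field_simp
  have := h1.add theta_div_tendsto
  rw [zero_add] at this
  refine this.congr' ?_
  filter_upwards [eventually_gt_atTop 1] with x hx1
  have hl := Real.log_pos hx1
  field_simp
  ring

lemma S_lower (S : ℕ → ℤ) (hS : ∀ m : ℕ, 0 < m → IsS m (S m)) {ε : ℝ} (hε : 0 < ε) (hε1 : ε < 1) :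
    ∀ᶠ m : ℕ in atTop, Real.exp ((1 - ε) * m) ≤ (S m : ℝ) := by
  have hx : Tendsto (fun m : ℕ => Real.exp ((1 - ε / 2) * m)) atTop atTop :=
    Real.tendsto_exp_atTop.comp (tendsto_natCast_atTop_atTop.const_mul_atTop (by linarith))
  have e1 := hx.eventually (pnt.eventually (lt_mem_nhds (show 1 - ε / 4 < 1 by linarith)))
  have hy : Tendsto (fun m : ℕ => Real.exp (ε / 2 * m)) atTop atTop :=
    Real.tendsto_exp_atTop.comp (tendsto_natCast_atTop_atTop.const_mul_atTop (by linarith))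
  filter_upwards [e1, hy.eventually_ge_atTop (4 / ε), eventually_gt_atTop 0] with m h1 h2 hm
  set x := Real.exp ((1 - ε / 2) * m) with hxdef
  have hxpos : 0 < x := Real.exp_pos _
  have hm' : (0:ℝ) < m := by exact_mod_cast hm
  rw [hxdef, Real.log_exp, ← hxdef, lt_div_iff₀ hxpos] at h1
  set k := Nat.primeCounting ⌊x⌋₊ with hk
  have hkm : (1 + ε / 4) * x ≤ k * m := by
    have a : (1 + ε / 4) * (1 - ε / 2) * x ≤ (1 - ε / 4) * x :=
      mul_le_mul_of_nonneg_right (by nlinarith) hxpos.le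
    have b : (1 - ε / 2) * ((1 + ε / 4) * x) ≤ (1 - ε / 2) * (k * m) := by nlinarith
    exact le_of_mul_le_mul_left b (by linarith)
  have hk0 : 0 < k := by
    rcases Nat.eq_zero_or_pos k with h | h
    · rw [h] at hkm
      have : 0 < (1 + ε / 4) * x := by positivity
      simp at hkm; linarith
    · exact h
  have hp : (nthPrime k : ℝ) ≤ x := by
    have : nthPrime k < ⌊x⌋₊ + 1 := by
      unfold nthPrime
      apply Nat.nth_lt_of_lt_count
      have : Nat.count Nat.Prime (⌊x⌋₊ + 1) = k := rfl
      omega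
    exact (Nat.le_floor_iff hxpos.le).1 (by omega)
  have hle : (k : ℤ) * m - nthPrime k ≤ S m := (hS m hm).2 ⟨k, hk0, rfl⟩
  have hle' : (k : ℝ) * m - nthPrime k ≤ S m := by exact_mod_cast hle
  have : Real.exp ((1 - ε) * m) ≤ ε / 4 * x := by
    have hsplit : x = Real.exp ((1 - ε) * m) * Real.exp (ε / 2 * m) := by
      rw [hxdef, ← Real.exp_add]; congr 1; ring
    rw [hsplit]
    have h3 : 1 ≤ ε / 4 * Real.exp (ε / 2 * m) := by
      rw [div_le_iff₀ hε] at h2; linarith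
    have := Real.exp_pos ((1 - ε) * m)
    nlinarith
  linarith

lemma S_upper (S : ℕ → ℤ) (hS : ∀ m : ℕ, 0 < m → IsS m (S m)) {ε : ℝ} (hε : 0 < ε) :
    ∀ᶠ m : ℕ in atTop, (S m : ℝ) ≤ Real.exp ((1 + ε) * m) := by
  obtain ⟨X, hX⟩ := eventually_atTop.1
    (pnt.eventually (gt_mem_nhds (show 1 < 1 + ε / 2 by linarith)))
  have hx : Tendsto (fun m : ℕ => Real.exp ((1 + ε / 2) * m)) atTop atTop :=
    Real.tendsto_exp_atTop.comp (tendsto_natCast_atTop_atTop.const_mul_atTop (by linarith))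
  have hy : Tendsto (fun m : ℕ => Real.exp (ε / 2 * m) / (ε / 2 * m)) atTop atTop := by
    have := (Real.tendsto_exp_div_pow_atTop 1).comp
      (Tendsto.const_mul_atTop (half_pos hε) (tendsto_natCast_atTop_atTop (R := ℝ)))
    simpa [Function.comp_def] using this
  filter_upwards [hx.eventually_ge_atTop X, hy.eventually_ge_atTop (2 / ε),
    eventually_gt_atTop 0] with m h1 h2 hm
  have hm' : (0:ℝ) < m := by exact_mod_cast hm
  obtain ⟨⟨k, hk0, hk⟩, -⟩ := hS m hm
  have hk' : (S m : ℝ) = k * m - nthPrime k := by rw [hk]; push_cast; ring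
  rw [hk']
  set p := nthPrime k with hp
  have hkp : k ≤ p := by
    have := Nat.add_two_le_nth_prime (k - 1)
    rw [hp, nthPrime]; omega
  have hpi : Nat.primeCounting p = k := by
    have h := Nat.count_nth_succ_of_infinite Nat.infinite_setOfPred_prime (k - 1)
    have h' : Nat.primeCounting p = k - 1 + 1 := h
    omega
  have hppos : (0:ℝ) < p := by exact_mod_cast (by omega : 0 < p)
  rcases le_or_gt (p : ℝ) (Real.exp ((1 + ε / 2) * m)) with h | h
  · have hmle : (m : ℝ) ≤ Real.exp (ε / 2 * m) := by
      rw [le_div_iff₀ (by positivity)] at h2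
      have : 2 / ε * (ε / 2 * m) = (m:ℝ) := by field_simp
      linarith
    have hkx : (k : ℝ) ≤ Real.exp ((1 + ε / 2) * m) := le_trans (by exact_mod_cast hkp) h
    have : (k : ℝ) * m ≤ Real.exp ((1 + ε / 2) * m) * Real.exp (ε / 2 * m) := by gcongr
    rw [← Real.exp_add, show (1 + ε / 2) * (m:ℝ) + ε / 2 * m = (1 + ε) * m by ring] at this
    linarith
  · have h3 := hX p (by linarith)
    rw [Nat.floor_natCast, hpi, div_lt_iff₀ hppos] at h3
    have h4 : (1 + ε / 2) * m < Real.log p := (Real.lt_log_iff_exp_lt hppos).2 h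
    have h5 : (k : ℝ) * ((1 + ε / 2) * m) ≤ k * Real.log p := by gcongr
    have h6 : (1 + ε / 2) * (k * m) ≤ (1 + ε / 2) * p := by linarith
    have h7 : (k : ℝ) * m ≤ p := le_of_mul_le_mul_left h6 (by linarith)
    have := Real.exp_pos ((1 + ε) * m)
    linarith

theorem stmt6 (S : ℕ → ℤ) (hS : ∀ m : ℕ, 0 < m → IsS m (S m)) :
    Filter.Tendsto (fun m : ℕ => ((S m : ℝ)) ^ ((1 : ℝ) / (m : ℝ)))
      Filter.atTop (nhds (Real.exp 1)) := by
  have key : Tendsto (fun m : ℕ => Real.log (S m) / m) atTop (𝓝 1) := by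
    rw [Metric.tendsto_nhds]
    intro ε hε
    have hδ : 0 < min (ε / 2) (1 / 2) := by positivity
    have hδ1 : min (ε / 2) (1 / 2) < 1 := lt_of_le_of_lt (min_le_right _ _) (by norm_num)
    have hδ2 : min (ε / 2) (1 / 2) ≤ ε / 2 := min_le_left _ _
    filter_upwards [S_lower S hS hδ hδ1, S_upper S hS hδ, eventually_gt_atTop 0] with m h1 h2 hm
    have hm' : (0:ℝ) < m := by exact_mod_cast hm
    have hpos : (0:ℝ) < S m := (Real.exp_pos _).trans_le h1
    have l1 := (Real.le_log_iff_exp_le hpos).2 h1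
    have l2 := (Real.log_le_iff_le_exp hpos).2 h2
    rw [← le_div_iff₀ hm'] at l1
    rw [← div_le_iff₀ hm'] at l2
    rw [Real.dist_eq, abs_lt]
    constructor <;> linarith
  refine ((Real.continuous_exp.tendsto 1).comp key).congr' ?_
  filter_upwards [S_lower S hS (ε := 1 / 2) (by norm_num) (by norm_num)] with m h1
  have hpos : (0:ℝ) < S m := (Real.exp_pos _).trans_le h1
  rw [Real.rpow_def_of_pos hpos]
  simp [div_eq_mul_inv]
end
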